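/- The cone cCat of the extended Catalan arrangement is a free arrangement: the module D(cCat) of logarithmic vector fields on ℂ^{N+1} = {(x_1,…,x_N,z)} — vector fields L = Σ_{i=1}^N g_i ∂_{x_i} + g_0 ∂_z with polynomial coefficients such that ((α,x) − jz) divides L((α,x) − jz) for every α ∈ R_+ and −m_α ≤ j ≤ m_α, and z divides L(z) — is a free ℂ[x_1,…,x_N,z]-module (of rank N+1). -/

import Mathlib

open MvPolynomial

noncomputable section

/-- The linear polynomial with coefficient vector `a`. -/
def linPoly {n : ℕ} (a : Fin n → ℂ) : MvPolynomial (Fin n) ℂ :=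
  ∑ i, MvPolynomial.C (a i) * MvPolynomial.X i

/-- Coefficient vector of the linear form `(α,x) − j z` on `ℂ^{N+1}`. -/
def coneVec {N : ℕ} (a : Fin N → ℝ) (j : ℤ) : Fin (N + 1) → ℂ :=
  Fin.snoc (fun i => ((a i : ℝ) : ℂ)) (-(j : ℂ))

/-- Polynomials in `n` variables over `ℂ`. -/
abbrev Pol (n : ℕ) := MvPolynomial (Fin n) ℂ

section Linear

variable {n : ℕ}

theorem linPoly_add (a b : Fin n → ℂ) : linPoly (a + b) = linPoly a + linPoly b := by
  simp [linPoly, add_mul, Finset.sum_add_distrib]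

theorem linPoly_smul (c : ℂ) (a : Fin n → ℂ) : linPoly (c • a) = C c * linPoly a := by
  simp [linPoly, Finset.mul_sum, mul_assoc]

theorem linPoly_neg (a : Fin n → ℂ) : linPoly (-a) = -linPoly a := by
  simp [linPoly]

theorem linPoly_sub (a b : Fin n → ℂ) : linPoly (a - b) = linPoly a - linPoly b := by
  rw [sub_eq_add_neg, linPoly_add, linPoly_neg, sub_eq_add_neg]

theorem linPoly_zero : linPoly (0 : Fin n → ℂ) = 0 := by simp [linPoly]

theorem linPoly_single (i : Fin n) : linPoly (Pi.single i 1) = X i := by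
  classical
  simp [linPoly, Pi.single_apply]

theorem eval_linPoly (v a : Fin n → ℂ) : eval v (linPoly a) = a ⬝ᵥ v := by
  simp [linPoly, dotProduct]

theorem isHomogeneous_linPoly (a : Fin n → ℂ) : (linPoly a).IsHomogeneous 1 := by
  refine IsHomogeneous.sum _ _ _ fun i _ => ?_
  simpa using (isHomogeneous_C (Fin n) (a i)).mul (isHomogeneous_X ℂ i)

theorem linPoly_eq_zero {a : Fin n → ℂ} : linPoly a = 0 ↔ a = 0 := by
  classical
  refine ⟨fun h => ?_, fun h => by rw [h, linPoly_zero]⟩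
  ext i
  have := congrArg (eval (Pi.single i 1)) h
  simpa [eval_linPoly] using this

theorem linPoly_injective : Function.Injective (linPoly : (Fin n → ℂ) → Pol n) := by
  intro a b h
  have : linPoly (a - b) = 0 := by rw [linPoly_sub, h, sub_self]
  exact sub_eq_zero.1 (linPoly_eq_zero.1 this)

theorem prime_linPoly {a : Fin n → ℂ} (ha : a ≠ 0) : Prime (linPoly a) := by
  have h0 : linPoly a ≠ 0 := fun h => ha (linPoly_eq_zero.1 h)
  refine Irreducible.prime (irreducible_of_totalDegree_eq_one ?_ ?_)
  · exact (isHomogeneous_linPoly a).totalDegree h0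
  · intro x hx
    by_contra hux
    have hx0 : x = 0 := by
      by_contra h
      exact hux (isUnit_iff_ne_zero.2 h)
    refine h0 ?_
    ext i
    simpa [hx0] using hx i

theorem linPoly_dvd_linPoly {a b : Fin n → ℂ} (h : linPoly a ∣ linPoly b) :
    ∃ c : ℂ, b = c • a := by
  by_cases hb : b = 0
  · exact ⟨0, by simp [hb]⟩
  obtain ⟨q, hq⟩ := h
  have hb0 : linPoly b ≠ 0 := fun h => hb (linPoly_eq_zero.1 h)
  have ha0 : linPoly a ≠ 0 := by rintro h; rw [h, zero_mul] at hq; exact hb0 hq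
  have hq0 : q ≠ 0 := by rintro rfl; rw [mul_zero] at hq; exact hb0 hq
  have hd := totalDegree_mul_of_isDomain ha0 hq0
  rw [← hq, (isHomogeneous_linPoly b).totalDegree hb0,
    (isHomogeneous_linPoly a).totalDegree ha0] at hd
  have hc : q = C (coeff 0 q) := totalDegree_eq_zero_iff_eq_C.1 (by omega)
  refine ⟨coeff 0 q, linPoly_injective ?_⟩
  rw [linPoly_smul, hq, mul_comm, ← hc]

/-- The substitution sending the linear form `a` to the linear form `g a`. -/
def linSub (g : Matrix (Fin n) (Fin n) ℂ) : Pol n →ₐ[ℂ] Pol n :=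
  aeval fun j => linPoly (fun i => g i j)

theorem linSub_X (g : Matrix (Fin n) (Fin n) ℂ) (j : Fin n) :
    linSub g (X j) = linPoly (fun i => g i j) := by simp [linSub]

theorem linSub_linPoly (g : Matrix (Fin n) (Fin n) ℂ) (a : Fin n → ℂ) :
    linSub g (linPoly a) = linPoly (g.mulVec a) := by
  simp only [linPoly, map_sum, map_mul, linSub_X, Matrix.mulVec, dotProduct, Finset.sum_mul,
    Finset.mul_sum]
  rw [Finset.sum_comm]
  refine Finset.sum_congr rfl fun i _ => Finset.sum_congr rfl fun j _ => ?_
  rw [algHom_C]; simp only [algebraMap_eq]; ring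

theorem linSub_one : linSub (1 : Matrix (Fin n) (Fin n) ℂ) = AlgHom.id ℂ _ := by
  refine algHom_ext fun j => ?_
  rw [← linPoly_single, linSub_linPoly, Matrix.one_mulVec]; rfl

theorem linSub_mul (g h : Matrix (Fin n) (Fin n) ℂ) (f : Pol n) :
    linSub (g * h) f = linSub g (linSub h f) := by
  have : linSub (g * h) = (linSub g).comp (linSub h) := by
    refine algHom_ext fun j => ?_
    rw [← linPoly_single, AlgHom.comp_apply, linSub_linPoly, linSub_linPoly, linSub_linPoly,
      Matrix.mulVec_mulVec]
  rw [this]; rfl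

theorem isHomogeneous_linSub (g : Matrix (Fin n) (Fin n) ℂ) {f : Pol n} {d : ℕ}
    (hf : f.IsHomogeneous d) : (linSub g f).IsHomogeneous d := by
  rw [← one_mul d]
  exact hf.aeval _ (fun j => isHomogeneous_linPoly (fun i => g i j))

theorem linPoly_dvd_sub_linSub (u b : Fin n → ℂ) (f : Pol n) :
    linPoly u ∣ f - linSub (1 - Matrix.vecMulVec u b) f := by
  induction f using MvPolynomial.induction_on with
  | C c => simp [linSub]
  | add p q hp hq =>
    rw [map_add, add_sub_add_comm]; exact dvd_add hp hq
  | mul_X p j hp =>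
    have : p * X j - linSub (1 - Matrix.vecMulVec u b) (p * X j) =
        (p - linSub (1 - Matrix.vecMulVec u b) p) * X j +
        linSub (1 - Matrix.vecMulVec u b) p *
          (X j - linSub (1 - Matrix.vecMulVec u b) (X j)) := by rw [map_mul]; ring
    rw [this]
    refine dvd_add (hp.mul_right _) (Dvd.dvd.mul_left ?_ _)
    refine ⟨C (b j), ?_⟩
    rw [← linPoly_single, linSub_linPoly, ← linPoly_sub, mul_comm, ← linPoly_smul]
    congr 1
    ext i
    simp [Matrix.vecMulVec_apply, Matrix.one_apply, Pi.single_apply, mul_comm]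

/-- The directional derivative along `y`. -/
def dir (y : Fin n → ℂ) : Derivation ℂ (Pol n) (Pol n) := ∑ i, y i • pderiv i

theorem dir_apply (y : Fin n → ℂ) (f : Pol n) : dir y f = ∑ i, y i • pderiv i f := by
  have := congrFun (map_sum (Derivation.coeFnAddMonoidHom (R := ℂ) (A := Pol n) (M := Pol n))
    (fun i => y i • pderiv i) Finset.univ) f
  exact this.trans (Finset.sum_apply _ _ _)

theorem dir_linPoly (y a : Fin n → ℂ) : dir y (linPoly a) = C (a ⬝ᵥ y) := by
  classical
  simp only [dir_apply, linPoly, map_sum, Derivation.leibniz, pderiv_C, pderiv_X, smul_zero,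
    dotProduct]
  refine Finset.sum_congr rfl fun i _ => ?_
  rw [Finset.sum_eq_single i]
  · simp [smul_eq_C_mul, mul_comm]
  · intro b _ hb; simp [hb]
  · simp

theorem dir_add (y z : Fin n → ℂ) (f : Pol n) : dir (y + z) f = dir y f + dir z f := by
  simp [dir_apply, add_smul, Finset.sum_add_distrib]

theorem dir_smul (c : ℂ) (y : Fin n → ℂ) (f : Pol n) : dir (c • y) f = c • dir y f := by
  simp [dir_apply, mul_smul, Finset.smul_sum]

theorem dir_linSub {g : Matrix (Fin n) (Fin n) ℂ} (hg : g.transpose * g = 1) (y : Fin n → ℂ)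
    (f : Pol n) : dir (g.mulVec y) (linSub g f) = linSub g (dir y f) := by
  induction f using MvPolynomial.induction_on with
  | C c => simp [linSub]
  | add p q hp hq => simp only [map_add, hp, hq]
  | mul_X p j hp =>
    simp only [map_mul, Derivation.leibniz, smul_eq_mul, map_add, hp]
    congr 2
    rw [← linPoly_single, linSub_linPoly, dir_linPoly, dir_linPoly, algHom_C, algebraMap_eq]
    congr 1
    rw [Matrix.dotProduct_mulVec, Matrix.vecMul_mulVec, hg, Matrix.vecMul_one]
end Linear

/-- Contraction of a vector field with a constant covector. -/
def pair {N : ℕ} {B : Type*} [CommRing B] [Algebra ℂ B] (a : Fin N → ℂ) :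
    (Fin N → B) →ₗ[B] B where
  toFun φ := ∑ i, a i • φ i
  map_add' φ ψ := by simp [smul_add, Finset.sum_add_distrib]
  map_smul' c φ := by simp [Finset.mul_sum]

section pair

variable {N : ℕ} {B : Type*} [CommRing B] [Algebra ℂ B]

theorem pair_apply (a : Fin N → ℂ) (φ : Fin N → B) : pair a φ = ∑ i, a i • φ i := rfl

theorem pair_add_left (a b : Fin N → ℂ) (φ : Fin N → B) :
    pair (a + b) φ = pair a φ + pair b φ := by
  simp [pair_apply, add_smul, Finset.sum_add_distrib]

theorem pair_smul_left (c : ℂ) (a : Fin N → ℂ) (φ : Fin N → B) :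
    pair (c • a) φ = c • pair a φ := by
  simp [pair_apply, mul_smul, Finset.smul_sum]

theorem pair_neg_left (a : Fin N → ℂ) (φ : Fin N → B) : pair (-a) φ = -pair a φ := by
  simp [pair_apply]

theorem pair_sub_left (a b : Fin N → ℂ) (φ : Fin N → B) :
    pair (a - b) φ = pair a φ - pair b φ := by
  rw [sub_eq_add_neg, pair_add_left, pair_neg_left, sub_eq_add_neg]

theorem pair_single (i : Fin N) (φ : Fin N → B) : pair (Pi.single i 1) φ = φ i := by
  simp [pair_apply, Pi.single_apply]

/-- The semilinear action of a constant matrix and a ring endomorphism on vectors. -/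
def tact {r : ℕ} (ρ : Matrix (Fin r) (Fin r) ℂ) (σ : B →ₐ[ℂ] B) :
    (Fin r → B) →ₗ[ℂ] (Fin r → B) where
  toFun p i := ∑ j, ρ i j • σ (p j)
  map_add' p q := by ext i; simp [smul_add, Finset.sum_add_distrib]
  map_smul' c p := by
    ext i; simp only [Pi.smul_apply, map_smul, Finset.smul_sum, RingHom.id_apply]
    exact Finset.sum_congr rfl fun j _ => smul_comm _ _ _

theorem tact_apply {r : ℕ} (ρ : Matrix (Fin r) (Fin r) ℂ) (σ : B →ₐ[ℂ] B) (p : Fin r → B)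
    (i : Fin r) : tact ρ σ p i = ∑ j, ρ i j • σ (p j) := rfl

theorem tact_smul {r : ℕ} (ρ : Matrix (Fin r) (Fin r) ℂ) (σ : B →ₐ[ℂ] B) (f : B)
    (p : Fin r → B) : tact ρ σ (f • p) = σ f • tact ρ σ p := by
  ext i; simp [tact_apply, Finset.mul_sum]

theorem tact_tact {r : ℕ} (ρ ρ' : Matrix (Fin r) (Fin r) ℂ) (σ σ' : B →ₐ[ℂ] B)
    (p : Fin r → B) : tact ρ σ (tact ρ' σ' p) = tact (ρ * ρ') (σ.comp σ') p := by
  ext i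
  simp only [tact_apply, map_sum, map_smul, Finset.smul_sum, Matrix.mul_apply, Finset.sum_smul,
    AlgHom.comp_apply, mul_smul]
  exact Finset.sum_comm

theorem tact_one {r : ℕ} (p : Fin r → B) : tact 1 (AlgHom.id ℂ B) p = p := by
  ext i; simp [tact_apply, Matrix.one_apply]

theorem pair_tact (a : Fin N → ℂ) (ρ : Matrix (Fin N) (Fin N) ℂ) (σ : B →ₐ[ℂ] B)
    (φ : Fin N → B) : pair a (tact ρ σ φ) = σ (pair (Matrix.vecMul a ρ) φ) := by
  simp only [pair_apply, tact_apply, Finset.smul_sum, map_sum, map_smul, Matrix.vecMul,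
    dotProduct, Finset.sum_smul, mul_smul]
  exact Finset.sum_comm

theorem pair_mulVec_tact {ρ : Matrix (Fin N) (Fin N) ℂ} (hρ : ρ.transpose * ρ = 1)
    (a : Fin N → ℂ) (σ : B →ₐ[ℂ] B) (φ : Fin N → B) :
    pair (ρ.mulVec a) (tact ρ σ φ) = σ (pair a φ) := by
  rw [pair_tact, Matrix.vecMul_mulVec, hρ, Matrix.vecMul_one]

end pair

/-- A finite complex orthogonal reflection group `W` acting irreducibly, with an invariant reduced
system of roots, a positive system with its simple roots and its highest root, and an
invariant multiplicity function. -/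
structure RootData (N : ℕ) (W : Type) [Group W] where
  /-- The roots. -/
  roots : Finset (Fin N → ℂ)
  /-- The positive roots. -/
  pos : Finset (Fin N → ℂ)
  /-- The simple roots. -/
  simple : Finset (Fin N → ℂ)
  /-- The highest root. -/
  top : Fin N → ℂ
  /-- The multiplicity. -/
  m : (Fin N → ℂ) → ℕ
  /-- The matrix of a group element. -/
  g : W →* Matrix (Fin N) (Fin N) ℂ
  /-- The reflections. -/
  s : (Fin N → ℂ) → W
  orth : ∀ w, (g w).transpose * g w = 1
  faithful : Function.Injective g
  sq_ne : ∀ a ∈ roots, a ⬝ᵥ a ≠ 0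
  g_s : ∀ a ∈ roots, g (s a) = 1 - Matrix.vecMulVec a ((2 / (a ⬝ᵥ a)) • a)
  stab : ∀ w, ∀ a ∈ roots, (g w).mulVec a ∈ roots
  m_inv : ∀ w, ∀ a ∈ roots, m ((g w).mulVec a) = m a
  reduced : ∀ a ∈ roots, ∀ c : ℂ, c • a ∈ roots → c = 1 ∨ c = -1
  irr : ∀ U : Submodule ℂ (Fin N → ℂ), (∀ w, ∀ v ∈ U, (g w).mulVec v ∈ U) → U = ⊥ ∨ U = ⊤
  mem_roots : ∀ a, a ∈ roots ↔ a ∈ pos ∨ -a ∈ pos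
  pos_disj : ∀ a ∈ pos, -a ∉ pos
  simple_pos : simple ⊆ pos
  simple_perm : ∀ a ∈ simple, ∀ b ∈ pos, b ≠ a → (g (s a)).mulVec b ∈ pos
  gen : Subgroup.closure (s '' (simple : Set (Fin N → ℂ))) = ⊤
  top_pos : top ∈ pos
  top_pair : ∀ b ∈ pos, b ≠ top → (g (s top)).mulVec b = b ∨
    ((g (s top)).mulVec b = b - top ∧ top - b ∈ pos)

namespace RootData

variable {N : ℕ} {W : Type} [Group W] (D : RootData N W)

theorem pos_roots {a : Fin N → ℂ} (h : a ∈ D.pos) : a ∈ D.roots := (D.mem_roots a).2 (Or.inl h)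

theorem neg_roots {a : Fin N → ℂ} (h : a ∈ D.roots) : -a ∈ D.roots := by
  rw [D.mem_roots] at h ⊢
  rw [neg_neg]; exact h.symm

theorem root_ne_zero {a : Fin N → ℂ} (h : a ∈ D.roots) : a ≠ 0 := by
  rintro rfl
  exact D.sq_ne _ h (by simp)

theorem dot_g (w : W) (a b : Fin N → ℂ) :
    (D.g w).mulVec a ⬝ᵥ (D.g w).mulVec b = a ⬝ᵥ b := by
  rw [Matrix.dotProduct_mulVec, Matrix.vecMul_mulVec, D.orth, Matrix.vecMul_one]

theorem g_mulVec_g (w w' : W) (a : Fin N → ℂ) :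
    (D.g w).mulVec ((D.g w').mulVec a) = (D.g (w * w')).mulVec a := by
  rw [Matrix.mulVec_mulVec, map_mul]

theorem g_inv_mulVec (w : W) (a : Fin N → ℂ) :
    (D.g w⁻¹).mulVec ((D.g w).mulVec a) = a := by
  rw [g_mulVec_g]; simp

theorem g_mulVec_inv (w : W) (a : Fin N → ℂ) :
    (D.g w).mulVec ((D.g w⁻¹).mulVec a) = a := by
  rw [g_mulVec_g]; simp

theorem s_mulVec {a : Fin N → ℂ} (h : a ∈ D.roots) (v : Fin N → ℂ) :
    (D.g (D.s a)).mulVec v = v - (2 * (a ⬝ᵥ v) / (a ⬝ᵥ a)) • a := by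
  rw [D.g_s a h, Matrix.sub_mulVec, Matrix.one_mulVec, Matrix.vecMulVec_mulVec]
  congr 1
  ext i
  simp
  ring

theorem s_self {a : Fin N → ℂ} (h : a ∈ D.roots) : (D.g (D.s a)).mulVec a = -a := by
  rw [D.s_mulVec h, mul_div_assoc, div_self (D.sq_ne a h), mul_one, two_smul]; abel

theorem s_orth {a v : Fin N → ℂ} (h : a ∈ D.roots) (hv : a ⬝ᵥ v = 0) :
    (D.g (D.s a)).mulVec v = v := by
  rw [D.s_mulVec h, hv]; simp

theorem ext_mulVec {w w' : W} (h : ∀ v, (D.g w).mulVec v = (D.g w').mulVec v) : w = w' :=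
  D.faithful (Matrix.ext_of_mulVec_single fun _ => h _)

theorem s_sq {a : Fin N → ℂ} (h : a ∈ D.roots) : D.s a * D.s a = 1 := by
  refine D.ext_mulVec fun v => ?_
  rw [← g_mulVec_g, D.s_mulVec h v, Matrix.mulVec_sub, Matrix.mulVec_smul, D.s_self h,
    D.s_mulVec h v]
  simp

theorem s_inv {a : Fin N → ℂ} (h : a ∈ D.roots) : (D.s a)⁻¹ = D.s a :=
  inv_eq_of_mul_eq_one_right (D.s_sq h)

theorem s_conj {a : Fin N → ℂ} (h : a ∈ D.roots) (w : W) :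
    D.s ((D.g w).mulVec a) = w * D.s a * w⁻¹ := by
  refine D.ext_mulVec fun v => ?_
  rw [D.s_mulVec (D.stab w a h), ← g_mulVec_g, ← g_mulVec_g, D.s_mulVec h, Matrix.mulVec_sub,
    g_mulVec_inv, Matrix.mulVec_smul, dot_g]
  have : (D.g w).mulVec a ⬝ᵥ v = a ⬝ᵥ (D.g w⁻¹).mulVec v := by
    conv_lhs => rw [← D.g_mulVec_inv w v]
    rw [dot_g]
  rw [this]

theorem s_neg {a : Fin N → ℂ} (h : a ∈ D.roots) : D.s (-a) = D.s a := by
  refine D.ext_mulVec fun v => ?_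
  rw [D.s_mulVec h, D.s_mulVec (D.neg_roots h)]
  ext i
  simp
  ring

theorem m_neg {a : Fin N → ℂ} (h : a ∈ D.roots) : D.m (-a) = D.m a := by
  rw [← D.s_self h, D.m_inv _ _ h]

theorem eq_or_neg {a b : Fin N → ℂ} (ha : a ∈ D.roots) (hb : b ∈ D.roots)
    (h : linPoly a ∣ linPoly b) : b = a ∨ b = -a := by
  obtain ⟨c, rfl⟩ := linPoly_dvd_linPoly h
  rcases D.reduced a ha c hb with rfl | rfl
  · left; simp
  · right; simp

theorem pos_dvd {a b : Fin N → ℂ} (ha : a ∈ D.pos) (hb : b ∈ D.pos)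
    (h : linPoly a ∣ linPoly b) : b = a := by
  rcases D.eq_or_neg (D.pos_roots ha) (D.pos_roots hb) h with h | h
  · exact h
  · rw [h] at hb; exact absurd hb (D.pos_disj a ha)

theorem neg_ne {a : Fin N → ℂ} (h : a ∈ D.roots) : -a ≠ a := fun e => by
  refine D.root_ne_zero h ?_
  ext i
  have := congrFun e i
  simp only [Pi.neg_apply] at this
  simpa using self_eq_neg.1 this.symm

/-- A sum of an even function over the roots is twice the sum over the positive roots. -/
theorem sum_roots {M : Type*} [AddCommMonoid M] (f : (Fin N → ℂ) → M)
    (hf : ∀ a ∈ D.pos, f (-a) = f a) : ∑ a ∈ D.roots, f a = 2 • ∑ a ∈ D.pos, f a := by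
  classical
  have : D.roots = D.pos ∪ D.pos.image Neg.neg := by
    ext a
    rw [D.mem_roots, Finset.mem_union, Finset.mem_image]
    refine or_congr Iff.rfl ⟨fun h => ⟨_, h, neg_neg a⟩, ?_⟩
    rintro ⟨b, hb, rfl⟩
    rwa [neg_neg]
  rw [this, Finset.sum_union, Finset.sum_image (fun a _ b _ h => neg_injective h), two_nsmul]
  · congr 1
    exact Finset.sum_congr rfl hf
  · rw [Finset.disjoint_left]
    intro a ha h
    obtain ⟨b, hb, rfl⟩ := Finset.mem_image.1 h
    exact D.pos_disj _ hb ha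

/-- The action on polynomials. -/
def act (w : W) : Pol N →ₐ[ℂ] Pol N := linSub (D.g w)

theorem act_linPoly (w : W) (a : Fin N → ℂ) :
    D.act w (linPoly a) = linPoly ((D.g w).mulVec a) := linSub_linPoly _ _

theorem act_act (w w' : W) (f : Pol N) : D.act w (D.act w' f) = D.act (w * w') f := by
  rw [act, act, act, map_mul, linSub_mul]

theorem act_comp (w w' : W) : (D.act w).comp (D.act w') = D.act (w * w') :=
  AlgHom.ext fun f => D.act_act w w' f

theorem act_one (f : Pol N) : D.act 1 f = f := by rw [act, map_one, linSub_one]; rfl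

theorem act_inv_act (w : W) (f : Pol N) : D.act w⁻¹ (D.act w f) = f := by
  rw [act_act, inv_mul_cancel, act_one]

theorem act_injective (w : W) : Function.Injective (D.act w) :=
  Function.LeftInverse.injective (D.act_inv_act w)

theorem act_C (w : W) (c : ℂ) : D.act w (C c) = C c := algHom_C _ c

theorem act_s_linPoly {a : Fin N → ℂ} (h : a ∈ D.roots) :
    D.act (D.s a) (linPoly a) = -linPoly a := by
  rw [act_linPoly, D.s_self h, linPoly_neg]

theorem dvd_sub_act {a : Fin N → ℂ} (h : a ∈ D.roots) (f : Pol N) :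
    linPoly a ∣ f - D.act (D.s a) f := by
  rw [act, D.g_s a h]; exact linPoly_dvd_sub_linSub _ _ _

theorem act_isHomogeneous (w : W) {f : Pol N} {d : ℕ} (h : f.IsHomogeneous d) :
    (D.act w f).IsHomogeneous d := isHomogeneous_linSub _ h

theorem dir_act (w : W) (y : Fin N → ℂ) (f : Pol N) :
    dir ((D.g w).mulVec y) (D.act w f) = D.act w (dir y f) := dir_linSub (D.orth w) y f

/-- The action on vector fields. -/
def vact (w : W) : (Fin N → Pol N) →ₗ[ℂ] (Fin N → Pol N) := tact (D.g w) (D.act w)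

theorem vact_smul (w : W) (f : Pol N) (φ : Fin N → Pol N) :
    D.vact w (f • φ) = D.act w f • D.vact w φ := tact_smul _ _ _ _

theorem vact_vact (w w' : W) (φ : Fin N → Pol N) :
    D.vact w (D.vact w' φ) = D.vact (w * w') φ := by
  rw [vact, vact, vact, tact_tact, act_comp, map_mul]

theorem vact_one (φ : Fin N → Pol N) : D.vact 1 φ = φ := by
  rw [vact, map_one, show D.act 1 = AlgHom.id ℂ _ from AlgHom.ext D.act_one, tact_one]

theorem pair_vact (w : W) (a : Fin N → ℂ) (φ : Fin N → Pol N) :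
    pair ((D.g w).mulVec a) (D.vact w φ) = D.act w (pair a φ) :=
  pair_mulVec_tact (D.orth w) _ _ _

theorem pair_vact' (w : W) (a : Fin N → ℂ) (φ : Fin N → Pol N) :
    pair a (D.vact w φ) = D.act w (pair ((D.g w⁻¹).mulVec a) φ) := by
  rw [← pair_vact, g_mulVec_inv]

/-- Logarithmic vector fields of the multiarrangement with multiplicities `k`. -/
def mder (k : (Fin N → ℂ) → ℕ) : Submodule (Pol N) (Fin N → Pol N) where
  carrier := {φ | ∀ a ∈ D.roots, linPoly a ^ k a ∣ pair a φ}
  add_mem' h h' a ha := by rw [map_add]; exact dvd_add (h a ha) (h' a ha)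
  zero_mem' a _ := by simp
  smul_mem' c φ h a ha := by rw [map_smul]; exact (h a ha).mul_left _

theorem vact_mem_mder {k : (Fin N → ℂ) → ℕ}
    (hk : ∀ w, ∀ a ∈ D.roots, k ((D.g w).mulVec a) = k a) {φ : Fin N → Pol N} (w : W)
    (h : φ ∈ D.mder k) : D.vact w φ ∈ D.mder k := by
  intro a ha
  rw [pair_vact']
  have h1 := map_dvd (D.act w) (h _ (D.stab w⁻¹ a ha))
  rwa [map_pow, act_linPoly, g_mulVec_inv, hk _ _ ha] at h1

theorem sub_vact_apply {a : Fin N → ℂ} (h : a ∈ D.roots) (φ : Fin N → Pol N) (i : Fin N) :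
    (φ - D.vact (D.s a) φ) i = (φ i - D.act (D.s a) (φ i)) +
      (2 * a i / (a ⬝ᵥ a)) • D.act (D.s a) (pair a φ) := by
  have : D.vact (D.s a) φ i = D.act (D.s a) (φ i) -
      (2 * a i / (a ⬝ᵥ a)) • D.act (D.s a) (pair a φ) := by
    rw [← pair_single i (D.vact _ _), pair_vact', D.s_inv h, D.s_mulVec h, pair_sub_left,
      pair_single, pair_smul_left, map_sub, map_smul]
    simp
  rw [Pi.sub_apply, this]; ring

theorem dvd_sub_vact {a : Fin N → ℂ} (h : a ∈ D.roots) {φ : Fin N → Pol N}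
    (hφ : linPoly a ∣ pair a φ) : ∃ ψ, φ - D.vact (D.s a) φ = linPoly a • ψ := by
  have : ∀ i, linPoly a ∣ (φ - D.vact (D.s a) φ) i := fun i => by
    rw [sub_vact_apply _ h, smul_eq_C_mul]
    refine dvd_add (D.dvd_sub_act h _) (Dvd.dvd.mul_left ?_ _)
    have := map_dvd (D.act (D.s a)) hφ
    rwa [act_s_linPoly _ h, neg_dvd] at this
  choose ψ hψ using this
  exact ⟨ψ, funext hψ⟩

end RootData

/-- Rational functions in `n` variables over `ℂ`. -/
abbrev Rat' (n : ℕ) := FractionRing (Pol n)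

section frac

variable {n : ℕ}

/-- The ring homomorphism `f ↦ f + ε ∂_y f`. -/
def dualHom (y : Fin n → ℂ) : Pol n →+* TrivSqZeroExt (Rat' n) (Rat' n) where
  toFun f := TrivSqZeroExt.inl (algebraMap _ _ f) + TrivSqZeroExt.inr (algebraMap _ _ (dir y f))
  map_zero' := by simp
  map_one' := by rw [Derivation.map_one_eq_zero, map_one, map_zero]; simp
  map_add' f g := by ext <;> simp only [map_add, TrivSqZeroExt.fst_add, TrivSqZeroExt.snd_add,
    TrivSqZeroExt.fst_inl, TrivSqZeroExt.snd_inl, TrivSqZeroExt.fst_inr, TrivSqZeroExt.snd_inr] <;>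
    ring
  map_mul' f g := by
    ext <;> simp only [Derivation.leibniz, map_add, map_mul, TrivSqZeroExt.fst_add,
      TrivSqZeroExt.snd_add, TrivSqZeroExt.fst_inl, TrivSqZeroExt.snd_inl, TrivSqZeroExt.fst_inr,
      TrivSqZeroExt.snd_inr, TrivSqZeroExt.fst_mul, TrivSqZeroExt.snd_mul, smul_eq_mul,
      op_smul_eq_smul] <;> ring

theorem isUnit_dualHom (y : Fin n → ℂ) (b : nonZeroDivisors (Pol n)) :
    IsUnit (dualHom y b) := by
  rw [TrivSqZeroExt.isUnit_iff_isUnit_fst]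
  have : (dualHom y b).fst = algebraMap _ (Rat' n) (b : Pol n) := by simp [dualHom]
  rw [this]
  exact IsLocalization.map_units (Rat' n) b

/-- The extension of `dualHom` to rational functions. -/
def dualHomK (y : Fin n → ℂ) : Rat' n →+* TrivSqZeroExt (Rat' n) (Rat' n) :=
  IsLocalization.lift (isUnit_dualHom y)

theorem dualHomK_algebraMap (y : Fin n → ℂ) (f : Pol n) :
    dualHomK y (algebraMap _ _ f) = dualHom y f := IsLocalization.lift_eq _ _

theorem dualHomK_fst (y : Fin n → ℂ) (f : Rat' n) : (dualHomK y f).fst = f := by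
  have : (TrivSqZeroExt.fstHom (Rat' n) (Rat' n) (Rat' n)).toRingHom.comp (dualHomK y) =
      RingHom.id _ := by
    refine IsLocalization.ringHom_ext (nonZeroDivisors (Pol n)) (RingHom.ext fun f => ?_)
    simp [dualHomK_algebraMap, dualHom]
  exact RingHom.congr_fun this f

/-- The directional derivative of rational functions. -/
def dirK (y : Fin n → ℂ) : Derivation ℂ (Rat' n) (Rat' n) :=
  Derivation.mk'
    { toFun := fun f => (dualHomK y f).snd
      map_add' := fun f g => by simp
      map_smul' := fun c f => by
        have : c • f = algebraMap (Pol n) _ (C c) * f := by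
          rw [Algebra.smul_def, IsScalarTower.algebraMap_apply ℂ (Pol n) (Rat' n)]; rfl
        rw [this, map_mul, TrivSqZeroExt.snd_mul, dualHomK_fst, dualHomK_algebraMap]
        simp [dualHom]
        rw [Algebra.smul_def, IsScalarTower.algebraMap_apply ℂ (Pol n) (Rat' n)]; rfl }
    (fun f g => by
      simp [TrivSqZeroExt.snd_mul, dualHomK_fst, mul_comm])

theorem dirK_algebraMap (y : Fin n → ℂ) (f : Pol n) :
    dirK y (algebraMap _ _ f) = algebraMap _ _ (dir y f) := by
  change (dualHomK y _).snd = _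
  rw [dualHomK_algebraMap]
  simp only [dualHom, RingHom.coe_mk, MonoidHom.coe_mk, OneHom.coe_mk, TrivSqZeroExt.snd_add,
    TrivSqZeroExt.snd_inl, TrivSqZeroExt.snd_inr, zero_add]

theorem algebraMap_C (c : ℂ) : algebraMap (Pol n) (Rat' n) (C c) = algebraMap ℂ _ c := by
  rw [IsScalarTower.algebraMap_apply ℂ (Pol n) (Rat' n)]; rfl

/-- Linear forms as rational functions. -/
def lin (a : Fin n → ℂ) : Rat' n := algebraMap _ _ (linPoly a)

theorem lin_ne_zero {a : Fin n → ℂ} (h : a ≠ 0) : lin a ≠ 0 := by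
  rw [lin, Ne, FaithfulSMul.algebraMap_eq_zero_iff]
  exact fun h' => h (linPoly_eq_zero.1 h')

theorem lin_neg (a : Fin n → ℂ) : lin (-a) = -lin a := by rw [lin, linPoly_neg, map_neg]; rfl

theorem dirK_lin (y a : Fin n → ℂ) : dirK y (lin a) = algebraMap ℂ _ (a ⬝ᵥ y) := by
  rw [lin, dirK_algebraMap, dir_linPoly, algebraMap_C]

theorem rat_div (f : Rat' n) : ∃ a b : Pol n, b ≠ 0 ∧ f = algebraMap _ _ a / algebraMap _ _ b := by
  obtain ⟨a, b, hb, rfl⟩ := IsFractionRing.div_surjective (A := Pol n) f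
  exact ⟨a, b, nonZeroDivisors.ne_zero hb, rfl⟩

theorem algebraMap_ne_zero {b : Pol n} (hb : b ≠ 0) : algebraMap (Pol n) (Rat' n) b ≠ 0 := by
  rwa [Ne, FaithfulSMul.algebraMap_eq_zero_iff]

theorem rat_ind_eq {M : Type*} [AddCommGroup M] [Module (Rat' n) M] {f : Rat' n} (hf : f ≠ 0)
    {x y : M} (h : f • x = f • y) : x = y := smul_right_injective M hf h

theorem dirK_div (y : Fin n → ℂ) (f g : Rat' n) (hg : g ≠ 0) :
    dirK y (f / g) = (dirK y f * g - f * dirK y g) / g ^ 2 := by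
  have h : f = f / g * g := by field_simp
  have h1 : dirK y f = dirK y (f / g) * g + f / g * dirK y g := by
    conv_lhs => rw [h]
    rw [Derivation.leibniz, smul_eq_mul, smul_eq_mul]; ring
  rw [h1]; field_simp; ring

theorem dirK_add (y z : Fin n → ℂ) (f : Rat' n) : dirK (y + z) f = dirK y f + dirK z f := by
  obtain ⟨a, b, hb, rfl⟩ := rat_div f
  have := algebraMap_ne_zero hb
  simp only [dirK_div _ _ _ this, dirK_algebraMap, dir_add, map_add]
  field_simp; ring

theorem dirK_smul (c : ℂ) (y : Fin n → ℂ) (f : Rat' n) : dirK (c • y) f = c • dirK y f := by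
  obtain ⟨a, b, hb, rfl⟩ := rat_div f
  have := algebraMap_ne_zero hb
  simp only [dirK_div _ _ _ this, dirK_algebraMap, dir_smul, smul_eq_C_mul, map_mul, algebraMap_C]
  rw [Algebra.smul_def]
  field_simp

theorem dirK_comm (y z : Fin n → ℂ) (f : Rat' n) : dirK y (dirK z f) = dirK z (dirK y f) := by
  have key : ⁅dirK y, dirK z⁆ = 0 := by
    have h0 : ∀ p : Pol n, ⁅dirK y, dirK z⁆ (algebraMap _ _ p) = 0 := by
      intro p
      rw [Derivation.commutator_apply, dirK_algebraMap, dirK_algebraMap, dirK_algebraMap,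
        dirK_algebraMap, ← map_sub, ← Derivation.commutator_apply]
      have : ⁅(dir y : Derivation ℂ (Pol n) (Pol n)), dir z⁆ = 0 := by
        refine derivation_ext fun i => ?_
        rw [Derivation.commutator_apply, ← linPoly_single, dir_linPoly, dir_linPoly]
        rw [← algebraMap_eq, Derivation.map_algebraMap, Derivation.map_algebraMap]; simp
      rw [this]; simp
    refine Derivation.ext fun f => ?_
    obtain ⟨a, b, hb, rfl⟩ := rat_div f
    have hb' := algebraMap_ne_zero hb
    have h1 : ⁅dirK y, dirK z⁆ (algebraMap _ _ a) =
        ⁅dirK y, dirK z⁆ (algebraMap _ _ a / algebraMap _ _ b) * algebraMap _ _ b +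
        algebraMap _ _ a / algebraMap _ _ b * ⁅dirK y, dirK z⁆ (algebraMap _ _ b) := by
      conv_lhs => rw [show algebraMap _ (Rat' n) a =
        algebraMap _ _ a / algebraMap _ _ b * algebraMap _ _ b by field_simp]
      rw [Derivation.leibniz, smul_eq_mul, smul_eq_mul]; ring
    rw [h0, h0, mul_zero, add_zero] at h1
    rcases mul_eq_zero.1 h1.symm with h | h
    · rw [h]; rfl
    · exact absurd h hb'
  have := congrArg (fun d => d f) key
  rw [Derivation.commutator_apply] at this
  exact sub_eq_zero.1 this

/-- Rational functions regular along the prime `π`. -/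
def reg {π : Pol n} (hπ : Prime π) : Subring (Rat' n) where
  carrier := {f | ∃ b c : Pol n, ¬ π ∣ b ∧ f * algebraMap _ _ b = algebraMap _ _ c}
  mul_mem' := by
    rintro f f' ⟨b, c, hb, h⟩ ⟨b', c', hb', h'⟩
    refine ⟨b * b', c * c', fun hd => (hπ.dvd_or_dvd hd).elim hb hb', ?_⟩
    rw [map_mul, map_mul, ← h, ← h']; ring
  one_mem' := ⟨1, 1, fun h => hπ.not_isUnit (isUnit_of_dvd_one h), by simp⟩
  add_mem' := by
    rintro f f' ⟨b, c, hb, h⟩ ⟨b', c', hb', h'⟩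
    refine ⟨b * b', c * b' + c' * b, fun hd => (hπ.dvd_or_dvd hd).elim hb hb', ?_⟩
    rw [map_add, map_mul, map_mul, map_mul, ← h, ← h']; ring
  zero_mem' := ⟨1, 0, fun h => hπ.not_isUnit (isUnit_of_dvd_one h), by simp⟩
  neg_mem' := by
    rintro f ⟨b, c, hb, h⟩
    exact ⟨b, -c, hb, by rw [map_neg, ← h]; ring⟩

variable {π : Pol n} (hπ : Prime π)

theorem algebraMap_mem_reg (f : Pol n) : algebraMap _ _ f ∈ reg hπ :=
  ⟨1, f, fun h => hπ.not_isUnit (isUnit_of_dvd_one h), by simp⟩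

theorem const_mem_reg (c : ℂ) : algebraMap ℂ _ c ∈ reg hπ := by
  rw [← algebraMap_C]; exact algebraMap_mem_reg hπ _

theorem smul_mem_reg (c : ℂ) {f : Rat' n} (hf : f ∈ reg hπ) : c • f ∈ reg hπ := by
  rw [Algebra.smul_def]; exact mul_mem (const_mem_reg hπ c) hf

theorem dirK_mem_reg (y : Fin n → ℂ) {f : Rat' n} (hf : f ∈ reg hπ) : dirK y f ∈ reg hπ := by
  obtain ⟨b, c, hb, h⟩ := hf
  refine ⟨b * b, dir y c * b - c * dir y b, fun hd => (hπ.dvd_or_dvd hd).elim hb hb, ?_⟩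
  have h1 := congrArg (dirK y) h
  rw [Derivation.leibniz, dirK_algebraMap, dirK_algebraMap, smul_eq_mul, smul_eq_mul] at h1
  rw [map_sub, map_mul, map_mul, map_mul, ← h1, ← h]; ring

theorem inv_mem_reg {b : Pol n} (hb : ¬ π ∣ b) : (algebraMap _ (Rat' n) b)⁻¹ ∈ reg hπ := by
  refine ⟨b, 1, hb, ?_⟩
  have : b ≠ 0 := by rintro rfl; exact hb (dvd_zero _)
  rw [inv_mul_cancel₀ (algebraMap_ne_zero this), map_one]

/-- A rational function regular along all primes is a polynomial. -/
theorem exists_pol_of_reg {f : Rat' n} (h : ∀ (π : Pol n) (hπ : Prime π), f ∈ reg hπ) :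
    ∃ c : Pol n, algebraMap _ _ c = f := by
  have hrel := IsFractionRing.num_den_reduced (Pol n) f
  have hmk := IsFractionRing.mk'_num_den' (Pol n) f
  have hf : algebraMap _ (Rat' n) (IsFractionRing.num (Pol n) f) =
      f * algebraMap _ _ ((IsFractionRing.den (Pol n) f : nonZeroDivisors (Pol n)) : Pol n) := by
    have hd := algebraMap_ne_zero (n := n)
      (nonZeroDivisors.coe_ne_zero (IsFractionRing.den (Pol n) f))
    rw [← div_eq_iff hd, hmk]
  have hd0 : ((IsFractionRing.den (Pol n) f : nonZeroDivisors (Pol n)) : Pol n) ≠ 0 :=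
    nonZeroDivisors.coe_ne_zero _
  have hu : IsUnit ((IsFractionRing.den (Pol n) f : nonZeroDivisors (Pol n)) : Pol n) := by
    by_contra hu
    obtain ⟨π, hirr, hπd⟩ := WfDvdMonoid.exists_irreducible_factor hu hd0
    have hπ := hirr.prime
    obtain ⟨b, c, hb, hbc⟩ := h π hπ
    have h1 : IsFractionRing.num (Pol n) f * b =
        c * ((IsFractionRing.den (Pol n) f : nonZeroDivisors (Pol n)) : Pol n) := by
      apply FaithfulSMul.algebraMap_injective (Pol n) (Rat' n)
      rw [map_mul, map_mul, ← hbc]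
      rw [hf]; ring
    have h2 : π ∣ IsFractionRing.num (Pol n) f :=
      (hπ.dvd_or_dvd (h1 ▸ hπd.mul_left c)).resolve_right hb
    exact hπ.not_isUnit (hrel h2 hπd)
  obtain ⟨u, hu⟩ := hu
  refine ⟨IsFractionRing.num (Pol n) f * ↑u⁻¹, ?_⟩
  rw [map_mul, hf, mul_assoc, ← map_mul, ← hu]; simp

end frac

namespace RootData

variable {N : ℕ} {W : Type} [Group W] (D : RootData N W)

theorem toAlgHom_comp_act_injective (w : W) : Function.Injective
    ((IsScalarTower.toAlgHom ℂ (Pol N) (Rat' N)).comp (D.act w)) := fun _ _ h =>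
  D.act_injective w (FaithfulSMul.algebraMap_injective (Pol N) (Rat' N) h)

/-- The action on rational functions. -/
def actK (w : W) : Rat' N →ₐ[ℂ] Rat' N :=
  IsFractionRing.liftAlgHom (A := Pol N) (K := Rat' N)
    (g := (IsScalarTower.toAlgHom ℂ (Pol N) (Rat' N)).comp (D.act w))
    (D.toAlgHom_comp_act_injective w)

theorem actK_algebraMap (w : W) (f : Pol N) :
    D.actK w (algebraMap _ _ f) = algebraMap _ _ (D.act w f) := by
  exact IsFractionRing.lift_algebraMap (A := Pol N) (K := Rat' N)
    (D.toAlgHom_comp_act_injective w) f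

theorem actK_lin (w : W) (a : Fin N → ℂ) : D.actK w (lin a) = lin ((D.g w).mulVec a) := by
  rw [lin, actK_algebraMap, act_linPoly]; rfl

theorem actK_actK (w w' : W) (f : Rat' N) : D.actK w (D.actK w' f) = D.actK (w * w') f := by
  obtain ⟨a, b, hb, rfl⟩ := rat_div f
  simp only [map_div₀, actK_algebraMap, act_act]

theorem actK_one (f : Rat' N) : D.actK 1 f = f := by
  obtain ⟨a, b, hb, rfl⟩ := rat_div f
  simp only [map_div₀, actK_algebraMap, act_one]

theorem actK_comp (w w' : W) : (D.actK w).comp (D.actK w') = D.actK (w * w') :=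
  AlgHom.ext fun f => D.actK_actK w w' f

theorem dirK_actK (w : W) (y : Fin N → ℂ) (f : Rat' N) :
    dirK ((D.g w).mulVec y) (D.actK w f) = D.actK w (dirK y f) := by
  obtain ⟨a, b, hb, rfl⟩ := rat_div f
  have h1 := algebraMap_ne_zero hb
  have h2 : algebraMap _ (Rat' N) (D.act w b) ≠ 0 :=
    algebraMap_ne_zero fun h => hb (D.act_injective w (by rw [h, map_zero]))
  simp only [map_div₀, actK_algebraMap, dirK_div _ _ _ h1, dirK_div _ _ _ h2, dirK_algebraMap,
    dir_act, map_sub, map_mul, map_pow]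

theorem actK_mem_reg {a : Fin N → ℂ} (ha : a ∈ D.roots) (hπ : Prime (linPoly a)) {f : Rat' N}
    (hf : f ∈ reg hπ) : D.actK (D.s a) f ∈ reg hπ := by
  obtain ⟨b, c, hb, h⟩ := hf
  refine ⟨D.act (D.s a) b, D.act (D.s a) c, fun hd => hb ?_, ?_⟩
  · have := map_dvd (D.act (D.s a)) hd
    rwa [act_s_linPoly _ ha, neg_dvd, act_act, D.s_sq ha, act_one] at this
  · rw [← actK_algebraMap, ← actK_algebraMap, ← map_mul, h]

theorem sub_actK_div_mem_reg {a : Fin N → ℂ} (ha : a ∈ D.roots) (hπ : Prime (linPoly a))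
    {f : Rat' N} (hf : f ∈ reg hπ) : (f - D.actK (D.s a) f) / lin a ∈ reg hπ := by
  obtain ⟨b, c, hb, h⟩ := hf
  obtain ⟨q, hq⟩ := D.dvd_sub_act ha (c * D.act (D.s a) b)
  have hb' : ¬ linPoly a ∣ D.act (D.s a) b := fun hd => hb <| by
    have := map_dvd (D.act (D.s a)) hd
    rwa [act_s_linPoly _ ha, neg_dvd, act_act, D.s_sq ha, act_one] at this
  refine ⟨b * D.act (D.s a) b, q, fun hd => (hπ.dvd_or_dvd hd).elim hb hb', ?_⟩
  have h0 := lin_ne_zero (D.root_ne_zero ha)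
  rw [div_mul_eq_mul_div, div_eq_iff h0]
  have h2 := congrArg (algebraMap _ (Rat' N)) hq
  rw [map_mul, map_sub, map_mul, map_mul, act_act, D.s_sq ha, act_one, map_mul, ← h,
    ← actK_algebraMap, ← actK_algebraMap, ← h, map_mul, actK_algebraMap] at h2
  rw [map_mul, mul_comm (algebraMap _ _ q)]
  change _ = lin a * _ at h2
  rw [← h2]; ring

end RootData

/-- The coordinatewise directional derivative. -/
def dirV {n r : ℕ} (y : Fin n → ℂ) : (Fin r → Rat' n) →ₗ[ℂ] (Fin r → Rat' n) where
  toFun p i := dirK y (p i)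
  map_add' p q := by ext i; simp
  map_smul' c p := by ext i; simp

section dirV

variable {n r : ℕ}

theorem dirV_apply (y : Fin n → ℂ) (p : Fin r → Rat' n) (i : Fin r) :
    dirV y p i = dirK y (p i) := rfl

theorem dirV_smul (y : Fin n → ℂ) (f : Rat' n) (p : Fin r → Rat' n) :
    dirV y (f • p) = dirK y f • p + f • dirV y p := by
  ext i; simp [dirV_apply, mul_comm, add_comm]

theorem dirV_const_mulVec (y : Fin n → ℂ) {k : ℕ} (B : Matrix (Fin k) (Fin r) ℂ)
    (p : Fin r → Rat' n) : dirV y ((B.map (algebraMap ℂ (Rat' n))).mulVec p) =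
      (B.map (algebraMap ℂ (Rat' n))).mulVec (dirV y p) := by
  ext i
  simp [dirV_apply, Matrix.mulVec, dotProduct]

end dirV

theorem lin_sub {n : ℕ} (a b : Fin n → ℂ) : lin (a - b) = lin a - lin b := by
  rw [lin, linPoly_sub, map_sub]; rfl

theorem lin_smul {n : ℕ} (c : ℂ) (a : Fin n → ℂ) :
    lin (c • a) = algebraMap ℂ _ c * lin a := by
  rw [lin, linPoly_smul, map_mul, algebraMap_C]; rfl

namespace RootData

variable {N : ℕ} {W : Type} [Group W] (D : RootData N W)
variable {r : ℕ} (ρ : W →* Matrix (Fin r) (Fin r) ℂ)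

/-- A representation with scalars extended to rational functions. -/
def repK : W →* Matrix (Fin r) (Fin r) (Rat' N) :=
  ((algebraMap ℂ (Rat' N)).mapMatrix : Matrix (Fin r) (Fin r) ℂ →+* _).toMonoidHom.comp ρ

theorem repK_apply (w : W) : repK (N := N) ρ w = (ρ w).map (algebraMap ℂ (Rat' N)) := rfl

/-- The coefficient of a root in the connection. -/
def coef (a y : Fin N → ℂ) : Rat' N := algebraMap ℂ _ (D.m a * (a ⬝ᵥ y) / 2) / lin a

/-- The connection matrix. -/
def conn (y : Fin N → ℂ) : Matrix (Fin r) (Fin r) (Rat' N) :=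
  ∑ a ∈ D.roots, D.coef a y • (1 - repK ρ (D.s a))

/-- The covariant derivative. -/
def nabla (y : Fin N → ℂ) : (Fin r → Rat' N) →ₗ[ℂ] (Fin r → Rat' N) :=
  dirV y + (D.conn ρ y).mulVecLin.restrictScalars ℂ

theorem nabla_apply (y : Fin N → ℂ) (p : Fin r → Rat' N) :
    D.nabla ρ y p = dirV y p + (D.conn ρ y).mulVec p := rfl

theorem nabla_smul (y : Fin N → ℂ) (f : Rat' N) (p : Fin r → Rat' N) :
    D.nabla ρ y (f • p) = dirK y f • p + f • D.nabla ρ y p := by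
  rw [nabla_apply, nabla_apply, dirV_smul, Matrix.mulVec_smul, smul_add, add_assoc]

theorem conn_mulVec (y : Fin N → ℂ) (p : Fin r → Rat' N) : (D.conn ρ y).mulVec p =
    ∑ a ∈ D.roots, D.coef a y • (p - (repK ρ (D.s a)).mulVec p) := by
  rw [conn, Matrix.sum_mulVec]
  simp [Matrix.smul_mulVec, Matrix.sub_mulVec]

theorem coef_add (a y z : Fin N → ℂ) : D.coef a (y + z) = D.coef a y + D.coef a z := by
  simp only [coef, dotProduct_add, ← add_div, ← map_add]
  congr 2; ring

theorem coef_smul (a y : Fin N → ℂ) (c : ℂ) : D.coef a (c • y) = c • D.coef a y := by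
  rw [coef, coef, dotProduct_smul, smul_eq_mul, Algebra.smul_def, ← mul_div_assoc, ← map_mul]
  congr 2; ring

theorem nabla_add_left (y z : Fin N → ℂ) (p : Fin r → Rat' N) :
    D.nabla ρ (y + z) p = D.nabla ρ y p + D.nabla ρ z p := by
  have : dirV (y + z) p = dirV y p + dirV z p := funext fun i => dirK_add _ _ _
  simp only [nabla_apply, conn_mulVec, this, coef_add, add_smul, Finset.sum_add_distrib]
  abel

theorem nabla_smul_left (c : ℂ) (y : Fin N → ℂ) (p : Fin r → Rat' N) :
    D.nabla ρ (c • y) p = c • D.nabla ρ y p := by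
  have : dirV (c • y) p = c • dirV y p := funext fun i => dirK_smul _ _ _
  simp only [nabla_apply, conn_mulVec, this, coef_smul, smul_add, Finset.smul_sum, smul_assoc]

/-- The action of a group element on vectors of rational functions. -/
def kact (w : W) : (Fin r → Rat' N) →ₗ[ℂ] (Fin r → Rat' N) := tact (ρ w) (D.actK w)

theorem kact_eq (w : W) (p : Fin r → Rat' N) :
    D.kact ρ w p = (repK ρ w).mulVec (fun i => D.actK w (p i)) := by
  ext i
  simp [kact, tact_apply, repK_apply, Matrix.mulVec, dotProduct, Algebra.smul_def]

theorem kact_smul (w : W) (f : Rat' N) (p : Fin r → Rat' N) :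
    D.kact ρ w (f • p) = D.actK w f • D.kact ρ w p := tact_smul _ _ _ _

theorem kact_kact (w w' : W) (p : Fin r → Rat' N) :
    D.kact ρ w (D.kact ρ w' p) = D.kact ρ (w * w') p := by
  rw [kact, kact, kact, tact_tact, actK_comp, map_mul]

theorem kact_one (p : Fin r → Rat' N) : D.kact ρ 1 p = p := by
  rw [kact, map_one, show D.actK 1 = AlgHom.id ℂ _ from AlgHom.ext D.actK_one, tact_one]

theorem kact_const_mulVec (w : W) (B : Matrix (Fin r) (Fin r) ℂ) (p : Fin r → Rat' N) :
    (fun i => D.actK w (((B.map (algebraMap ℂ (Rat' N))).mulVec p) i)) =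
      (B.map (algebraMap ℂ (Rat' N))).mulVec (fun i => D.actK w (p i)) := by
  ext i
  simp [Matrix.mulVec, dotProduct]

theorem kact_repK (w u : W) (p : Fin r → Rat' N) :
    D.kact ρ w ((repK ρ u).mulVec p) = (repK ρ (w * u * w⁻¹)).mulVec (D.kact ρ w p) := by
  rw [kact_eq, kact_eq, repK_apply ρ u, kact_const_mulVec, ← repK_apply, Matrix.mulVec_mulVec,
    Matrix.mulVec_mulVec, ← map_mul, ← map_mul]
  simp

theorem actK_coef (w : W) {a : Fin N → ℂ} (ha : a ∈ D.roots) (y : Fin N → ℂ) :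
    D.actK w (D.coef a y) = D.coef ((D.g w).mulVec a) ((D.g w).mulVec y) := by
  rw [coef, coef, map_div₀, actK_lin, AlgHom.commutes, dot_g, D.m_inv _ _ ha]

theorem sum_roots_g {M : Type*} [AddCommMonoid M] (w : W) (f : (Fin N → ℂ) → M) :
    ∑ a ∈ D.roots, f ((D.g w).mulVec a) = ∑ a ∈ D.roots, f a := by
  refine Finset.sum_nbij' (fun a => (D.g w).mulVec a) (fun a => (D.g w⁻¹).mulVec a)
    (fun a ha => D.stab _ _ ha) (fun a ha => D.stab _ _ ha) ?_ ?_ ?_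
  · intro a _; exact D.g_inv_mulVec w a
  · intro a _; exact D.g_mulVec_inv w a
  · intro a _; rfl

theorem kact_nabla (w : W) (y : Fin N → ℂ) (p : Fin r → Rat' N) :
    D.kact ρ w (D.nabla ρ y p) = D.nabla ρ ((D.g w).mulVec y) (D.kact ρ w p) := by
  have h1 : D.kact ρ w (dirV y p) = dirV ((D.g w).mulVec y) (D.kact ρ w p) := by
    rw [kact_eq, kact_eq, repK_apply, dirV_const_mulVec]
    congr 1
    ext i
    simp [dirV_apply, dirK_actK]
  rw [nabla_apply, nabla_apply, map_add, h1, conn_mulVec, conn_mulVec, map_sum,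
    ← D.sum_roots_g w fun a => D.coef a ((D.g w).mulVec y) •
      (D.kact ρ w p - (repK ρ (D.s a)).mulVec (D.kact ρ w p))]
  congr 1
  refine Finset.sum_congr rfl fun a ha => ?_
  rw [kact_smul, map_sub, kact_repK, actK_coef _ _ ha, D.s_conj ha]

/-- The braid move `(a, b) ↦ (b, -s_b a)` on pairs of roots. -/
def braid : Equiv.Perm (D.roots × D.roots) where
  toFun p := (p.2, ⟨-(D.g (D.s p.2)).mulVec p.1, D.neg_roots (D.stab _ _ p.1.2)⟩)
  invFun p := (⟨-(D.g (D.s p.1)).mulVec p.2, D.neg_roots (D.stab _ _ p.2.2)⟩, p.1)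
  left_inv p := by
    ext1
    · ext1
      simp [Matrix.mulVec_neg, ← map_mul, D.s_sq p.2.2]
    · rfl
  right_inv p := by
    ext1
    · rfl
    · ext1
      simp [Matrix.mulVec_neg, ← map_mul, D.s_sq p.1.2]

theorem braid_snd (p : D.roots × D.roots) : ((D.braid p).2 : Fin N → ℂ) =
    (2 * ((p.2 : Fin N → ℂ) ⬝ᵥ (p.1 : Fin N → ℂ)) / ((p.2 : Fin N → ℂ) ⬝ᵥ (p.2 : Fin N → ℂ))) •
      (p.2 : Fin N → ℂ) - (p.1 : Fin N → ℂ) := by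
  change -(D.g (D.s p.2)).mulVec p.1 = _
  rw [D.s_mulVec p.2.2]; simp

theorem braid_wedge (p : D.roots × D.roots) (k : ℕ) {M : Type*} [AddCommGroup M] [Module ℂ M]
    (ω : (Fin N → ℂ) →ₗ[ℂ] (Fin N → ℂ) →ₗ[ℂ] M) (hω : ∀ a, ω a a = 0) :
    ω ((D.braid ^ k) p).1 ((D.braid ^ k) p).2 = ω p.1 p.2 := by
  induction k with
  | zero => rfl
  | succ k ih =>
    rw [pow_succ', Equiv.Perm.mul_apply, braid_snd, ← ih]
    set q := (D.braid ^ k) p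
    change ω q.2 _ = _
    have h : ω q.2 q.1 = -ω q.1 q.2 := by
      have := hω ((q.1 : Fin N → ℂ) + q.2)
      simp only [map_add, LinearMap.add_apply, hω, zero_add, add_zero] at this
      exact eq_neg_of_add_eq_zero_left (by rw [add_comm] at this; rwa [add_comm])
    rw [map_sub, map_smul, hω, smul_zero, zero_sub, h, neg_neg]

theorem braid_sum (p : D.roots × D.roots) (y : Fin N → ℂ) :
    (lin (((p.1 : Fin N → ℂ) ⬝ᵥ y) • (p.2 : Fin N → ℂ) -
      ((p.2 : Fin N → ℂ) ⬝ᵥ y) • (p.1 : Fin N → ℂ))) *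
      ∑ k ∈ Finset.range (orderOf D.braid),
        (lin (((D.braid ^ k) p).1 : Fin N → ℂ))⁻¹ *
          (lin (((D.braid ^ k) p).2 : Fin N → ℂ))⁻¹ = 0 := by
  let ω : (Fin N → ℂ) →ₗ[ℂ] (Fin N → ℂ) →ₗ[ℂ] (Fin N → ℂ) :=
    LinearMap.mk₂ ℂ (fun a b => (a ⬝ᵥ y) • b - (b ⬝ᵥ y) • a)
      (by intros; simp only [add_dotProduct, add_smul, smul_add]; abel)
      (by intros; simp only [smul_dotProduct, smul_eq_mul, mul_smul, smul_sub]; congr 1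
          rw [smul_comm])
      (by intros; simp only [add_dotProduct, add_smul, smul_add]; abel)
      (by intros; simp only [smul_dotProduct, smul_eq_mul, mul_smul, smul_sub]; congr 1
          rw [smul_comm])
  let f : ℕ → Rat' N := fun k =>
    algebraMap ℂ _ ((((D.braid ^ k) p).1 : Fin N → ℂ) ⬝ᵥ y) / lin (((D.braid ^ k) p).1 : Fin N → ℂ)
  rw [Finset.mul_sum, Finset.sum_congr rfl (g := fun k => f k - f (k + 1))]
  · rw [Finset.sum_range_sub']
    simp [f, pow_orderOf_eq_one]
  · intro k _
    have h : ω p.1 p.2 = _ := (D.braid_wedge p k ω (fun a => sub_self _)).symm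
    change lin (ω p.1 p.2) * _ = _
    rw [h]
    have h2 : ((D.braid ^ (k + 1)) p).1 = ((D.braid ^ k) p).2 := by rw [pow_succ']; rfl
    simp only [f, h2]
    set q := (D.braid ^ k) p
    have h3 := lin_ne_zero (D.root_ne_zero q.1.2)
    have h4 := lin_ne_zero (D.root_ne_zero q.2.2)
    simp only [ω, LinearMap.mk₂_apply, lin_sub, lin_smul]
    field_simp

theorem conn_comm_term (y z : Fin N → ℂ) (p : D.roots × D.roots) :
    algebraMap ℂ (Rat' N) (((p.1 : Fin N → ℂ) ⬝ᵥ y) * ((p.2 : Fin N → ℂ) ⬝ᵥ z) -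
      ((p.1 : Fin N → ℂ) ⬝ᵥ z) * ((p.2 : Fin N → ℂ) ⬝ᵥ y)) *
      ∑ k ∈ Finset.range (orderOf D.braid),
        (lin (((D.braid ^ k) p).1 : Fin N → ℂ))⁻¹ *
          (lin (((D.braid ^ k) p).2 : Fin N → ℂ))⁻¹ = 0 := by
  rcases mul_eq_zero.1 (D.braid_sum p y) with h | h
  · have h0 := (linPoly_eq_zero.1 ((FaithfulSMul.algebraMap_eq_zero_iff _ _).1 h))
    have := congrArg (fun v => v ⬝ᵥ z) h0
    simp only [sub_dotProduct, smul_dotProduct, smul_eq_mul, zero_dotProduct] at this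
    rw [show ((p.1 : Fin N → ℂ) ⬝ᵥ y) * ((p.2 : Fin N → ℂ) ⬝ᵥ z) -
      ((p.1 : Fin N → ℂ) ⬝ᵥ z) * ((p.2 : Fin N → ℂ) ⬝ᵥ y) = 0 by rw [← this]; ring]
    simp
  · rw [h, mul_zero]

theorem braid_inv (p : D.roots × D.roots) (k : ℕ) :
    D.m ((D.braid ^ k) p).1 * D.m ((D.braid ^ k) p).2 = D.m p.1 * D.m p.2 ∧
      D.s ((D.braid ^ k) p).1 * D.s ((D.braid ^ k) p).2 = D.s p.1 * D.s p.2 := by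
  induction k with
  | zero => exact ⟨rfl, rfl⟩
  | succ k ih =>
    rw [pow_succ', Equiv.Perm.mul_apply, ← ih.1, ← ih.2]
    set q := (D.braid ^ k) p
    have hq := D.stab (D.s q.2) _ q.1.2
    constructor
    · change D.m q.2 * D.m (-(D.g (D.s q.2)).mulVec q.1) = _
      rw [D.m_neg hq, D.m_inv _ _ q.1.2, mul_comm]
    · change D.s q.2 * D.s (-(D.g (D.s q.2)).mulVec q.1) = _
      rw [D.s_neg hq, D.s_conj q.1.2, ← mul_assoc, ← mul_assoc, D.s_sq q.2.2, one_mul,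
        D.s_inv q.2.2]

/-- The non-scalar part of the connection matrix. -/
def connRefl (y : Fin N → ℂ) : Matrix (Fin r) (Fin r) (Rat' N) :=
  ∑ a : D.roots, D.coef a y • repK ρ (D.s a)

theorem conn_eq (y : Fin N → ℂ) :
    D.conn ρ y = (∑ a : D.roots, D.coef a y) • 1 - D.connRefl ρ y := by
  rw [conn, connRefl, ← Finset.sum_coe_sort]
  simp only [smul_sub, Finset.sum_sub_distrib, Finset.sum_smul]

theorem coef_mul_coef_sub (p : D.roots × D.roots) (y z : Fin N → ℂ) :
    D.coef p.1 y * D.coef p.2 z - D.coef p.1 z * D.coef p.2 y =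
      algebraMap ℂ (Rat' N) (((D.m p.1 * D.m p.2 : ℕ) : ℂ) / 4) *
        (algebraMap ℂ (Rat' N) (((p.1 : Fin N → ℂ) ⬝ᵥ y) * ((p.2 : Fin N → ℂ) ⬝ᵥ z) -
          ((p.1 : Fin N → ℂ) ⬝ᵥ z) * ((p.2 : Fin N → ℂ) ⬝ᵥ y)) *
        ((lin (p.1 : Fin N → ℂ))⁻¹ * (lin (p.2 : Fin N → ℂ))⁻¹)) := by
  simp only [coef, Nat.cast_mul, map_div₀, map_mul, map_sub]
  have h4 : algebraMap ℂ (Rat' N) 4 = algebraMap ℂ (Rat' N) 2 * algebraMap ℂ (Rat' N) 2 := by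
    rw [← map_mul]; norm_num
  rw [h4]
  simp only [div_eq_mul_inv, mul_inv]
  ring

theorem connRefl_comm (y z : Fin N → ℂ) :
    D.connRefl ρ y * D.connRefl ρ z = D.connRefl ρ z * D.connRefl ρ y := by
  let G : D.roots × D.roots → Matrix (Fin r) (Fin r) (Rat' N) := fun p =>
    (D.coef p.1 y * D.coef p.2 z - D.coef p.1 z * D.coef p.2 y) • repK ρ (D.s p.1 * D.s p.2)
  let ω : (Fin N → ℂ) →ₗ[ℂ] (Fin N → ℂ) →ₗ[ℂ] ℂ :=
    LinearMap.mk₂ ℂ (fun a b => (a ⬝ᵥ y) * (b ⬝ᵥ z) - (a ⬝ᵥ z) * (b ⬝ᵥ y))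
      (by intros; simp only [add_dotProduct]; ring)
      (by intros; simp only [smul_dotProduct, smul_eq_mul]; ring)
      (by intros; simp only [add_dotProduct]; ring)
      (by intros; simp only [smul_dotProduct, smul_eq_mul]; ring)
  have h1 : D.connRefl ρ y * D.connRefl ρ z - D.connRefl ρ z * D.connRefl ρ y = ∑ p, G p := by
    have hp : ∀ y z, D.connRefl ρ y * D.connRefl ρ z = ∑ p : D.roots × D.roots,
        (D.coef p.1 y * D.coef p.2 z) • (repK ρ (D.s p.1) * repK ρ (D.s p.2)) := by
      intro y z
      rw [connRefl, connRefl, Fintype.sum_mul_sum, Fintype.sum_prod_type]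
      simp only [smul_mul_smul_comm]
    simp only [hp, G, sub_smul, Finset.sum_sub_distrib, map_mul]
  have h2 : ∀ k : ℕ, ∑ p, G ((D.braid ^ k) p) = ∑ p, G p := fun k => Equiv.sum_comp _ _
  have h3 : ∀ p, ∑ k ∈ Finset.range (orderOf D.braid), G ((D.braid ^ k) p) = 0 := by
    intro p
    have : ∀ k, G ((D.braid ^ k) p) = (algebraMap ℂ (Rat' N) (((D.m p.1 * D.m p.2 : ℕ) : ℂ) / 4) *
        (algebraMap ℂ (Rat' N) (((p.1 : Fin N → ℂ) ⬝ᵥ y) * ((p.2 : Fin N → ℂ) ⬝ᵥ z) -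
          ((p.1 : Fin N → ℂ) ⬝ᵥ z) * ((p.2 : Fin N → ℂ) ⬝ᵥ y)) *
        ((lin (((D.braid ^ k) p).1 : Fin N → ℂ))⁻¹ *
          (lin (((D.braid ^ k) p).2 : Fin N → ℂ))⁻¹))) • repK ρ (D.s p.1 * D.s p.2) := by
      intro k
      have h := D.braid_wedge p k ω (fun a => by simp only [ω, LinearMap.mk₂_apply]; ring)
      simp only [ω, LinearMap.mk₂_apply] at h
      simp only [G]
      rw [coef_mul_coef_sub, (D.braid_inv p k).1, (D.braid_inv p k).2, h]
    simp only [this, ← Finset.sum_smul, ← Finset.mul_sum]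
    rw [conn_comm_term, mul_zero, zero_smul]
  have h4 : (orderOf D.braid) • ∑ p, G p = 0 := by
    calc (orderOf D.braid) • ∑ p, G p
        = ∑ k ∈ Finset.range (orderOf D.braid), ∑ p, G ((D.braid ^ k) p) := by
          simp only [h2, Finset.sum_const, Finset.card_range]
      _ = 0 := by rw [Finset.sum_comm]; exact Finset.sum_eq_zero fun p _ => h3 p
  rw [← Nat.cast_smul_eq_nsmul (Rat' N), smul_eq_zero, Nat.cast_eq_zero] at h4
  exact sub_eq_zero.1 (h1.trans (h4.resolve_left (orderOf_pos D.braid).ne'))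

theorem conn_comm (y z : Fin N → ℂ) : D.conn ρ y * D.conn ρ z = D.conn ρ z * D.conn ρ y := by
  have := D.connRefl_comm ρ y z
  simp only [conn_eq, sub_mul, mul_sub, smul_mul_assoc, mul_smul_comm, one_mul, mul_one, this]
  simp only [smul_sub, smul_smul]
  rw [mul_comm (∑ a : D.roots, D.coef a z)]
  abel

theorem dirK_coef (a y z : Fin N → ℂ) : dirK z (D.coef a y) = dirK y (D.coef a z) := by
  by_cases h : a = 0
  · simp [coef, h]
  have h0 := lin_ne_zero h
  simp only [coef, dirK_div _ _ _ h0, Derivation.map_algebraMap, dirK_lin, ← map_mul, zero_mul,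
    zero_sub]
  congr 3; ring

theorem nabla_comm (y z : Fin N → ℂ) (p : Fin r → Rat' N) :
    D.nabla ρ y (D.nabla ρ z p) = D.nabla ρ z (D.nabla ρ y p) := by
  have h1 : ∀ y z, dirV y ((D.conn ρ z).mulVec p) =
      ∑ a ∈ D.roots, dirK y (D.coef a z) • (p - (repK ρ (D.s a)).mulVec p) +
        (D.conn ρ z).mulVec (dirV y p) := by
    intro y z
    rw [conn_mulVec, conn_mulVec, map_sum, ← Finset.sum_add_distrib]
    refine Finset.sum_congr rfl fun a _ => ?_
    rw [dirV_smul, map_sub, repK_apply, dirV_const_mulVec]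
  have h2 : dirV y (dirV z p) = dirV z (dirV y p) := funext fun i => dirK_comm _ _ _
  simp only [nabla_apply, map_add, Matrix.mulVec_mulVec, h1, h2,
    D.conn_comm ρ y z, D.dirK_coef _ z y]
  abel

end RootData

section regV

variable {n r : ℕ} {π : Pol n} (hπ : Prime π)

/-- Vectors of rational functions regular along `π`. -/
def regV (r : ℕ) : Submodule (reg hπ) (Fin r → Rat' n) where
  carrier := {p | ∀ i, p i ∈ reg hπ}
  add_mem' h h' i := add_mem (h i) (h' i)
  zero_mem' _ := zero_mem _
  smul_mem' c _ h i := mul_mem c.2 (h i)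

theorem smul_mem_regV {f : Rat' n} (hf : f ∈ reg hπ) {p : Fin r → Rat' n} (h : p ∈ regV hπ r) :
    f • p ∈ regV hπ r := fun i => mul_mem hf (h i)

theorem dirV_mem_regV (y : Fin n → ℂ) {p : Fin r → Rat' n} (h : p ∈ regV hπ r) :
    dirV y p ∈ regV hπ r := fun i => dirK_mem_reg hπ y (h i)

theorem const_mulVec_mem_regV {k : ℕ} (B : Matrix (Fin k) (Fin r) ℂ) {p : Fin r → Rat' n}
    (h : p ∈ regV hπ r) : (B.map (algebraMap ℂ (Rat' n))).mulVec p ∈ regV hπ k := fun i => by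
  rw [Matrix.mulVec, dotProduct]
  exact sum_mem fun j _ => mul_mem (const_mem_reg hπ _) (h j)

end regV

namespace RootData

variable {N : ℕ} {W : Type} [Group W] (D : RootData N W)
variable {r : ℕ} (ρ : W →* Matrix (Fin r) (Fin r) ℂ)

theorem coef_mem_reg {π : Pol N} (hπ : Prime π) {a : Fin N → ℂ} (h : ¬ π ∣ linPoly a)
    (y : Fin N → ℂ) : D.coef a y ∈ reg hπ := by
  rw [coef, div_eq_mul_inv]
  exact mul_mem (const_mem_reg hπ _) (inv_mem_reg hπ h)

theorem repK_mulVec_mem_regV {π : Pol N} (hπ : Prime π) (w : W) {p : Fin r → Rat' N}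
    (h : p ∈ regV hπ r) : (repK ρ w).mulVec p ∈ regV hπ r := const_mulVec_mem_regV hπ _ h

theorem nabla_mem_regV {π : Pol N} (hπ : Prime π) (hr : ∀ a ∈ D.roots, ¬ π ∣ linPoly a)
    (y : Fin N → ℂ) {p : Fin r → Rat' N} (h : p ∈ regV hπ r) : D.nabla ρ y p ∈ regV hπ r := by
  rw [nabla_apply, conn_mulVec]
  refine add_mem (dirV_mem_regV hπ y h) (sum_mem fun a ha => ?_)
  exact smul_mem_regV hπ (D.coef_mem_reg hπ (hr a ha) y)
    (sub_mem h (repK_mulVec_mem_regV ρ hπ _ h))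

section loc

variable {α : Fin N → ℂ} (hα : α ∈ D.pos)

include hα in
theorem prime_pos : Prime (linPoly α) := prime_linPoly (D.root_ne_zero (D.pos_roots hα))

include hα in
theorem nabla_sub_mem_regV (y : Fin N → ℂ) {p : Fin r → Rat' N}
    (h : p ∈ regV (D.prime_pos hα) r) :
    D.nabla ρ y p - (algebraMap ℂ (Rat' N) (D.m α * (α ⬝ᵥ y)) / lin α) •
      (p - D.kact ρ (D.s α) p) ∈ regV (D.prime_pos hα) r := by
  classical
  have hr := D.pos_roots hα
  have h1 : (D.conn ρ y).mulVec p = (2 : Rat' N) • (D.coef α y • (p - (repK ρ (D.s α)).mulVec p)) +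
      (2 : Rat' N) • ∑ a ∈ D.pos.erase α, D.coef a y • (p - (repK ρ (D.s a)).mulVec p) := by
    rw [conn_mulVec, D.sum_roots, two_nsmul, ← two_smul (Rat' N),
      ← Finset.add_sum_erase _ _ hα, smul_add]
    intro a ha
    have ha' := D.pos_roots ha
    rw [D.s_neg ha']
    congr 1
    rw [coef, coef, D.m_neg ha', lin_neg, neg_dotProduct, mul_neg, neg_div, map_neg]
    exact neg_div_neg_eq _ _
  have h2 : ((2 : Rat' N) • ∑ a ∈ D.pos.erase α, D.coef a y • (p - (repK ρ (D.s a)).mulVec p)) ∈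
      regV (D.prime_pos hα) r := by
    rw [two_smul]
    refine (fun h => add_mem h h) (sum_mem fun a ha => ?_)
    rw [Finset.mem_erase] at ha
    exact smul_mem_regV _ (D.coef_mem_reg _ (fun hd => ha.1 (D.pos_dvd hα ha.2 hd)) y)
      (sub_mem h (repK_mulVec_mem_regV ρ _ _ h))
  have h3 : (2 : Rat' N) • (D.coef α y • (p - (repK ρ (D.s α)).mulVec p)) =
      (algebraMap ℂ (Rat' N) (D.m α * (α ⬝ᵥ y)) / lin α) • (p - D.kact ρ (D.s α) p) -
      (repK ρ (D.s α)).mulVec (algebraMap ℂ (Rat' N) (D.m α * (α ⬝ᵥ y)) •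
        fun i => (p i - D.actK (D.s α) (p i)) / lin α) := by
    have h0 := lin_ne_zero (D.root_ne_zero hr)
    have h4 : (p - fun i => D.actK (D.s α) (p i)) =
        lin α • fun i => (p i - D.actK (D.s α) (p i)) / lin α := by
      ext i; simp; field_simp
    rw [kact_eq, show p - (repK ρ (D.s α)).mulVec (fun i => D.actK (D.s α) (p i)) =
      p - (repK ρ (D.s α)).mulVec p + (repK ρ (D.s α)).mulVec
        (p - fun i => D.actK (D.s α) (p i)) by rw [Matrix.mulVec_sub]; abel, h4, coef, map_div₀,
      Matrix.mulVec_smul, Matrix.mulVec_smul, smul_add, smul_smul _ (lin α), div_mul_cancel₀ _ h0,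
      add_sub_cancel_right, smul_smul]
    congr 1
    rw [map_ofNat]
    field_simp
  rw [nabla_apply, h1, h3]
  have h5 : (repK ρ (D.s α)).mulVec (algebraMap ℂ (Rat' N) (D.m α * (α ⬝ᵥ y)) •
      fun i => (p i - D.actK (D.s α) (p i)) / lin α) ∈ regV (D.prime_pos hα) r :=
    repK_mulVec_mem_regV ρ _ _ (smul_mem_regV _ (const_mem_reg _ _) fun i =>
      D.sub_actK_div_mem_reg hr _ (h i))
  convert add_mem (sub_mem (dirV_mem_regV (D.prime_pos hα) y h) h5) h2 using 1
  abel

include hα in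
theorem nabla_tangent_mem_regV {y : Fin N → ℂ} (hy : α ⬝ᵥ y = 0) {p : Fin r → Rat' N}
    (h : p ∈ regV (D.prime_pos hα) r) : D.nabla ρ y p ∈ regV (D.prime_pos hα) r := by
  simpa [hy] using D.nabla_sub_mem_regV ρ hα y h

include hα in
theorem kact_mem_regV {p : Fin r → Rat' N} (h : p ∈ regV (D.prime_pos hα) r) :
    D.kact ρ (D.s α) p ∈ regV (D.prime_pos hα) r := by
  rw [kact_eq]
  exact repK_mulVec_mem_regV ρ _ _ fun i => D.actK_mem_reg (D.pos_roots hα) _ (h i)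

/-- The normal vector of a root. -/
def nrm (α : Fin N → ℂ) : Fin N → ℂ := (α ⬝ᵥ α)⁻¹ • α

include hα in
theorem dot_nrm : α ⬝ᵥ nrm α = 1 := by
  rw [nrm, dotProduct_smul, smul_eq_mul, inv_mul_cancel₀ (D.sq_ne _ (D.pos_roots hα))]

include hα in
theorem nabla_nrm_mem_regV {p : Fin r → Rat' N} (h : p ∈ regV (D.prime_pos hα) r) :
    D.nabla ρ (nrm α) p - ((D.m α : Rat' N) / lin α) • (p - D.kact ρ (D.s α) p) ∈
      regV (D.prime_pos hα) r := by
  have := D.nabla_sub_mem_regV ρ hα (nrm α) h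
  rwa [D.dot_nrm hα, mul_one, map_natCast] at this

include hα in
theorem kact_nabla_nrm (p : Fin r → Rat' N) : D.kact ρ (D.s α) (D.nabla ρ (nrm α) p) =
    -D.nabla ρ (nrm α) (D.kact ρ (D.s α) p) := by
  rw [kact_nabla, nrm, Matrix.mulVec_smul, D.s_self (D.pos_roots hα), smul_neg, ← neg_one_smul ℂ,
    nabla_smul_left, neg_one_smul]

include hα in
theorem kact_nabla_tangent {y : Fin N → ℂ} (hy : α ⬝ᵥ y = 0) (p : Fin r → Rat' N) :
    D.kact ρ (D.s α) (D.nabla ρ y p) = D.nabla ρ y (D.kact ρ (D.s α) p) := by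
  rw [kact_nabla, D.s_orth (D.pos_roots hα) hy]

include hα in
theorem kact_lin_smul (p : Fin r → Rat' N) (k : ℕ) :
    D.kact ρ (D.s α) (lin α ^ k • p) = (-1 : Rat' N) ^ k • lin α ^ k • D.kact ρ (D.s α) p := by
  rw [kact_smul, map_pow, actK_lin, D.s_self (D.pos_roots hα), lin_neg, neg_pow, mul_smul]

include hα in
theorem dirK_lin_pow (k : ℕ) :
    dirK (nrm α) (lin α ^ (k + 1)) = ((k + 1 : ℕ) : Rat' N) * lin α ^ k := by
  rw [Derivation.leibniz_pow, dirK_lin, D.dot_nrm hα, map_one, nsmul_eq_mul, smul_eq_mul, mul_one]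
  simp

end loc

end RootData

namespace RootData

variable {N : ℕ} {W : Type} [Group W] (D : RootData N W)
variable {r : ℕ} (ρ : W →* Matrix (Fin r) (Fin r) ℂ)

section loc

variable {α : Fin N → ℂ} (hα : α ∈ D.pos)

include hα in
theorem lin_pos_ne_zero : lin α ≠ 0 := lin_ne_zero (D.root_ne_zero (D.pos_roots hα))

include hα in
theorem lin_mem_reg (k : ℕ) : lin α ^ k ∈ reg (D.prime_pos hα) :=
  pow_mem (algebraMap_mem_reg _ _) k

include hα in
theorem nabla_nrm_pow_smul (k : ℕ) (c : ℂ) (q : Fin r → Rat' N) :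
    D.nabla ρ (nrm α) (c • (lin α ^ (k + 1) • q)) =
      c • (((k + 1 : ℕ) : Rat' N) • lin α ^ k • q + lin α ^ (k + 1) • D.nabla ρ (nrm α) q) := by
  rw [map_smul, nabla_smul, D.dirK_lin_pow hα, mul_smul]

include hα in
/-- Odd regular vectors can be corrected to approximate solutions of the normal equation. -/
theorem exists_approx (k : ℕ) {p : Fin r → Rat' N} (hp : p ∈ regV (D.prime_pos hα) r)
    (hodd : D.kact ρ (D.s α) p = -p) : ∃ v ∈ regV (D.prime_pos hα) r,
      D.kact ρ (D.s α) v = -v ∧ (∃ q ∈ regV (D.prime_pos hα) r, v - p = lin α • q) ∧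
      ∃ e ∈ regV (D.prime_pos hα) r,
        D.nabla ρ (nrm α) v - (2 * (D.m α : Rat' N) / lin α) • v = lin α ^ k • e := by
  have h0 := D.lin_pos_ne_zero hα
  induction k with
  | zero =>
    refine ⟨p, hp, hodd, ⟨0, zero_mem _, by simp⟩, _, D.nabla_nrm_mem_regV ρ hα hp, ?_⟩
    rw [hodd, pow_zero, one_smul, sub_neg_eq_add, ← two_smul (Rat' N), smul_smul]
    congr 2; ring
  | succ k ih =>
    obtain ⟨v, hv, hvo, ⟨q, hq, hvq⟩, e, he, hve⟩ := ih
    have hse : D.kact ρ (D.s α) e = (-1 : Rat' N) ^ k • e := by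
      have h2 : D.actK (D.s α) (2 * (D.m α : Rat' N) / lin α) =
          -(2 * (D.m α : Rat' N) / lin α) := by
        rw [map_div₀, actK_lin, D.s_self (D.pos_roots hα), lin_neg, map_mul, map_natCast,
          map_ofNat]
        exact div_neg _
      have h1 := congrArg (D.kact ρ (D.s α)) hve
      rw [kact_lin_smul _ _ hα, map_sub, kact_nabla_nrm _ _ hα, kact_smul, h2, hvo,
        map_neg, neg_neg, smul_neg, neg_smul, neg_neg, hve, smul_comm] at h1
      have h3 := rat_ind_eq (pow_ne_zero k h0) h1
      calc _ = (-1 : Rat' N) ^ k • ((-1 : Rat' N) ^ k • D.kact ρ (D.s α) e) := by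
            rw [smul_smul, ← mul_pow]; simp
        _ = _ := by rw [← h3]
    have key : ∃ (c : ℂ) (e' : Fin r → Rat' N), e' ∈ regV (D.prime_pos hα) r ∧
        lin α ^ k • e + (D.nabla ρ (nrm α) (c • (lin α ^ (k + 1) • e)) -
          (2 * (D.m α : Rat' N) / lin α) • (c • (lin α ^ (k + 1) • e))) =
          lin α ^ (k + 1) • e' := by
      have h2 := D.nabla_nrm_mem_regV ρ hα he
      set e2 := D.nabla ρ (nrm α) e - ((D.m α : Rat' N) / lin α) • (e - D.kact ρ (D.s α) e)
      have h3 : D.nabla ρ (nrm α) e = e2 + ((D.m α : Rat' N) / lin α) •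
        (e - D.kact ρ (D.s α) e) := by simp [e2]
      rcases Nat.even_or_odd k with hk | hk
      · rw [hk.neg_one_pow, one_smul] at hse
        rw [hse, sub_self, smul_zero, add_zero] at h3
        have hc : ((k : ℂ) + 1 - 2 * D.m α) ≠ 0 := by
          intro h
          have : (k + 1 : ℕ) = 2 * D.m α := by
            rw [sub_eq_zero] at h; exact_mod_cast h
          obtain ⟨l, rfl⟩ := hk
          omega
        refine ⟨-((k : ℂ) + 1 - 2 * D.m α)⁻¹, -((k : ℂ) + 1 - 2 * D.m α)⁻¹ • e2,
          fun i => smul_mem_reg _ _ (h2 i), ?_⟩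
        rw [nabla_nrm_pow_smul _ _ hα, h3]
        have hc' : ((k : Rat' N) + 1 - 2 * D.m α) ≠ 0 := by
          have := (map_ne_zero (algebraMap ℂ (Rat' N))).2 hc
          simpa only [map_sub, map_add, map_natCast, map_mul, map_ofNat, map_one] using this
        ext i
        simp only [Pi.add_apply, Pi.sub_apply, Pi.smul_apply]
        simp only [Algebra.smul_def, map_neg, map_inv₀,
          map_sub, map_add, map_natCast, map_mul, map_ofNat, map_one, Nat.cast_add,
          Nat.cast_one, Algebra.algebraMap_self, RingHom.id_apply, pow_succ]
        field_simp
        ring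
      · rw [hk.neg_one_pow, neg_one_smul] at hse
        rw [hse] at h3
        have hc : ((k : ℂ) + 1) ≠ 0 := by exact_mod_cast Nat.succ_ne_zero k
        refine ⟨-((k : ℂ) + 1)⁻¹, -((k : ℂ) + 1)⁻¹ • e2,
          fun i => smul_mem_reg _ _ (h2 i), ?_⟩
        rw [nabla_nrm_pow_smul _ _ hα, h3]
        have hc' : ((k : Rat' N) + 1) ≠ 0 := by exact_mod_cast Nat.succ_ne_zero k
        ext i
        simp only [Pi.add_apply, Pi.sub_apply, Pi.smul_apply, Pi.neg_apply]
        simp only [Algebra.smul_def, map_neg, map_inv₀,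
          map_add, map_natCast, map_mul, map_one, Nat.cast_add,
          Nat.cast_one, Algebra.algebraMap_self, RingHom.id_apply, pow_succ]
        field_simp
        ring
    obtain ⟨c, e', he', hce⟩ := key
    refine ⟨v + c • (lin α ^ (k + 1) • e), ?_, ?_, ⟨q + c • (lin α ^ k • e), ?_, ?_⟩, e', he', ?_⟩
    · exact add_mem hv fun i => smul_mem_reg _ _ (mul_mem (D.lin_mem_reg hα _) (he i))
    · rw [map_add, map_smul, kact_lin_smul _ _ hα, hse, hvo, smul_comm (lin α ^ (k + 1)), smul_smul,
        ← pow_add, show k + 1 + k = 2 * k + 1 by ring, pow_succ, pow_mul]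
      simp [add_comm]
    · exact add_mem hq fun i => smul_mem_reg _ _ (mul_mem (D.lin_mem_reg hα _) (he i))
    · rw [smul_add, ← hvq, smul_comm (lin α) c, smul_smul (lin α), ← pow_succ']
      abel
    · rw [← hce, ← hve, map_add, smul_add]
      abel

/-- Odd solutions of the normal equation to high order. -/
def oddSol : Set (Fin r → Rat' N) := {v | v ∈ regV (D.prime_pos hα) r ∧
  D.kact ρ (D.s α) v = -v ∧ ∃ e ∈ regV (D.prime_pos hα) r,
    D.nabla ρ (nrm α) v - (2 * (D.m α : Rat' N) / lin α) • v = lin α ^ (2 * D.m α) • e}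

/-- The lattice of Deligne type along the hyperplane of `α`. -/
def lattice : Submodule (reg (D.prime_pos hα)) (Fin r → Rat' N) :=
  Submodule.span _ ((regV (D.prime_pos hα) r : Set (Fin r → Rat' N)) ∪
    (fun v => (lin α ^ (2 * D.m α))⁻¹ • v) '' D.oddSol ρ hα)

theorem regV_le_lattice {p : Fin r → Rat' N} (h : p ∈ regV (D.prime_pos hα) r) :
    p ∈ D.lattice ρ hα := Submodule.subset_span (Or.inl h)

theorem oddSol_mem_lattice {v : Fin r → Rat' N} (h : v ∈ D.oddSol ρ hα) :
    (lin α ^ (2 * D.m α))⁻¹ • v ∈ D.lattice ρ hα := Submodule.subset_span (Or.inr ⟨v, h, rfl⟩)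

theorem reg_smul_mem_lattice {f : Rat' N} (hf : f ∈ reg (D.prime_pos hα)) {p : Fin r → Rat' N}
    (h : p ∈ D.lattice ρ hα) : f • p ∈ D.lattice ρ hα :=
  Submodule.smul_mem _ (⟨f, hf⟩ : reg (D.prime_pos hα)) h

theorem lattice_pole {p : Fin r → Rat' N} (h : p ∈ D.lattice ρ hα) :
    lin α ^ (2 * D.m α) • p ∈ regV (D.prime_pos hα) r := by
  induction h using Submodule.span_induction with
  | mem x hx =>
    rcases hx with hx | ⟨v, hv, rfl⟩
    · exact smul_mem_regV _ (D.lin_mem_reg hα _) hx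
    · simp only
      rw [smul_smul, mul_inv_cancel₀ (pow_ne_zero _ (D.lin_pos_ne_zero hα)), one_smul]
      exact hv.1
  | zero => simp
  | add x y _ _ hx hy => rw [smul_add]; exact add_mem hx hy
  | smul c x _ hx => rw [smul_comm]; exact Submodule.smul_mem _ _ hx

theorem nabla_mem_lattice_of_regV (y : Fin N → ℂ) {p : Fin r → Rat' N}
    (h : p ∈ regV (D.prime_pos hα) r) : D.nabla ρ y p ∈ D.lattice ρ hα := by
  have h0 := D.lin_pos_ne_zero hα
  rw [← sub_add_cancel (D.nabla ρ y p) ((algebraMap ℂ (Rat' N) (D.m α * (α ⬝ᵥ y)) / lin α) •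
      (p - D.kact ρ (D.s α) p))]
  refine add_mem (D.regV_le_lattice ρ hα (D.nabla_sub_mem_regV ρ hα y h)) ?_
  rcases Nat.eq_zero_or_pos (D.m α) with hm | hm
  · simp [hm]
  have hp' := sub_mem h (D.kact_mem_regV ρ hα h)
  obtain ⟨v, hv, hvo, ⟨q, hq, hvq⟩, he⟩ := D.exists_approx ρ hα (2 * D.m α) hp' (by
    rw [map_sub, kact_kact, D.s_sq (D.pos_roots hα), kact_one]; abel)
  have h1 := D.oddSol_mem_lattice ρ hα (v := v) ⟨hv, hvo, he⟩
  have h2 : (algebraMap ℂ (Rat' N) (D.m α * (α ⬝ᵥ y)) / lin α) • (p - D.kact ρ (D.s α) p) =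
      algebraMap ℂ (Rat' N) (D.m α * (α ⬝ᵥ y)) • (lin α ^ (2 * D.m α - 1) •
        ((lin α ^ (2 * D.m α))⁻¹ • v) - q) := by
    have h3 : lin α ^ (2 * D.m α) = lin α ^ (2 * D.m α - 1) * lin α := by
      rw [← pow_succ]; congr 1; omega
    have h4 : p - D.kact ρ (D.s α) p = v - lin α • q := by rw [← hvq]; abel
    rw [h4, div_eq_mul_inv, mul_smul, smul_sub, smul_smul _ (lin α), inv_mul_cancel₀ h0, one_smul,
      h3, smul_smul, mul_inv, ← mul_assoc, mul_inv_cancel₀ (pow_ne_zero _ h0), one_mul]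
  rw [h2]
  exact D.reg_smul_mem_lattice ρ hα (const_mem_reg _ _) (sub_mem
    (D.reg_smul_mem_lattice ρ hα (D.lin_mem_reg hα _) h1) (D.regV_le_lattice ρ hα hq))

include hα in
theorem nabla_nrm_inv_smul (k : ℕ) (v : Fin r → Rat' N) :
    D.nabla ρ (nrm α) ((lin α ^ k)⁻¹ • v) =
      (lin α ^ k)⁻¹ • (D.nabla ρ (nrm α) v - ((k : Rat' N) / lin α) • v) := by
  have h0 := D.lin_pos_ne_zero hα
  rw [nabla_smul, smul_sub, smul_smul, sub_eq_add_neg, add_comm, ← neg_smul]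
  congr 2
  rw [inv_eq_one_div, dirK_div _ _ _ (pow_ne_zero k h0), Derivation.map_one_eq_zero]
  cases k with
  | zero => simp
  | succ k =>
    rw [D.dirK_lin_pow hα]
    field_simp
    ring

include hα in
theorem nabla_tangent_inv_smul {y : Fin N → ℂ} (hy : α ⬝ᵥ y = 0) (k : ℕ) (f : Fin r → Rat' N) :
    D.nabla ρ y (lin α ^ k • f) = lin α ^ k • D.nabla ρ y f ∧
      D.nabla ρ y ((lin α ^ k)⁻¹ • f) = (lin α ^ k)⁻¹ • D.nabla ρ y f ∧
      D.nabla ρ y ((2 * (D.m α : Rat' N) / lin α) • f) =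
        (2 * (D.m α : Rat' N) / lin α) • D.nabla ρ y f := by
  have h0 := D.lin_pos_ne_zero hα
  have h1 : dirK y (lin α ^ k) = 0 := by
    rw [Derivation.leibniz_pow, dirK_lin, hy]; simp
  refine ⟨?_, ?_, ?_⟩
  · rw [nabla_smul, h1, zero_smul, zero_add]
  · rw [nabla_smul, inv_eq_one_div, dirK_div _ _ _ (pow_ne_zero k h0), h1]; simp
  · rw [nabla_smul, dirK_div _ _ _ h0, dirK_lin, hy, ← Nat.cast_two, ← Nat.cast_mul,
      Derivation.map_natCast]
    simp

theorem nabla_tangent_oddSol {y : Fin N → ℂ} (hy : α ⬝ᵥ y = 0) {v : Fin r → Rat' N}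
    (h : v ∈ D.oddSol ρ hα) : D.nabla ρ y v ∈ D.oddSol ρ hα := by
  obtain ⟨hv, hvo, e, he, hve⟩ := h
  refine ⟨D.nabla_tangent_mem_regV ρ hα hy hv, ?_, _, D.nabla_tangent_mem_regV ρ hα hy he, ?_⟩
  · rw [kact_nabla_tangent _ _ hα hy, hvo, map_neg]
  · rw [← (D.nabla_tangent_inv_smul ρ hα hy _ _).1, ← hve, map_sub, nabla_comm,
      (D.nabla_tangent_inv_smul ρ hα hy 0 _).2.2]

theorem nabla_mem_lattice (y : Fin N → ℂ) {p : Fin r → Rat' N} (h : p ∈ D.lattice ρ hα) :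
    D.nabla ρ y p ∈ D.lattice ρ hα := by
  induction h using Submodule.span_induction with
  | mem x hx =>
    rcases hx with hx | ⟨v, hv, rfl⟩
    · exact D.nabla_mem_lattice_of_regV ρ hα y hx
    · have hy : y = (α ⬝ᵥ y) • nrm α + (y - (α ⬝ᵥ y) • nrm α) := by abel
      have hy' : α ⬝ᵥ (y - (α ⬝ᵥ y) • nrm α) = 0 := by
        rw [dotProduct_sub, dotProduct_smul, D.dot_nrm hα]; simp
      rw [hy, nabla_add_left, nabla_smul_left]
      refine add_mem ?_ ?_
      · obtain ⟨e, he, hve⟩ := hv.2.2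
        simp only
        rw [nabla_nrm_inv_smul _ _ hα]
        push_cast
        rw [hve, smul_smul, inv_mul_cancel₀ (pow_ne_zero _ (D.lin_pos_ne_zero hα)), one_smul]
        exact D.regV_le_lattice ρ hα fun i => smul_mem_reg _ _ (he i)
      · simp only
        rw [(D.nabla_tangent_inv_smul ρ hα hy' _ _).2.1]
        exact D.oddSol_mem_lattice ρ hα (D.nabla_tangent_oddSol ρ hα hy' hv)
  | zero => simp
  | add x y _ _ hx hy => rw [map_add]; exact add_mem hx hy
  | smul c x hx' hx =>
    rw [Subring.smul_def, nabla_smul]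
    exact add_mem (D.reg_smul_mem_lattice ρ hα (dirK_mem_reg _ _ c.2) hx')
      (D.reg_smul_mem_lattice ρ hα c.2 hx)

/-- A flat symmetric vector with bounded pole along `α` is regular along `α`. -/
theorem regV_of_flat {p : Fin r → Rat' N} (hp : D.nabla ρ (nrm α) p = 0)
    (hs : D.kact ρ (D.s α) p = p)
    (hpole : lin α ^ (2 * D.m α) • p ∈ regV (D.prime_pos hα) r) :
    p ∈ regV (D.prime_pos hα) r := by
  classical
  have h0 := D.lin_pos_ne_zero hα
  have hex : ∃ k, lin α ^ k • p ∈ regV (D.prime_pos hα) r := ⟨_, hpole⟩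
  have hk := Nat.find_spec hex
  have hmin := fun j => Nat.find_min (m := j) hex
  set k := Nat.find hex
  rcases Nat.eq_zero_or_pos k with h | h
  · rwa [h, pow_zero, one_smul] at hk
  exfalso
  have hmin' := hmin (k - 1) (by omega)
  obtain ⟨j, hj⟩ : ∃ j, k = j + 1 := ⟨k - 1, by omega⟩
  rw [hj] at hk hmin'
  have h1 := D.nabla_nrm_mem_regV ρ hα hk
  rw [nabla_smul, D.dirK_lin_pow hα, hp, smul_zero, add_zero, kact_lin_smul _ _ hα, hs] at h1
  have hgen : ∀ c : ℂ, c ≠ 0 → algebraMap ℂ (Rat' N) c • (lin α ^ j • p) ∉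
      regV (D.prime_pos hα) r := fun c hc hmem => hmin' <| by
    have := smul_mem_regV _ (const_mem_reg (D.prime_pos hα) c⁻¹) hmem
    rwa [smul_smul, ← map_mul, inv_mul_cancel₀ hc, map_one, one_smul] at this
  rcases Nat.even_or_odd j with he | ho
  · have he' : (-1 : Rat' N) ^ (j + 1) = -1 := he.add_one.neg_one_pow
    rw [he', neg_one_smul, sub_neg_eq_add, ← two_smul (Rat' N), smul_smul, smul_smul,
      ← sub_smul] at h1
    have hc : ((j : ℂ) + 1 - 2 * D.m α) ≠ 0 := by
      intro h
      have : (j + 1 : ℕ) = 2 * D.m α := by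
        rw [sub_eq_zero] at h; exact_mod_cast h
      obtain ⟨l, rfl⟩ := he
      omega
    refine hgen _ hc ?_
    convert h1 using 1
    rw [smul_smul]
    congr 1
    simp only [map_sub, map_add, map_natCast, map_mul, map_ofNat, map_one, Nat.cast_add,
      Nat.cast_one, pow_succ]
    field_simp
  · have he' : (-1 : Rat' N) ^ (j + 1) = 1 := ho.add_one.neg_one_pow
    rw [he', one_smul, sub_self, smul_zero, sub_zero, mul_smul] at h1
    refine hgen ((j + 1 : ℕ) : ℂ) (by exact_mod_cast Nat.succ_ne_zero j) ?_
    rwa [map_natCast]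

end loc

end RootData

section euler

variable {n : ℕ}

/-- The Euler derivation on polynomials. -/
def euler : Derivation ℂ (Pol n) (Pol n) := ∑ i, (X i : Pol n) • pderiv i

theorem euler_apply (f : Pol n) : euler f = ∑ i, X i * pderiv i f :=
  (congrFun (map_sum (Derivation.coeFnAddMonoidHom (R := ℂ) (A := Pol n) (M := Pol n))
    (fun i => (X i : Pol n) • pderiv i) Finset.univ) f).trans (Finset.sum_apply _ _ _)

theorem euler_monomial (s : Fin n →₀ ℕ) (c : ℂ) :
    euler (monomial s c) = (s.degree : ℂ) • monomial s c := by
  simp only [euler_apply, X_mul_pderiv_monomial, ← Finset.sum_smul, Finsupp.degree_eq_sum,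
    Nat.cast_smul_eq_nsmul]

theorem coeff_euler (f : Pol n) (s : Fin n →₀ ℕ) : coeff s (euler f) = s.degree * coeff s f := by
  induction f using MvPolynomial.induction_on' with
  | monomial u a =>
    rw [euler_monomial, coeff_smul, smul_eq_mul, coeff_monomial]
    split_ifs with h
    · rw [h]
    · simp
  | add p q hp hq => rw [map_add, coeff_add, hp, hq, coeff_add, mul_add]

theorem euler_of_isHomogeneous {f : Pol n} {d : ℕ} (h : f.IsHomogeneous d) :
    euler f = (d : ℂ) • f := by
  ext s
  rw [coeff_euler, coeff_smul, smul_eq_mul]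
  by_cases hs : coeff s f = 0
  · simp [hs]
  · rw [← h hs, Finsupp.degree_eq_weight_one]
    rfl

theorem degree_of_euler {f : Pol n} {d : ℤ} (h : euler f = (d : ℂ) • f) {s : Fin n →₀ ℕ}
    (hs : coeff s f ≠ 0) : (s.degree : ℤ) = d := by
  have := congrArg (coeff s) h
  rw [coeff_euler, coeff_smul, smul_eq_mul] at this
  exact_mod_cast mul_right_cancel₀ hs this

theorem homogeneousComponent_mul {d : ℕ} {g : Pol n} (hg : g.IsHomogeneous d) (f : Pol n) (k : ℕ) :
    homogeneousComponent (k + d) (f * g) = homogeneousComponent k f * g := by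
  conv_lhs => rw [← sum_homogeneousComponent f, Finset.sum_mul, map_sum]
  have : ∀ i ∈ Finset.range (f.totalDegree + 1),
      homogeneousComponent (k + d) (homogeneousComponent i f * g) =
        if i = k then homogeneousComponent k f * g else 0 := fun i _ => by
    rw [homogeneousComponent_of_mem ((homogeneousComponent_isHomogeneous i f).mul hg)]
    by_cases h : i = k
    · simp [h]
    · rw [if_neg (by omega), if_neg h]
  rw [Finset.sum_congr rfl this, Finset.sum_ite_eq']
  split_ifs with h
  · rfl
  · rw [homogeneousComponent_eq_zero, zero_mul]
    simpa using h

/-- The Euler derivation on rational functions. -/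
def eulerK : Derivation ℂ (Rat' n) (Rat' n) :=
  ∑ i, algebraMap (Pol n) (Rat' n) (X i) • dirK (Pi.single i 1)

theorem eulerK_apply (f : Rat' n) :
    eulerK f = ∑ i, algebraMap (Pol n) (Rat' n) (X i) * dirK (Pi.single i 1) f :=
  (congrFun (map_sum (Derivation.coeFnAddMonoidHom (R := ℂ) (A := Rat' n) (M := Rat' n))
    (fun i => algebraMap (Pol n) (Rat' n) (X i) • dirK (Pi.single i 1)) Finset.univ) f).trans
    (Finset.sum_apply _ _ _)

theorem dir_single (i : Fin n) (f : Pol n) : dir (Pi.single i 1) f = pderiv i f := by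
  simp [dir_apply, Pi.single_apply, ite_smul]

theorem eulerK_algebraMap (f : Pol n) :
    eulerK (algebraMap _ (Rat' n) f) = algebraMap _ _ (euler f) := by
  simp [eulerK_apply, euler_apply, dirK_algebraMap, dir_single]

theorem eulerK_dirK (y : Fin n → ℂ) (f : Rat' n) :
    eulerK (dirK y f) = dirK y (eulerK f) - dirK y f := by
  have h : ∀ i, dirK y (algebraMap (Pol n) (Rat' n) (X i)) = algebraMap ℂ _ (y i) := fun i => by
    rw [← linPoly_single]
    have := dirK_lin y (Pi.single i 1)
    rw [single_one_dotProduct] at this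
    exact this
  have h2 : dirK y f = ∑ i, algebraMap ℂ (Rat' n) (y i) * dirK (Pi.single i 1) f := by
    have hy : y = ∑ i, y i • (Pi.single i 1 : Fin n → ℂ) := by
      ext j; simp [Finset.sum_apply, Pi.single_apply]
    have key : ∀ s : Finset (Fin n), dirK (∑ i ∈ s, y i • (Pi.single i 1 : Fin n → ℂ)) f =
        ∑ i ∈ s, algebraMap ℂ (Rat' n) (y i) * dirK (Pi.single i 1) f := fun s => by
      classical
      induction s using Finset.induction_on with
      | empty =>
        rw [Finset.sum_empty, Finset.sum_empty, ← zero_smul ℂ (0 : Fin n → ℂ), dirK_smul, zero_smul]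
      | insert a s ha ih =>
        rw [Finset.sum_insert ha, Finset.sum_insert ha, dirK_add, dirK_smul, ih, Algebra.smul_def]
    conv_lhs => rw [hy]
    exact key _
  rw [eulerK_apply, eulerK_apply, map_sum]
  conv_rhs => arg 2; rw [h2]
  rw [← Finset.sum_sub_distrib]
  refine Finset.sum_congr rfl fun i _ => ?_
  rw [Derivation.leibniz, h, dirK_comm, smul_eq_mul, smul_eq_mul]
  ring

/-- Homogeneous vectors of rational functions. -/
def HomV {r : ℕ} (d : ℤ) (p : Fin r → Rat' n) : Prop := ∀ i, eulerK (p i) = (d : Rat' n) * p i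

theorem homV_algebraMap {f : Pol n} {d : ℤ}
    (h : eulerK (algebraMap _ (Rat' n) f) = (d : Rat' n) * algebraMap _ _ f) :
    euler f = (d : ℂ) • f := by
  refine FaithfulSMul.algebraMap_injective (Pol n) (Rat' n) ?_
  rw [← eulerK_algebraMap, h, smul_eq_C_mul, map_mul, algebraMap_C, map_intCast]

end euler

/-- A basis of the lowest homogeneous part of a submodule of logarithmic vector fields stable under
the reflection group and the Dunkl operators. -/
structure DunklKernel {N : ℕ} {W : Type} [Group W] (D : RootData N W) (r : ℕ) where
  /-- The degree. -/
  d : ℕ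
  /-- The vector fields. -/
  φ : Fin r → Fin N → Pol N
  /-- The representation carried by the vector fields. -/
  ρ : W →* Matrix (Fin r) (Fin r) ℂ
  pos : 0 < r
  hom : ∀ j i, (φ j i).IsHomogeneous d
  ind : LinearIndependent ℂ φ
  mem : ∀ j, φ j ∈ D.mder fun a => 2 * D.m a
  equiv : ∀ w j, D.vact w (φ j) = ∑ i, ρ w i j • φ i
  flat : ∀ y j i, dirK y (algebraMap _ (Rat' N) (φ j i)) =
    ∑ a ∈ D.roots, D.coef a y * algebraMap _ (Rat' N) ((φ j - D.vact (D.s a) (φ j)) i)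

namespace DunklKernel

variable {N : ℕ} {W : Type} [Group W] {D : RootData N W} {r : ℕ} (Φ : DunklKernel D r)

/-- The map to vector fields given by the basis. -/
def M : (Fin r → Rat' N) →ₗ[Rat' N] (Fin N → Rat' N) :=
  (Matrix.of fun i j => algebraMap _ (Rat' N) (Φ.φ j i)).mulVecLin

theorem M_apply (p : Fin r → Rat' N) (i : Fin N) :
    Φ.M p i = ∑ j, algebraMap _ (Rat' N) (Φ.φ j i) * p j := rfl

theorem M_algebraMap (c : Fin r → Pol N) (i : Fin N) :
    Φ.M (fun j => algebraMap _ _ (c j)) i = algebraMap _ _ ((∑ j, c j • Φ.φ j) i) := by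
  simp [M_apply, Finset.sum_apply, mul_comm]

theorem algebraMap_vact (w : W) (j : Fin r) (i : Fin N) :
    algebraMap _ (Rat' N) (D.vact w (Φ.φ j) i) =
      ∑ k, algebraMap _ (Rat' N) (Φ.φ k i) * algebraMap ℂ (Rat' N) (Φ.ρ w k j) := by
  rw [Φ.equiv, Finset.sum_apply, map_sum]
  refine Finset.sum_congr rfl fun k _ => ?_
  rw [Pi.smul_apply, smul_eq_C_mul, map_mul, algebraMap_C, mul_comm]

theorem M_repK (w : W) (p : Fin r → Rat' N) (i : Fin N) :
    Φ.M ((RootData.repK Φ.ρ w).mulVec p) i =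
      ∑ j, algebraMap _ (Rat' N) (D.vact w (Φ.φ j) i) * p j := by
  simp only [M_apply, algebraMap_vact, Matrix.mulVec, dotProduct, Finset.mul_sum, Finset.sum_mul,
    RootData.repK_apply, Matrix.map_apply, mul_assoc]
  exact Finset.sum_comm

theorem dirV_M (y : Fin N → ℂ) (p : Fin r → Rat' N) :
    dirV y (Φ.M p) = Φ.M (D.nabla Φ.ρ y p) := by
  rw [RootData.nabla_apply, map_add, RootData.conn_mulVec, map_sum]
  ext i
  rw [dirV_apply, M_apply, map_sum, Pi.add_apply, Finset.sum_apply]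
  simp only [Derivation.leibniz, smul_eq_mul, Φ.flat]
  rw [Finset.sum_add_distrib]
  congr 1
  simp only [map_smul, map_sub, Pi.smul_apply, Pi.sub_apply, M_repK, smul_eq_mul]
  simp only [M_apply, ← Finset.sum_sub_distrib, Finset.mul_sum]
  rw [Finset.sum_comm]
  refine Finset.sum_congr rfl fun j _ => Finset.sum_congr rfl fun a _ => ?_
  ring

theorem M_kact (w : W) (p : Fin r → Rat' N) :
    tact (D.g w) (D.actK w) (Φ.M p) = Φ.M (D.kact Φ.ρ w p) := by
  rw [RootData.kact_eq]
  ext i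
  rw [M_repK, tact_apply]
  simp only [M_apply, map_sum, map_mul, RootData.actK_algebraMap, RootData.vact, tact_apply,
    Finset.smul_sum, Finset.sum_mul]
  rw [Finset.sum_comm]
  refine Finset.sum_congr rfl fun j _ => Finset.sum_congr rfl fun k _ => ?_
  rw [smul_eq_C_mul, map_mul, algebraMap_C, Algebra.smul_def, mul_assoc]

end DunklKernel

theorem reg_mono_of_dvd {n : ℕ} {π π' : Pol n} (hπ : Prime π) (hπ' : Prime π') (h : π ∣ π')
    {f : Rat' n} (hf : f ∈ reg hπ') : f ∈ reg hπ := by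
  obtain ⟨b, c, hb, hc⟩ := hf
  exact ⟨b, c, fun h' => hb (((hπ.dvd_prime_iff_associated hπ').1 h).symm.dvd.trans h'), hc⟩

theorem unscale_mem_reg {n : ℕ} {π : Pol n} (hπ : Prime π) {b : Pol n} (hb : ¬ π ∣ b)
    {f : Rat' n} (hf : algebraMap _ _ b * f ∈ reg hπ) : f ∈ reg hπ := by
  have h0 : algebraMap (Pol n) (Rat' n) b ≠ 0 :=
    algebraMap_ne_zero fun h => hb (h ▸ dvd_zero _)
  have := mul_mem (inv_mem_reg hπ hb) hf
  rwa [← mul_assoc, inv_mul_cancel₀ h0, one_mul] at this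

namespace RootData

variable {N : ℕ} {W : Type} [Group W] (D : RootData N W)

/-- The defining polynomial of the multiarrangement. -/
def Q : Pol N := ∏ a ∈ D.roots, linPoly a ^ D.m a

theorem act_Q (w : W) : D.act w D.Q = D.Q := by
  rw [Q, map_prod]
  have h := Finset.prod_congr rfl fun a (ha : a ∈ D.roots) =>
    show D.act w (linPoly a ^ D.m a) =
      linPoly ((D.g w).mulVec a) ^ D.m ((D.g w).mulVec a) by
    rw [map_pow, act_linPoly, D.m_inv w a ha]
  rw [h]
  exact D.sum_roots_g (M := Additive (Pol N)) w
    (fun a => Additive.ofMul (linPoly a ^ D.m a))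

theorem Q_ne_zero : D.Q ≠ 0 := Finset.prod_ne_zero_iff.2 fun _ ha =>
  pow_ne_zero _ fun h => D.root_ne_zero ha (linPoly_eq_zero.1 h)

theorem not_dvd_Q {π : Pol N} (hπ : Prime π) (hr : ∀ a ∈ D.roots, ¬ π ∣ linPoly a) :
    ¬ π ∣ D.Q := by
  intro h
  obtain ⟨a, ha, h⟩ := (hπ.dvd_finsetProd_iff _).1 h
  exact hr a ha (hπ.dvd_of_dvd_pow h)

theorem Q_eq {α : Fin N → ℂ} (hα : α ∈ D.pos) :
    ∃ q, ¬ linPoly α ∣ q ∧ D.Q = q * linPoly α ^ (2 * D.m α) := by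
  classical
  have h1 := D.pos_roots hα
  have h2 := D.neg_roots h1
  refine ⟨(-1) ^ D.m α * ∏ a ∈ (D.roots.erase α).erase (-α), linPoly a ^ D.m a, ?_, ?_⟩
  · intro h
    rcases (D.prime_pos hα).dvd_or_dvd h with h | h
    · exact (D.prime_pos hα).not_isUnit
        (isUnit_of_dvd_unit ((D.prime_pos hα).dvd_of_dvd_pow h) isUnit_one.neg)
    · obtain ⟨a, ha, h⟩ := ((D.prime_pos hα).dvd_finsetProd_iff _).1 h
      simp only [Finset.mem_erase] at ha
      rcases D.eq_or_neg h1 ha.2.2 ((D.prime_pos hα).dvd_of_dvd_pow h) with e | e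
      · exact ha.2.1 e
      · exact ha.1 e
  · rw [Q, ← Finset.mul_prod_erase _ _ h1,
      ← Finset.mul_prod_erase (D.roots.erase α) _ (Finset.mem_erase.2 ⟨D.neg_ne h1, h2⟩),
      linPoly_neg, D.m_neg h1, neg_pow, two_mul, pow_add]
    ring

theorem euler_Q : euler D.Q = ((∑ a ∈ D.roots, D.m a : ℕ) : ℂ) • D.Q := by
  refine euler_of_isHomogeneous (IsHomogeneous.prod _ _ _ fun a _ => ?_)
  simpa using (isHomogeneous_linPoly a).pow (D.m a)

/-- Regularity can be tested away from the roots and along the positive roots. -/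
theorem exists_pol_of_reg {f : Rat' N}
    (h : ∀ π (hπ : Prime π), (∀ a ∈ D.roots, ¬ π ∣ linPoly a) → f ∈ reg hπ)
    (h' : ∀ α (hα : α ∈ D.pos), f ∈ reg (D.prime_pos hα)) :
    ∃ c : Pol N, algebraMap _ _ c = f := by
  refine _root_.exists_pol_of_reg fun π hπ => ?_
  by_cases hr : ∀ a ∈ D.roots, ¬ π ∣ linPoly a
  · exact h π hπ hr
  · push Not at hr
    obtain ⟨a, ha, hd⟩ := hr
    rcases (D.mem_roots a).1 ha with hp | hp
    · exact reg_mono_of_dvd hπ _ hd (h' a hp)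
    · refine reg_mono_of_dvd hπ (D.prime_pos hp) ?_ (h' _ hp)
      rwa [linPoly_neg, dvd_neg]

variable {r : ℕ} (ρ : W →* Matrix (Fin r) (Fin r) ℂ)

/-- Vectors with poles controlled by `Q`. -/
def polar (p : Fin r → Rat' N) : Prop :=
  ∃ c : Fin r → Pol N, ∀ i, algebraMap _ _ D.Q * p i = algebraMap _ _ (c i)

variable {D} in
theorem polar.regV {p : Fin r → Rat' N} (h : D.polar p) {π : Pol N} (hπ : Prime π)
    (hr : ∀ a ∈ D.roots, ¬ π ∣ linPoly a) : p ∈ regV hπ r := fun i => by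
  obtain ⟨c, hc⟩ := h
  refine unscale_mem_reg hπ (D.not_dvd_Q hπ hr) ?_
  rw [hc]; exact algebraMap_mem_reg _ _

variable {D} in
theorem polar.pole {p : Fin r → Rat' N} (h : D.polar p) {α : Fin N → ℂ} (hα : α ∈ D.pos) :
    lin α ^ (2 * D.m α) • p ∈ _root_.regV (D.prime_pos hα) r := fun i => by
  obtain ⟨c, hc⟩ := h
  obtain ⟨q, hq, hQ⟩ := D.Q_eq hα
  refine unscale_mem_reg _ hq ?_
  have := hc i
  rw [hQ, map_mul, map_pow, mul_assoc] at this
  rw [Pi.smul_apply, smul_eq_mul]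
  exact this ▸ algebraMap_mem_reg _ _

variable {D} in
theorem polar.kact {p : Fin r → Rat' N} (h : D.polar p) (w : W) : D.polar (D.kact ρ w p) := by
  obtain ⟨c, hc⟩ := h
  refine ⟨tact (ρ w) (D.act w) c, fun i => ?_⟩
  simp only [RootData.kact, tact_apply, Finset.mul_sum, map_sum, mul_smul_comm]
  refine Finset.sum_congr rfl fun j _ => ?_
  rw [smul_eq_C_mul, map_mul, algebraMap_C, ← actK_algebraMap, ← hc, map_mul, actK_algebraMap,
    act_Q, Algebra.smul_def]

variable {D} in
theorem polar.add {p q : Fin r → Rat' N} (h : D.polar p) (h' : D.polar q) : D.polar (p + q) := by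
  obtain ⟨c, hc⟩ := h
  obtain ⟨c', hc'⟩ := h'
  exact ⟨c + c', fun i => by rw [Pi.add_apply, mul_add, hc, hc', Pi.add_apply, map_add]⟩

variable {D} in
theorem polar.smul {p : Fin r → Rat' N} (h : D.polar p) (a : ℂ) : D.polar (a • p) := by
  obtain ⟨c, hc⟩ := h
  refine ⟨a • c, fun i => ?_⟩
  rw [Pi.smul_apply, mul_smul_comm, hc, Pi.smul_apply, smul_eq_C_mul, map_mul, algebraMap_C,
    Algebra.smul_def]

theorem polar_zero : D.polar (0 : Fin r → Rat' N) := ⟨0, fun i => by simp⟩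

/-- Vectors lying in all local lattices. -/
def lat (p : Fin r → Rat' N) : Prop :=
  (∀ α (hα : α ∈ D.pos), p ∈ D.lattice ρ hα) ∧
    ∀ π (hπ : Prime π), (∀ a ∈ D.roots, ¬ π ∣ linPoly a) → p ∈ regV hπ r

theorem lat_nabla {p : Fin r → Rat' N} (h : D.lat ρ p) (y : Fin N → ℂ) :
    D.lat ρ (D.nabla ρ y p) :=
  ⟨fun α hα => D.nabla_mem_lattice ρ hα y (h.1 α hα),
    fun π hπ hr => D.nabla_mem_regV ρ hπ hr y (h.2 π hπ hr)⟩

theorem lat_polar {p : Fin r → Rat' N} (h : D.lat ρ p) : D.polar p := by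
  have : ∀ i, ∃ c : Pol N, algebraMap _ _ c = algebraMap _ _ D.Q * p i := fun i => by
    refine D.exists_pol_of_reg
      (fun π hπ hr => mul_mem (algebraMap_mem_reg _ _) (h.2 π hπ hr i)) fun α hα => ?_
    obtain ⟨q, -, hQ⟩ := D.Q_eq hα
    rw [hQ, map_mul, map_pow, mul_assoc]
    exact mul_mem (algebraMap_mem_reg _ _) (D.lattice_pole ρ hα (h.1 α hα) i)
  choose c hc using this
  exact ⟨c, fun i => (hc i).symm⟩

theorem lat_const (c : Fin r → ℂ) : D.lat ρ (fun i => algebraMap ℂ (Rat' N) (c i)) :=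
  ⟨fun _ hα => D.regV_le_lattice ρ hα fun _ => const_mem_reg _ _,
    fun _ _ _ _ => const_mem_reg _ _⟩

end RootData

theorem eulerK_const {n : ℕ} (c : ℂ) : eulerK (algebraMap ℂ (Rat' n) c) = 0 :=
  Derivation.map_algebraMap _ c

theorem eulerK_lin {n : ℕ} (a : Fin n → ℂ) : eulerK (lin a) = lin a := by
  rw [lin, eulerK_algebraMap, euler_of_isHomogeneous (isHomogeneous_linPoly a)]
  simp

theorem lin_eq_sum {n : ℕ} (a : Fin n → ℂ) :
    lin a = ∑ i, algebraMap (Pol n) (Rat' n) (X i) * algebraMap ℂ (Rat' n) (a i) := by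
  rw [lin, linPoly, map_sum]
  exact Finset.sum_congr rfl fun i _ => by rw [map_mul, algebraMap_C, mul_comm]

theorem homV_dirV {n r : ℕ} {d : ℤ} {p : Fin r → Rat' n} (h : HomV d p) (y : Fin n → ℂ) :
    HomV (d - 1) (dirV y p) := fun i => by
  rw [dirV_apply, eulerK_dirK, h i, Derivation.leibniz, Derivation.map_intCast]
  push_cast
  simp only [smul_eq_mul, mul_zero, add_zero]
  ring

theorem homV_matrix {n r k : ℕ} {d : ℤ} {p : Fin r → Rat' n} (h : HomV d p) (e : ℤ)
    (A : Matrix (Fin k) (Fin r) (Rat' n)) (hA : ∀ i j, eulerK (A i j) = (e : Rat' n) * A i j) :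
    HomV (e + d) (A.mulVec p) := fun i => by
  simp only [Matrix.mulVec, dotProduct, map_sum, Finset.mul_sum, Derivation.leibniz, hA, h _,
    smul_eq_mul]
  refine Finset.sum_congr rfl fun j _ => ?_
  push_cast
  ring

theorem HomV.add {n r : ℕ} {d : ℤ} {p q : Fin r → Rat' n} (h : HomV d p) (h' : HomV d q) :
    HomV d (p + q) := fun i => by rw [Pi.add_apply, map_add, h, h', mul_add]

namespace RootData

variable {N : ℕ} {W : Type} [Group W] (D : RootData N W)
variable {r : ℕ} (ρ : W →* Matrix (Fin r) (Fin r) ℂ)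

theorem eulerK_coef {a : Fin N → ℂ} (ha : a ∈ D.roots) (y : Fin N → ℂ) :
    eulerK (D.coef a y) = -D.coef a y := by
  have h0 := lin_ne_zero (D.root_ne_zero ha)
  have h1 : D.coef a y * lin a = algebraMap ℂ _ (D.m a * (a ⬝ᵥ y) / 2) := div_mul_cancel₀ _ h0
  have h2 := congrArg eulerK h1
  rw [eulerK_const, Derivation.leibniz, eulerK_lin, smul_eq_mul, smul_eq_mul,
    mul_comm _ (eulerK _), ← add_mul] at h2
  exact (neg_eq_of_add_eq_zero_right ((mul_eq_zero.1 h2).resolve_right h0)).symm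

theorem homV_conn {d : ℤ} {p : Fin r → Rat' N} (h : HomV d p) (y : Fin N → ℂ) :
    HomV (d - 1) ((D.conn ρ y).mulVec p) := by
  rw [conn_mulVec]
  intro i
  have h1 : ∀ a, HomV d ((repK ρ (D.s a)).mulVec p) := fun a => by
    have := homV_matrix h 0 (repK ρ (D.s a)) fun i j => by
      rw [repK_apply, Matrix.map_apply, eulerK_const]; simp
    rwa [zero_add] at this
  rw [Finset.sum_apply, map_sum, Finset.mul_sum]
  refine Finset.sum_congr rfl fun a ha => ?_
  rw [Pi.smul_apply, smul_eq_mul, Derivation.leibniz, D.eulerK_coef ha, Pi.sub_apply, map_sub, h,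
    h1 a]
  simp only [smul_eq_mul]
  push_cast
  ring

theorem homV_nabla {d : ℤ} {p : Fin r → Rat' N} (h : HomV d p) (y : Fin N → ℂ) :
    HomV (d - 1) (D.nabla ρ y p) := (homV_dirV h y).add (D.homV_conn ρ h y)

theorem sum_X_coef {a : Fin N → ℂ} (ha : a ∈ D.roots) :
    ∑ i, algebraMap (Pol N) (Rat' N) (X i) * D.coef a (Pi.single i 1) =
      algebraMap ℂ (Rat' N) (D.m a / 2) := by
  have h0 := lin_ne_zero (D.root_ne_zero ha)
  simp only [coef, dotProduct_single_one]
  rw [← mul_div_cancel_right₀ (algebraMap ℂ (Rat' N) (D.m a / 2)) h0, lin_eq_sum, Finset.mul_sum,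
    Finset.sum_div]
  refine Finset.sum_congr rfl fun i _ => ?_
  rw [← lin_eq_sum, mul_div_assoc', mul_comm (algebraMap (Pol N) (Rat' N) (X i)), ← mul_assoc,
    mul_right_comm, ← map_mul]
  congr 3
  ring

end RootData

namespace DunklKernel

variable {N : ℕ} {W : Type} [Group W] {D : RootData N W} {r : ℕ} (Φ : DunklKernel D r)

theorem euler_matrix : ∑ a ∈ D.roots, (D.m a / 2 : ℂ) • (1 - Φ.ρ (D.s a)) = (Φ.d : ℂ) • 1 := by
  classical
  have key : ∀ j, (Φ.d : ℂ) • Φ.φ j =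
      ∑ a ∈ D.roots, (D.m a / 2 : ℂ) • (Φ.φ j - D.vact (D.s a) (Φ.φ j)) := fun j => by
    ext1 i
    refine FaithfulSMul.algebraMap_injective (Pol N) (Rat' N) ?_
    rw [Pi.smul_apply, ← euler_of_isHomogeneous (Φ.hom j i), ← eulerK_algebraMap, eulerK_apply]
    simp only [Φ.flat, Finset.mul_sum, Finset.sum_apply, map_sum, Pi.smul_apply]
    rw [Finset.sum_comm]
    refine Finset.sum_congr rfl fun a ha => ?_
    simp only [← mul_assoc]
    rw [← Finset.sum_mul, D.sum_X_coef ha, smul_eq_C_mul, map_mul, algebraMap_C]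
  ext i j
  have h := key j
  have h1 : ∀ a, Φ.φ j - D.vact (D.s a) (Φ.φ j) =
      ∑ i, (1 - Φ.ρ (D.s a)) i j • Φ.φ i := fun a => by
    rw [Φ.equiv]
    simp [Matrix.sub_apply, sub_smul, Finset.sum_sub_distrib, Matrix.one_apply, ite_smul]
  have h2 : ∑ i, ((∑ a ∈ D.roots, (D.m a / 2 : ℂ) • (1 - Φ.ρ (D.s a))) i j -
      ((Φ.d : ℂ) • (1 : Matrix (Fin r) (Fin r) ℂ)) i j) • Φ.φ i = 0 := by
    simp only [sub_smul, Finset.sum_sub_distrib]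
    rw [sub_eq_zero]
    have h3 : ∑ i, ((Φ.d : ℂ) • (1 : Matrix (Fin r) (Fin r) ℂ)) i j • Φ.φ i =
        (Φ.d : ℂ) • Φ.φ j := by
      simp [Matrix.one_apply, ite_smul, mul_ite]
    rw [h3, h]
    simp only [h1, Matrix.sum_apply, Finset.sum_smul, Finset.smul_sum, Matrix.smul_apply,
      smul_eq_mul, mul_smul]
    exact Finset.sum_comm
  exact sub_eq_zero.1 (Fintype.linearIndependent_iff.1 Φ.ind _ h2 i)

theorem nabla_euler {d : ℤ} {p : Fin r → Rat' N} (h : HomV d p) :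
    ∑ i, algebraMap (Pol N) (Rat' N) (X i) • D.nabla Φ.ρ (Pi.single i 1) p =
      ((d + Φ.d : ℤ) : Rat' N) • p := by
  have h1 : ∑ i, algebraMap (Pol N) (Rat' N) (X i) • dirV (Pi.single i 1) p =
      (d : Rat' N) • p := by
    ext k
    rw [Finset.sum_apply, Pi.smul_apply, smul_eq_mul, ← h k, eulerK_apply]
    rfl
  have h2 : ∑ i, algebraMap (Pol N) (Rat' N) (X i) •
      (D.conn Φ.ρ (Pi.single i 1)).mulVec p = (Φ.d : Rat' N) • p := by
    have h3 : ∑ i, algebraMap (Pol N) (Rat' N) (X i) • (D.conn Φ.ρ (Pi.single i 1)).mulVec p =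
        ∑ a ∈ D.roots, algebraMap ℂ (Rat' N) (D.m a / 2) •
          (p - (RootData.repK Φ.ρ (D.s a)).mulVec p) := by
      simp only [RootData.conn_mulVec, Finset.smul_sum, smul_smul]
      rw [Finset.sum_comm]
      exact Finset.sum_congr rfl fun a ha => by rw [← Finset.sum_smul, D.sum_X_coef ha]
    have h4 := congrArg (fun A : Matrix (Fin r) (Fin r) ℂ =>
      (A.map (algebraMap ℂ (Rat' N))).mulVec p) Φ.euler_matrix
    rw [h3]
    have h5 : ∀ A : Matrix (Fin r) (Fin r) ℂ, A.map (algebraMap ℂ (Rat' N)) =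
      (algebraMap ℂ (Rat' N)).mapMatrix A := fun _ => rfl
    have h6 : ∀ (c : ℂ) (A : Matrix (Fin r) (Fin r) ℂ), (algebraMap ℂ (Rat' N)).mapMatrix (c • A) =
        algebraMap ℂ (Rat' N) c • (algebraMap ℂ (Rat' N)).mapMatrix A := fun c A => by
      ext i j; simp
    simp only [h5, map_sum, h6, map_sub, map_one, Matrix.sum_mulVec, Matrix.smul_mulVec,
      Matrix.sub_mulVec, Matrix.one_mulVec, map_natCast] at h4
    exact h4
  simp only [RootData.nabla_apply, smul_add, Finset.sum_add_distrib, h1, h2]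
  push_cast
  rw [add_smul]

theorem homV_M {d : ℤ} {p : Fin r → Rat' N} (h : HomV d p) : HomV (Φ.d + d) (Φ.M p) :=
  homV_matrix h _ _ fun i j => by
    rw [Matrix.of_apply, eulerK_algebraMap, euler_of_isHomogeneous (Φ.hom j i), smul_eq_C_mul,
      map_mul, algebraMap_C]
    simp

theorem eq_zero_of_degree_lt {d : ℤ} {p : Fin r → Rat' N} (h : HomV d p) (hl : D.lat Φ.ρ p)
    (hd : d < -Φ.d) : p = 0 := by
  obtain ⟨n, hn⟩ : ∃ n : ℕ, d + (∑ a ∈ D.roots, D.m a : ℕ) < n :=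
    ⟨(d + (∑ a ∈ D.roots, D.m a : ℕ) + 1).toNat, by omega⟩
  induction n generalizing d p with
  | zero =>
    obtain ⟨c, hc⟩ := D.lat_polar Φ.ρ hl
    ext i
    have h0 : algebraMap (Pol N) (Rat' N) D.Q ≠ 0 := algebraMap_ne_zero D.Q_ne_zero
    have h1 : eulerK (algebraMap _ (Rat' N) (c i)) =
        (((∑ a ∈ D.roots, D.m a : ℕ) + d : ℤ) : Rat' N) * algebraMap _ _ (c i) := by
      rw [← hc, Derivation.leibniz, h i, eulerK_algebraMap, D.euler_Q, smul_eq_C_mul, map_mul,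
        algebraMap_C, map_natCast, smul_eq_mul, smul_eq_mul]
      push_cast
      ring
    have h2 : c i = 0 := by
      ext s
      by_contra hs
      have := degree_of_euler (homV_algebraMap h1) hs
      omega
    have h3 := hc i
    rw [h2, map_zero] at h3
    exact (mul_eq_zero.1 h3).resolve_left h0
  | succ n ih =>
    have h1 : ∀ y, D.nabla Φ.ρ y p = 0 := fun y =>
      ih (D.homV_nabla Φ.ρ h y) (D.lat_nabla Φ.ρ hl y) (by omega) (by push_cast at hn ⊢; omega)
    have h2 := Φ.nabla_euler h
    simp only [h1, smul_zero, Finset.sum_const_zero] at h2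
    have h3 : ((d + Φ.d : ℤ) : Rat' N) ≠ 0 := by
      rw [Int.cast_ne_zero]; omega
    exact ((smul_eq_zero.1 h2.symm).resolve_left h3)

/-- There is a nonzero flat vector mapping to a constant vector field. -/
theorem exists_flat : ∃ (p : Fin r → Rat' N) (c : Fin N → ℂ), c ≠ 0 ∧ D.polar p ∧
    (∀ y, D.nabla Φ.ρ y p = 0) ∧ ∀ i, Φ.M p i = algebraMap ℂ _ (c i) := by
  have key : ∀ k ≤ Φ.d, ∃ (p : Fin r → Rat' N) (f : Fin N → Pol N), f ≠ 0 ∧ D.lat Φ.ρ p ∧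
      HomV (-k) p ∧ ∀ i, Φ.M p i = algebraMap _ _ (f i) := by
    intro k hk
    induction k with
    | zero =>
      refine ⟨_, Φ.φ ⟨0, Φ.pos⟩, Φ.ind.ne_zero _, D.lat_const Φ.ρ (Pi.single ⟨0, Φ.pos⟩ 1),
        fun i => by rw [eulerK_const]; simp, fun i => ?_⟩
      rw [M_apply, Finset.sum_eq_single ⟨0, Φ.pos⟩]
      · simp
      · intro b _ hb; simp [hb]
      · simp
    | succ k ih =>
      obtain ⟨p, f, hf, hl, hp, hM⟩ := ih (by omega)
      have hd : ∀ y i, Φ.M (D.nabla Φ.ρ y p) i = algebraMap _ _ (dir y (f i)) := fun y i => by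
        rw [← dirV_M, dirV_apply, hM, dirK_algebraMap]
      have : ∃ y, (fun i => dir y (f i)) ≠ 0 := by
        by_contra! h0
        refine hf ?_
        ext1 i
        have h1 := Φ.homV_M hp i
        rw [hM] at h1
        have h2 := homV_algebraMap h1
        have h3 : euler (f i) = 0 := by
          rw [euler_apply]
          refine Finset.sum_eq_zero fun j _ => ?_
          rw [← dir_single, show dir (Pi.single j 1) (f i) = 0 from congrFun (h0 _) i, mul_zero]
        rw [h3] at h2
        refine (smul_eq_zero.1 h2.symm).resolve_left ?_
        rw [← ne_eq, Int.cast_ne_zero]; omega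
      obtain ⟨y, hy⟩ := this
      refine ⟨_, _, hy, D.lat_nabla Φ.ρ hl y, ?_, hd y⟩
      have := D.homV_nabla Φ.ρ hp y
      convert this using 1
      push_cast; ring
  obtain ⟨p, f, hf, hl, hp, hM⟩ := key Φ.d le_rfl
  have hc : ∀ i, f i = C (constantCoeff (f i)) := fun i => by
    have h1 := Φ.homV_M hp i
    rw [hM] at h1
    ext s
    by_cases hs : s = 0
    · rw [hs]; simp [constantCoeff_eq]
    · rw [coeff_C, if_neg (Ne.symm hs)]
      by_contra h
      have := degree_of_euler (homV_algebraMap h1) h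
      rw [add_neg_cancel] at this
      exact hs ((Finsupp.degree_eq_zero_iff s).1 (by exact_mod_cast this))
  refine ⟨p, fun i => constantCoeff (f i), fun h => hf ?_, D.lat_polar Φ.ρ hl, fun y => ?_,
    fun i => ?_⟩
  · ext1 i
    rw [hc, show constantCoeff (f i) = 0 from congrFun h i, map_zero]; rfl
  · exact Φ.eq_zero_of_degree_lt (D.homV_nabla Φ.ρ hp y) (D.lat_nabla Φ.ρ hl y) (by omega)
  · rw [hM, hc i, algebraMap_C]

end DunklKernel

namespace DunklKernel

variable {N : ℕ} {W : Type} [Group W] {D : RootData N W} {r : ℕ} (Φ : DunklKernel D r)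

/-- `p` is a flat section over the constant vector field `c`. -/
structure IsFlat (c : Fin N → ℂ) (p : Fin r → Rat' N) : Prop where
  polar : D.polar p
  flat : ∀ y, D.nabla Φ.ρ y p = 0
  map : ∀ i, Φ.M p i = algebraMap ℂ _ (c i)

variable {Φ}

theorem IsFlat.add {c c' : Fin N → ℂ} {p p' : Fin r → Rat' N} (h : Φ.IsFlat c p)
    (h' : Φ.IsFlat c' p') : Φ.IsFlat (c + c') (p + p') :=
  ⟨h.polar.add h'.polar, fun y => by rw [map_add, h.flat, h'.flat, add_zero],
    fun i => by rw [map_add, Pi.add_apply, h.map, h'.map, Pi.add_apply, map_add]⟩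

theorem isFlat_zero : Φ.IsFlat 0 0 :=
  ⟨D.polar_zero, fun y => map_zero _, fun i => by simp⟩

theorem IsFlat.smul {c : Fin N → ℂ} {p : Fin r → Rat' N} (h : Φ.IsFlat c p) (a : ℂ) :
    Φ.IsFlat (a • c) (a • p) :=
  ⟨h.polar.smul a, fun y => by rw [map_smul, h.flat, smul_zero], fun i => by
    rw [LinearMap.map_smul_of_tower, Pi.smul_apply, h.map, Algebra.smul_def, Pi.smul_apply,
      smul_eq_mul, map_mul]⟩

theorem IsFlat.sum {ι : Type*} (s : Finset ι) {c : ι → Fin N → ℂ} {p : ι → Fin r → Rat' N}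
    (h : ∀ i ∈ s, Φ.IsFlat (c i) (p i)) : Φ.IsFlat (∑ i ∈ s, c i) (∑ i ∈ s, p i) := by
  classical
  induction s using Finset.induction_on with
  | empty => exact isFlat_zero
  | insert a s ha ih =>
    rw [Finset.sum_insert ha, Finset.sum_insert ha]
    exact (h a (Finset.mem_insert_self a s)).add
      (ih fun i hi => h i (Finset.mem_insert_of_mem hi))

theorem IsFlat.kact {c : Fin N → ℂ} {p : Fin r → Rat' N} (h : Φ.IsFlat c p) (w : W) :
    Φ.IsFlat ((D.g w).mulVec c) (D.kact Φ.ρ w p) := by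
  refine ⟨h.polar.kact Φ.ρ w, fun y => ?_, fun i => ?_⟩
  · rw [← D.g_mulVec_inv w y, ← D.kact_nabla, h.flat, map_zero]
  · rw [← M_kact, show Φ.M p = fun i => algebraMap ℂ _ (c i) from funext h.map, tact_apply,
      Matrix.mulVec, dotProduct, map_sum]
    refine Finset.sum_congr rfl fun j _ => ?_
    rw [AlgHom.commutes, Algebra.smul_def, map_mul]

variable (Φ)

theorem exists_isFlat (c : Fin N → ℂ) : ∃ p, Φ.IsFlat c p := by
  let L : Submodule ℂ (Fin N → ℂ) :=
    { carrier := {c | ∃ p, Φ.IsFlat c p}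
      add_mem' := fun ⟨_, h⟩ ⟨_, h'⟩ => ⟨_, h.add h'⟩
      zero_mem' := ⟨_, isFlat_zero⟩
      smul_mem' := fun a _ ⟨_, h⟩ => ⟨_, h.smul a⟩ }
  have : L = ⊤ := by
    refine (D.irr L fun w v ⟨_, h⟩ => ⟨_, h.kact w⟩).resolve_left fun h => ?_
    obtain ⟨p, c, hc, hp, hf, hm⟩ := Φ.exists_flat
    have : c ∈ L := ⟨p, hp, hf, hm⟩
    rw [h] at this
    exact hc this
  have h2 : c ∈ L := by rw [this]; exact Submodule.mem_top
  exact h2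

/-- There is an equivariant linear choice of flat sections. -/
theorem exists_section [Finite W] : ∃ σ : (Fin N → ℂ) →ₗ[ℂ] (Fin r → Rat' N),
    (∀ c, Φ.IsFlat c (σ c)) ∧ ∀ w c, D.kact Φ.ρ w (σ c) = σ ((D.g w).mulVec c) := by
  have := Fintype.ofFinite W
  choose p hp using fun i => Φ.exists_isFlat (Pi.single i 1)
  let σ₀ : (Fin N → ℂ) →ₗ[ℂ] (Fin r → Rat' N) := Fintype.linearCombination ℂ p
  have h₀ : ∀ c, Φ.IsFlat c (σ₀ c) := fun c => by
    have := IsFlat.sum Finset.univ fun i _ => (hp i).smul (c i)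
    convert this using 1
    · ext j; simp [Finset.sum_apply, Pi.single_apply]
    · exact Fintype.linearCombination_apply ℂ p c
  let σ : (Fin N → ℂ) →ₗ[ℂ] (Fin r → Rat' N) :=
    (Fintype.card W : ℂ)⁻¹ • ∑ w, (D.kact Φ.ρ w).comp (σ₀.comp (D.g w⁻¹).mulVecLin)
  have hσ : ∀ c, σ c = (Fintype.card W : ℂ)⁻¹ •
      ∑ w, D.kact Φ.ρ w (σ₀ ((D.g w⁻¹).mulVec c)) := fun c => by
    simp [σ, LinearMap.sum_apply]
  refine ⟨σ, fun c => ?_, fun w c => ?_⟩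
  · rw [hσ]
    have := (IsFlat.sum Finset.univ fun w _ =>
      (h₀ ((D.g w⁻¹).mulVec c)).kact w).smul (Fintype.card W : ℂ)⁻¹
    convert this using 1
    simp only [D.g_mulVec_inv, Finset.sum_const, Finset.card_univ, ← Nat.cast_smul_eq_nsmul ℂ]
    rw [smul_smul, inv_mul_cancel₀ (Nat.cast_ne_zero.2 Fintype.card_ne_zero), one_smul]
  · rw [hσ, hσ, map_smul, map_sum]
    congr 1
    refine Fintype.sum_equiv (Equiv.mulLeft w) _ _ fun u => ?_
    rw [D.kact_kact, D.g_mulVec_g, Equiv.coe_mulLeft, mul_inv_rev, inv_mul_cancel_right]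

variable {σ : (Fin N → ℂ) →ₗ[ℂ] (Fin r → Rat' N)}

/-- The section evaluated at a polynomial vector field. -/
def sect (σ : (Fin N → ℂ) →ₗ[ℂ] (Fin r → Rat' N)) (ψ : Fin N → Pol N) : Fin r → Rat' N :=
  ∑ k, algebraMap _ (Rat' N) (ψ k) • σ (Pi.single k 1)

theorem sect_smul (f : Pol N) (ψ : Fin N → Pol N) :
    sect σ (f • ψ) = algebraMap _ (Rat' N) f • sect σ ψ := by
  simp only [sect, Pi.smul_apply, smul_eq_mul, map_mul, Finset.smul_sum, smul_smul]

theorem sect_sum {ι : Type*} (s : Finset ι) (ψ : ι → Fin N → Pol N) :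
    sect σ (∑ i ∈ s, ψ i) = ∑ i ∈ s, sect σ (ψ i) := by
  simp only [sect, Finset.sum_apply, map_sum, Finset.sum_smul]
  exact Finset.sum_comm

theorem M_sect (hσ : ∀ c, Φ.IsFlat c (σ c)) (ψ : Fin N → Pol N) (i : Fin N) :
    Φ.M (sect σ ψ) i = algebraMap _ _ (ψ i) := by
  simp only [sect, map_sum, map_smul, Finset.sum_apply, Pi.smul_apply, (hσ _).map,
    Pi.single_apply, smul_eq_mul]
  rw [Finset.sum_eq_single i]
  · simp
  · intro b _ hb; rw [if_neg (Ne.symm hb), map_zero, mul_zero]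
  · simp

theorem sect_mem_pol (hσ : ∀ c, Φ.IsFlat c (σ c))
    (he : ∀ w c, D.kact Φ.ρ w (σ c) = σ ((D.g w).mulVec c)) {ψ : Fin N → Pol N}
    (hψ : ψ ∈ D.mder fun a => 2 * D.m a) :
    ∃ c : Fin r → Pol N, ∀ i, algebraMap _ _ (c i) = sect σ ψ i := by
  have key : ∀ i, ∃ c : Pol N, algebraMap _ _ c = sect σ ψ i := fun i => by
    refine D.exists_pol_of_reg (fun π hπ hr => ?_) fun α hα => ?_
    · rw [sect, Finset.sum_apply]
      exact sum_mem fun k _ => mul_mem (algebraMap_mem_reg _ _) ((hσ _).polar.regV hπ hr i)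
    · have hα' := D.pos_roots hα
      have hsq := D.sq_ne α hα'
      obtain ⟨h, hh⟩ := hψ α hα'
      have hdec : ∀ k, σ (Pi.single k 1) = (α k / (α ⬝ᵥ α)) • σ α +
          σ (Pi.single k 1 - (α k / (α ⬝ᵥ α)) • α) := fun k => by
        rw [map_sub, map_smul, add_sub_cancel]
      have hreg : ∀ k, σ (Pi.single k 1 - (α k / (α ⬝ᵥ α)) • α) ∈ regV (D.prime_pos hα) r :=
        fun k => by
          refine D.regV_of_flat Φ.ρ hα ((hσ _).flat _) ?_ ((hσ _).polar.pole hα)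
          rw [he, D.s_orth hα']
          rw [dotProduct_sub, dotProduct_smul, dotProduct_single_one, smul_eq_mul,
            div_mul_cancel₀ _ hsq, sub_self]
      have h1 : sect σ ψ = algebraMap ℂ (Rat' N) (α ⬝ᵥ α)⁻¹ • algebraMap _ (Rat' N) h •
          (lin α ^ (2 * D.m α) • σ α) + ∑ k, algebraMap _ (Rat' N) (ψ k) •
            σ (Pi.single k 1 - (α k / (α ⬝ᵥ α)) • α) := by
        rw [sect, Finset.sum_congr rfl fun k _ => congrArg _ (hdec k)]
        simp only [smul_add, Finset.sum_add_distrib]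
        congr 1
        have h2 : algebraMap _ (Rat' N) h * lin α ^ (2 * D.m α) =
            ∑ k, algebraMap _ (Rat' N) (ψ k) * algebraMap ℂ _ (α k) := by
          rw [lin, ← map_pow, mul_comm, ← map_mul, ← hh, pair_apply, map_sum]
          exact Finset.sum_congr rfl fun k _ => by
            rw [smul_eq_C_mul, map_mul, algebraMap_C, mul_comm]
        rw [smul_smul (algebraMap _ (Rat' N) h), h2, Finset.sum_smul, Finset.smul_sum]
        refine Finset.sum_congr rfl fun k _ => ?_
        rw [div_eq_mul_inv, ← algebraMap_smul (Rat' N) (α k * (α ⬝ᵥ α)⁻¹) (σ α), smul_smul,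
          smul_smul, map_mul]
        congr 1
        ring
      rw [h1]
      refine add_mem (smul_mem_regV _ (const_mem_reg _ _)
        (smul_mem_regV _ (algebraMap_mem_reg _ _) ((hσ _).polar.pole hα))) ?_ i
      exact sum_mem fun k _ => smul_mem_regV _ (algebraMap_mem_reg _ _) (hreg k)
  choose c hc using key
  exact ⟨c, hc⟩

/-- The lowest part of a Dunkl stable submodule generates all logarithmic vector fields. -/
theorem exists_eq_sum [Finite W] {ψ : Fin N → Pol N} (hψ : ψ ∈ D.mder fun a => 2 * D.m a) :
    ∃ c : Fin r → Pol N, ψ = ∑ j, c j • Φ.φ j := by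
  obtain ⟨σ, hσ, he⟩ := Φ.exists_section
  obtain ⟨c, hc⟩ := Φ.sect_mem_pol hσ he hψ
  refine ⟨c, ?_⟩
  ext1 i
  refine FaithfulSMul.algebraMap_injective (Pol N) (Rat' N) ?_
  rw [← M_algebraMap, ← Φ.M_sect hσ, show sect σ ψ = fun j => algebraMap _ _ (c j) from
    (funext hc).symm]

/-- The lowest part of a Dunkl stable submodule is linearly independent over polynomials. -/
theorem eq_zero_of_sum_eq_zero [Finite W] {v : Fin r → Pol N} (hv : ∑ j, v j • Φ.φ j = 0) :
    v = 0 := by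
  obtain ⟨σ, hσ, he⟩ := Φ.exists_section
  choose e hee using fun j => Φ.sect_mem_pol hσ he (Φ.mem j)
  have h1 : ∀ j, Φ.φ j = ∑ i, e j i • Φ.φ i := fun j => by
    ext1 i
    refine FaithfulSMul.algebraMap_injective (Pol N) (Rat' N) ?_
    rw [← M_algebraMap, ← Φ.M_sect hσ, show sect σ (Φ.φ j) = fun i => algebraMap _ _ (e j i) from
      (funext (hee j)).symm]
  have h2 : ∀ j i, constantCoeff (e j i) = if j = i then 1 else 0 := fun j => by
    have h3 : Φ.φ j = ∑ i, constantCoeff (e j i) • Φ.φ i := by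
      ext1 k
      have h4 := congrArg (fun f => homogeneousComponent (0 + Φ.d) (f k)) (h1 j)
      simp only [Finset.sum_apply, map_sum, Pi.smul_apply, smul_eq_mul,
        homogeneousComponent_mul (Φ.hom _ k), homogeneousComponent_zero] at h4
      rw [zero_add, homogeneousComponent_of_mem (Φ.hom j k), if_pos rfl] at h4
      rw [h4]
      simp [Finset.sum_apply, smul_eq_C_mul, constantCoeff_eq]
    intro i
    have h5 := Fintype.linearIndependent_iff.1 Φ.ind
      (fun i => constantCoeff (e j i) - if j = i then 1 else 0) (by
        simp only [sub_smul, Finset.sum_sub_distrib, ite_smul, one_smul, zero_smul,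
          Finset.sum_ite_eq, Finset.mem_univ, if_true]
        rw [← h3, sub_self]) i
    exact sub_eq_zero.1 h5
  let E : Matrix (Fin r) (Fin r) (Pol N) := Matrix.of fun i j => e j i
  have hdet : E.det ≠ 0 := fun h => by
    have h6 := congrArg constantCoeff h
    rw [RingHom.map_det, map_zero, show constantCoeff.mapMatrix E =
      (1 : Matrix (Fin r) (Fin r) ℂ) from ?_, Matrix.det_one] at h6
    · exact one_ne_zero h6
    · ext i j
      rw [RingHom.mapMatrix_apply, Matrix.map_apply, show E i j = e j i from rfl, h2,
        Matrix.one_apply]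
      simp only [eq_comm]
  refine Matrix.eq_zero_of_mulVec_eq_zero hdet ?_
  ext1 i
  refine FaithfulSMul.algebraMap_injective (Pol N) (Rat' N) ?_
  have h7 : sect σ (∑ j, v j • Φ.φ j) i = 0 := by rw [hv]; simp [sect]
  rw [sect_sum, Finset.sum_apply] at h7
  simp only [sect_smul, Pi.smul_apply, ← hee, smul_eq_mul] at h7
  rw [Pi.zero_apply, map_zero, ← h7, Matrix.mulVec, dotProduct, map_sum]
  exact Finset.sum_congr rfl fun j _ => by rw [map_mul, show E i j = e j i from rfl, mul_comm]

end DunklKernel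

section vcomp

variable {n l : ℕ}

/-- The homogeneous component of a vector of polynomials. -/
def vcomp (k : ℕ) : (Fin l → Pol n) →ₗ[ℂ] (Fin l → Pol n) :=
  (homogeneousComponent k).compLeft (Fin l)

theorem vcomp_apply (k : ℕ) (φ : Fin l → Pol n) (i : Fin l) :
    vcomp k φ i = homogeneousComponent k (φ i) := rfl

theorem homogeneousComponent_algHom {p k : ℕ} (σ : Pol n →ₐ[ℂ] Pol p)
    (hσ : ∀ d f, f.IsHomogeneous d → (σ f).IsHomogeneous d) (f : Pol n) :
    homogeneousComponent k (σ f) = σ (homogeneousComponent k f) := by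
  conv_lhs => rw [← sum_homogeneousComponent f, map_sum, map_sum]
  have : ∀ i ∈ Finset.range (f.totalDegree + 1),
      homogeneousComponent k (σ (homogeneousComponent i f)) =
        if i = k then σ (homogeneousComponent k f) else 0 := fun i _ => by
    rw [homogeneousComponent_of_mem (hσ i _ (homogeneousComponent_isHomogeneous i f))]
    by_cases h : i = k
    · simp [h]
    · rw [if_neg (Ne.symm h), if_neg h]
  rw [Finset.sum_congr rfl this, Finset.sum_ite_eq']
  split_ifs with h
  · rfl
  · rw [homogeneousComponent_eq_zero, map_zero]
    simpa using h

theorem dvd_homogeneousComponent {g f : Pol n} {d : ℕ} (hg : g.IsHomogeneous d) (h : g ∣ f)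
    (k : ℕ) : g ∣ homogeneousComponent k f := by
  obtain ⟨q, rfl⟩ := h
  rw [mul_comm, ← sum_homogeneousComponent q, Finset.sum_mul, map_sum]
  refine Finset.dvd_sum fun i _ => ?_
  rw [homogeneousComponent_of_mem ((homogeneousComponent_isHomogeneous i q).mul hg)]
  split_ifs
  · exact Dvd.intro_left _ rfl
  · exact dvd_zero _

theorem pair_vcomp (a : Fin l → ℂ) (k : ℕ) (φ : Fin l → Pol n) :
    pair a (vcomp k φ) = homogeneousComponent k (pair a φ) := by
  simp [pair_apply, vcomp_apply]

theorem vcomp_vcomp (k : ℕ) (φ : Fin l → Pol n) : vcomp k (vcomp k φ) = vcomp k φ := by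
  ext1 i
  exact homogeneousComponent_of_mem (homogeneousComponent_isHomogeneous k _) |>.trans (if_pos rfl)

theorem exists_vcomp_ne_zero {φ : Fin l → Pol n} (h : φ ≠ 0) : ∃ k, vcomp k φ ≠ 0 := by
  by_contra! h0
  refine h (funext fun i => ?_)
  rw [← sum_homogeneousComponent (φ i)]
  exact Finset.sum_eq_zero fun k _ => congrFun (h0 k) i

theorem homogeneousComponent_pderiv {f : Pol n} {d : ℕ} (hf : f.IsHomogeneous d) (j : Fin n)
    {k : ℕ} (hk : d ≤ k) : homogeneousComponent k (pderiv j f) = 0 := by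
  rcases Nat.eq_zero_or_pos d with rfl | hd
  · rw [← homogeneousComponent_of_mem hf |>.trans (if_pos rfl), homogeneousComponent_zero,
      pderiv_C, map_zero]
  · rw [homogeneousComponent_of_mem hf.pderiv, if_neg (by omega)]

end vcomp

namespace RootData

variable {N : ℕ} {W : Type} [Group W] (D : RootData N W)

theorem vcomp_vact (w : W) (k : ℕ) (φ : Fin N → Pol N) :
    vcomp k (D.vact w φ) = D.vact w (vcomp k φ) := by
  ext1 i
  rw [vcomp_apply, vact, tact_apply, tact_apply, map_sum]
  refine Finset.sum_congr rfl fun j _ => ?_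
  rw [map_smul, homogeneousComponent_algHom _ fun d f => D.act_isHomogeneous w, vcomp_apply]

theorem vcomp_mem_mder {k : (Fin N → ℂ) → ℕ} {φ : Fin N → Pol N} (h : φ ∈ D.mder k) (d : ℕ) :
    vcomp d φ ∈ D.mder k := fun a ha => by
  rw [pair_vcomp]
  exact dvd_homogeneousComponent ((isHomogeneous_linPoly a).pow _) (h a ha) d

/-- A nonzero graded submodule stable under the group and the Dunkl operators gives rise to a
Dunkl kernel. -/
theorem exists_dunklKernel (X : Submodule (Pol N) (Fin N → Pol N)) (hX : X ≠ ⊥)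
    (hm : X ≤ D.mder fun a => 2 * D.m a) (hv : ∀ w, ∀ φ ∈ X, D.vact w φ ∈ X)
    (hc : ∀ k, ∀ φ ∈ X, vcomp k φ ∈ X)
    (hd : ∀ φ ∈ X, ∀ y : Fin N → ℂ, ∃ τ : (Fin N → ℂ) → Fin N → Pol N,
      (∀ a ∈ D.pos, (D.m a : ℂ) • (φ - D.vact (D.s a) φ) = linPoly a • τ a) ∧
      (fun i => dir y (φ i)) - ∑ a ∈ D.pos, (a ⬝ᵥ y) • τ a ∈ X) :
    ∃ r, ∃ Φ : DunklKernel D r, ∀ j, Φ.φ j ∈ X := by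
  classical
  have hex : ∃ d, ∃ φ ∈ X, φ ≠ 0 ∧ vcomp d φ = φ := by
    obtain ⟨φ, hφ, h0⟩ := Submodule.exists_mem_ne_zero_of_ne_bot hX
    obtain ⟨k, hk⟩ := exists_vcomp_ne_zero h0
    exact ⟨k, _, hc k φ hφ, hk, vcomp_vcomp k φ⟩
  set d := Nat.find hex with hd'
  obtain ⟨φ₀, hφ₀, h₀, h₀'⟩ := Nat.find_spec hex
  have hmin : ∀ ξ ∈ X, (∀ k, d ≤ k → vcomp k ξ = 0) → ξ = 0 := fun ξ hξ h => by
    by_contra h0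
    obtain ⟨k, hk⟩ := exists_vcomp_ne_zero h0
    have : d ≤ k := Nat.find_min' hex ⟨_, hc k ξ hξ, hk, vcomp_vcomp k ξ⟩
    exact hk (h k this)
  let U : Submodule ℂ (Fin N → Pol N) :=
    X.restrictScalars ℂ ⊓ LinearMap.ker (vcomp d - LinearMap.id)
  have hU : ∀ φ, φ ∈ U ↔ φ ∈ X ∧ vcomp d φ = φ := fun φ => by
    simp [U, sub_eq_zero]
  have hom : ∀ φ ∈ U, ∀ i, (φ i).IsHomogeneous d := fun φ h i => by
    rw [← ((hU φ).1 h).2]; exact homogeneousComponent_isHomogeneous d _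
  have hfin : FiniteDimensional ℂ U := by
    have : FiniteDimensional ℂ (Submodule.pi Set.univ fun _ : Fin N =>
        homogeneousSubmodule (Fin N) ℂ d) :=
      Module.Finite.iff_fg.2 (Submodule.fg_pi fun _ => homogeneousSubmodule_fg _ _ d)
    have hle : U ≤ Submodule.pi Set.univ fun _ : Fin N => homogeneousSubmodule (Fin N) ℂ d :=
      fun φ h i _ => hom φ h i
    exact Submodule.finiteDimensional_of_le hle
  have hact : ∀ w, ∀ φ ∈ U, D.vact w φ ∈ U := fun w φ h => by
    rw [hU] at h ⊢
    exact ⟨hv w φ h.1, by rw [vcomp_vact, h.2]⟩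
  let b := Module.finBasis ℂ U
  let T : W →* Module.End ℂ U :=
    { toFun := fun w => (D.vact w).restrict (hact w)
      map_one' := by ext1 x; exact Subtype.ext (D.vact_one _)
      map_mul' := fun w w' => by ext1 x; exact Subtype.ext (D.vact_vact _ _ _).symm }
  refine ⟨_, ⟨d, fun j => b j, (LinearMap.toMatrixAlgEquiv b : _ →* _).comp T, ?_,
    fun j => hom _ (b j).2, ?_, fun j => hm ((hU _).1 (b j).2).1, fun w j => ?_, fun y j i => ?_⟩,
    fun j => ((hU _).1 (b j).2).1⟩
  · rw [Module.finrank_pos_iff_exists_ne_zero]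
    exact ⟨⟨φ₀, (hU _).2 ⟨hφ₀, h₀'⟩⟩, fun h => h₀ (congrArg Subtype.val h)⟩
  · exact b.linearIndependent.map' U.subtype (Submodule.ker_subtype U)
  · have := congrArg Subtype.val (b.sum_repr (T w (b j)))
    rw [AddSubmonoidClass.coe_finsetSum] at this
    exact this.symm.trans (Finset.sum_congr rfl fun i _ => by
      simp [LinearMap.toMatrixAlgEquiv_apply])
  · have hj := (hU _).1 (b j).2
    generalize (b j : Fin N → Pol N) = φ at hj
    obtain ⟨τ, hτ, hτ'⟩ := hd φ hj.1 y
    have h0 := hmin _ hτ' fun k hk => by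
      have h1 : ∀ a ∈ D.pos, vcomp k (τ a) = 0 := fun a ha => by
        ext1 i
        have h2 := congrArg (homogeneousComponent (k + 1)) (congrFun (hτ a ha) i)
        rw [Pi.smul_apply, Pi.smul_apply, smul_eq_mul, mul_comm,
          homogeneousComponent_mul (isHomogeneous_linPoly a), map_smul, ← vcomp_apply, map_sub,
          vcomp_vact] at h2
        have h3 : vcomp (k + 1) φ = 0 := by
          rw [← hj.2]
          ext1 i
          exact (homogeneousComponent_of_mem (homogeneousComponent_isHomogeneous d _)).trans
            (if_neg (by omega))
        rw [h3, map_zero, sub_zero, Pi.zero_apply, smul_zero] at h2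
        exact (mul_eq_zero.1 h2.symm).resolve_right
          (linPoly_eq_zero.not.2 (D.root_ne_zero (D.pos_roots ha)))
      rw [map_sub, map_sum, Finset.sum_congr rfl fun a ha => by rw [map_smul, h1 a ha, smul_zero],
        Finset.sum_const_zero, sub_zero]
      ext1 i
      rw [vcomp_apply, dir_apply, map_sum]
      refine Finset.sum_eq_zero fun l _ => ?_
      rw [map_smul, homogeneousComponent_pderiv _ _ hk, smul_zero]
      rw [← hj.2]; exact homogeneousComponent_isHomogeneous d _
    rw [sub_eq_zero] at h0
    rw [dirK_algebraMap, congrFun h0 i, D.sum_roots, Finset.sum_apply, map_sum, two_nsmul,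
      ← Finset.sum_add_distrib]
    · refine Finset.sum_congr rfl fun a ha => ?_
      have h2 := congrArg (algebraMap _ (Rat' N)) (congrFun (hτ a ha) i)
      rw [Pi.smul_apply, Pi.smul_apply, smul_eq_mul, map_mul, smul_eq_C_mul, map_mul,
        algebraMap_C] at h2
      rw [Pi.smul_apply, smul_eq_C_mul, map_mul, algebraMap_C, coef]
      have h3 : lin a ≠ 0 := lin_ne_zero (D.root_ne_zero (D.pos_roots ha))
      refine mul_left_cancel₀ h3 ?_
      rw [lin, mul_left_comm, ← h2, ← lin, map_div₀, map_mul, map_ofNat]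
      field_simp
      ring
    · intro a ha
      rw [D.s_neg (D.pos_roots ha), coef, coef, lin_neg, D.m_neg (D.pos_roots ha), neg_dotProduct,
        mul_neg, neg_div, map_neg]
      exact congrArg (· * _) (neg_div_neg_eq _ _)

end RootData

section

variable {n l : ℕ}

theorem homogeneousComponent_mul' {d : ℕ} {g : Pol n} (hg : g.IsHomogeneous d) (f : Pol n)
    (k : ℕ) : homogeneousComponent k (f * g) =
      (if d ≤ k then homogeneousComponent (k - d) f else 0) * g := by
  split_ifs with h
  · rw [← homogeneousComponent_mul hg, Nat.sub_add_cancel h]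
  · rw [← sum_homogeneousComponent f, Finset.sum_mul, map_sum, zero_mul]
    refine Finset.sum_eq_zero fun i _ => ?_
    rw [homogeneousComponent_of_mem ((homogeneousComponent_isHomogeneous i f).mul hg),
      if_neg (by omega)]

theorem vcomp_smul {d : ℕ} {g : Pol n} (hg : g.IsHomogeneous d) (φ : Fin l → Pol n) (k : ℕ) :
    vcomp k (g • φ) = g • (if d ≤ k then vcomp (k - d) φ else 0) := by
  ext1 i
  rw [vcomp_apply, Pi.smul_apply, smul_eq_mul, mul_comm, homogeneousComponent_mul' hg, mul_comm]
  split_ifs <;> rfl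

theorem vcomp_smul' {d : ℕ} {φ : Fin l → Pol n} (hφ : ∀ i, (φ i).IsHomogeneous d) (f : Pol n)
    (k : ℕ) : vcomp k (f • φ) = (if d ≤ k then homogeneousComponent (k - d) f else 0) • φ := by
  ext1 i
  exact homogeneousComponent_mul' (hφ i) f k

theorem exists_vcomp_eq_zero (φ : Fin l → Pol n) : ∃ d, ∀ k, d ≤ k → vcomp k φ = 0 := by
  refine ⟨(Finset.univ.sup fun i => (φ i).totalDegree) + 1, fun k hk => funext fun i => ?_⟩
  refine homogeneousComponent_eq_zero _ _ (lt_of_lt_of_le (Nat.lt_succ_of_le ?_) hk)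
  exact Finset.le_sup (f := fun i => (φ i).totalDegree) (Finset.mem_univ i)

end

namespace RootData

variable {N : ℕ} {W : Type} [Group W] (D : RootData N W)

/-- Invariance modulo a stable subspace can be tested on simple reflections. -/
theorem sub_mem_of_simple {M : Type*} [AddCommGroup M] [Module ℂ M] (T : W → M →ₗ[ℂ] M)
    (h1 : ∀ x, T 1 x = x) (hT : ∀ w w' x, T w (T w' x) = T (w * w') x) (Q : Submodule ℂ M)
    (hQ : ∀ w, ∀ x ∈ Q, T w x ∈ Q) {x : M} (hx : ∀ a ∈ D.simple, x - T (D.s a) x ∈ Q) (w : W) :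
    x - T w x ∈ Q := by
  have hw : w ∈ Subgroup.closure (D.s '' (D.simple : Set (Fin N → ℂ))) := by
    rw [D.gen]; exact Subgroup.mem_top w
  induction hw using Subgroup.closure_induction with
  | mem w h => obtain ⟨a, ha, rfl⟩ := h; exact hx a ha
  | one => rw [h1, sub_self]; exact Q.zero_mem
  | mul u v _ _ hu hv =>
    have := Q.add_mem hu (hQ u _ hv)
    rwa [map_sub, hT, sub_add_sub_cancel] at this
  | inv u _ hu =>
    have := Q.neg_mem (hQ u⁻¹ _ hu)
    rwa [map_sub, hT, inv_mul_cancel, h1, neg_sub] at this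

theorem mem_of_sub_mem [Fintype W] {M : Type*} [AddCommGroup M] [Module ℂ M]
    (T : W → M →ₗ[ℂ] M) (Q : Submodule ℂ M) {x : M} (hx : ∀ w, x - T w x ∈ Q)
    (hs : ∑ w, T w x ∈ Q) : x ∈ Q := by
  have h := Q.add_mem (Q.sum_mem (t := Finset.univ) fun w _ => hx w) hs
  rw [← Finset.sum_add_distrib] at h
  simp only [sub_add_cancel, Finset.sum_const, Finset.card_univ] at h
  rw [← Nat.cast_smul_eq_nsmul ℂ] at h
  exact (Q.smul_mem_iff (Nat.cast_ne_zero.2 Fintype.card_ne_zero)).1 h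

theorem act_sum_act [Fintype W] (w : W) (f : Pol N) :
    D.act w (∑ u, D.act u f) = ∑ u, D.act u f := by
  rw [map_sum]
  exact Fintype.sum_equiv (Equiv.mulLeft w) _ _ fun u => D.act_act w u f

theorem vact_sum_vact [Fintype W] (w : W) (φ : Fin N → Pol N) :
    D.vact w (∑ u, D.vact u φ) = ∑ u, D.vact u φ := by
  rw [map_sum]
  exact Fintype.sum_equiv (Equiv.mulLeft w) _ _ fun u => D.vact_vact w u φ

theorem act_homogeneousComponent (w : W) (f : Pol N) (k : ℕ) :
    D.act w (homogeneousComponent k f) = homogeneousComponent k (D.act w f) :=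
  (homogeneousComponent_algHom _ (fun _ _ => D.act_isHomogeneous w) f).symm

/-- The polynomials invariant under the group. -/
def invS : Subalgebra ℂ (Pol N) where
  carrier := {f | ∀ w, D.act w f = f}
  mul_mem' h h' w := by rw [map_mul, h, h']
  add_mem' h h' w := by rw [map_add, h, h']
  algebraMap_mem' c w := AlgHom.commutes _ c

theorem homogeneousComponent_mem_invS {f : Pol N} (h : f ∈ D.invS) (k : ℕ) :
    homogeneousComponent k f ∈ D.invS := fun w => by rw [act_homogeneousComponent, h]

theorem sum_act_mem_invS [Fintype W] (f : Pol N) : ∑ w, D.act w f ∈ D.invS :=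
  fun w => D.act_sum_act w f

/-- The homogeneous invariants of positive degree. -/
def posInv : Set (Pol N) := {r | r ∈ D.invS ∧ ∃ e, 0 < e ∧ r.IsHomogeneous e}

/-- The Hilbert ideal. -/
def hilb : Ideal (Pol N) := Ideal.span D.posInv

/-- The invariant logarithmic vector fields. -/
def invV : Submodule ℂ (Fin N → Pol N) where
  carrier := {φ | φ ∈ D.mder (fun a => 2 * D.m a) ∧ ∀ w, D.vact w φ = φ}
  add_mem' h h' := ⟨add_mem h.1 h'.1, fun w => by rw [map_add, h.2, h'.2]⟩
  zero_mem' := ⟨zero_mem _, fun w => map_zero _⟩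
  smul_mem' c φ h := ⟨by
    rw [← algebraMap_smul (Pol N) c φ]; exact Submodule.smul_mem _ _ h.1,
    fun w => by rw [map_smul, h.2]⟩

/-- The decomposable invariant logarithmic vector fields. -/
def decV : Submodule ℂ (Fin N → Pol N) :=
  Submodule.span ℂ {φ | ∃ r ∈ D.posInv, ∃ y ∈ D.invV, φ = r • y}

variable {D}

theorem smul_mem_invV {r : Pol N} (hr : r ∈ D.invS) {y : Fin N → Pol N} (hy : y ∈ D.invV) :
    r • y ∈ D.invV :=
  ⟨Submodule.smul_mem _ _ hy.1, fun w => by rw [vact_smul, hr, hy.2]⟩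

theorem vcomp_mem_invV {y : Fin N → Pol N} (hy : y ∈ D.invV) (k : ℕ) : vcomp k y ∈ D.invV :=
  ⟨D.vcomp_mem_mder hy.1 k, fun w => by rw [← vcomp_vact, hy.2]⟩

theorem vact_mem {φ : Fin N → Pol N} (w : W) (h : φ ∈ D.mder (fun a => 2 * D.m a)) :
    D.vact w φ ∈ D.mder (fun a => 2 * D.m a) :=
  D.vact_mem_mder (fun w a ha => by rw [D.m_inv w a ha]) w h

theorem sum_vact_mem_invV [Fintype W] {φ : Fin N → Pol N}
    (h : φ ∈ D.mder (fun a => 2 * D.m a)) : ∑ w, D.vact w φ ∈ D.invV :=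
  ⟨sum_mem fun w _ => vact_mem w h, fun w => D.vact_sum_vact w φ⟩

theorem eq_sum_posInv {r : Pol N} (hr : r ∈ D.invS) (h0 : constantCoeff r = 0) :
    r = ∑ i ∈ Finset.range r.totalDegree, homogeneousComponent (i + 1) r ∧
      ∀ i, homogeneousComponent (i + 1) r ∈ D.posInv := by
  refine ⟨?_, fun i => ⟨D.homogeneousComponent_mem_invS hr _, i + 1, i.succ_pos,
    homogeneousComponent_isHomogeneous _ _⟩⟩
  conv_lhs => rw [← sum_homogeneousComponent r, Finset.sum_range_succ', homogeneousComponent_zero,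
    ← constantCoeff_eq, h0, C_0, add_zero]

theorem mem_hilb {r : Pol N} (hr : r ∈ D.invS) (h0 : constantCoeff r = 0) : r ∈ D.hilb := by
  rw [(eq_sum_posInv hr h0).1]
  exact sum_mem fun i _ => Ideal.subset_span ((eq_sum_posInv hr h0).2 i)

theorem smul_mem_decV {r : Pol N} (hr : r ∈ D.invS) (h0 : constantCoeff r = 0)
    {y : Fin N → Pol N} (hy : y ∈ D.invV) : r • y ∈ D.decV := by
  rw [(eq_sum_posInv hr h0).1, Finset.sum_smul]
  exact sum_mem fun i _ => Submodule.subset_span ⟨_, (eq_sum_posInv hr h0).2 i, y, hy, rfl⟩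

theorem act_mem_hilb (w : W) {f : Pol N} (h : f ∈ D.hilb) : D.act w f ∈ D.hilb := by
  induction h using Submodule.span_induction with
  | mem r hr => rw [hr.1]; exact Ideal.subset_span hr
  | zero => rw [map_zero]; exact zero_mem _
  | add f g _ _ hf hg => rw [map_add]; exact add_mem hf hg
  | smul a f _ hf => rw [smul_eq_mul, map_mul]; exact Ideal.mul_mem_left _ _ hf

theorem sum_vact_smul_mem_decV [Fintype W] {f : Pol N} (hf : f ∈ D.hilb) :
    ∀ {φ : Fin N → Pol N}, φ ∈ D.mder (fun a => 2 * D.m a) →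
      ∑ w, D.vact w (f • φ) ∈ D.decV := by
  induction hf using Submodule.span_induction with
  | mem r hr =>
    intro φ h
    simp only [vact_smul, hr.1 _, ← Finset.smul_sum]
    exact Submodule.subset_span ⟨r, hr, _, sum_vact_mem_invV h, rfl⟩
  | zero => intro φ _; simp
  | add f g _ _ hf hg =>
    intro φ h
    simp only [add_smul, map_add, Finset.sum_add_distrib]
    exact add_mem (hf h) (hg h)
  | smul a f _ hf =>
    intro φ h
    rw [smul_eq_mul, mul_comm, mul_smul]
    exact hf (Submodule.smul_mem _ _ h)

/-- A quotient of the difference by a reflection. -/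
theorem exists_divided_difference {a : Fin N → ℂ} (ha : a ∈ D.roots) (f : Pol N) :
    ∃ f', f - D.act (D.s a) f = linPoly a * f' ∧
      ∀ n, (∀ k, n + 1 ≤ k → homogeneousComponent k f = 0) →
        ∀ k, n ≤ k → homogeneousComponent k f' = 0 := by
  obtain ⟨f', hf'⟩ := D.dvd_sub_act ha f
  refine ⟨f', hf', fun n hn k hk => ?_⟩
  have h := congrArg (homogeneousComponent (k + 1)) hf'
  rw [mul_comm, homogeneousComponent_mul (isHomogeneous_linPoly a), map_sub,
    ← act_homogeneousComponent, hn _ (by omega), map_zero, sub_zero] at h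
  exact (mul_eq_zero.1 h.symm).resolve_right (linPoly_eq_zero.not.2 (D.root_ne_zero ha))

/-- Chevalley's lemma on relations with invariant coefficients. -/
theorem mem_hilb_of_relation [Fintype W] {ι : Type*} [DecidableEq ι] {T : Finset ι} {i₀ : ι}
    (hi₀ : i₀ ∈ T) {e : ι → ℕ} {u : ι → Pol N} (hu : ∀ i, u i ∈ D.invS)
    (he : ∀ i, (u i).IsHomogeneous (e i))
    (hne : ¬∃ r : ι → Pol N, (∀ i, r i ∈ D.invS) ∧ u i₀ = ∑ i ∈ T.erase i₀, r i * u i) (n : ℕ) :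
    ∀ c : ι → Pol N, (∀ k, n ≤ k → homogeneousComponent k (c i₀) = 0) →
      ∑ i ∈ T, c i * u i = 0 → c i₀ ∈ D.hilb := by
  induction n with
  | zero =>
    intro c hc _
    rw [← sum_homogeneousComponent (c i₀)]
    exact sum_mem fun k _ => by rw [hc k k.zero_le]; exact zero_mem _
  | succ n ih =>
    intro c hc hrel
    have h1 : ∀ a ∈ D.simple, c i₀ - D.act (D.s a) (c i₀) ∈ D.hilb := fun a ha => by
      have ha' := D.pos_roots (D.simple_pos ha)
      choose f' hf' hdeg using fun i => exists_divided_difference ha' (c i)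
      rw [hf']
      refine Ideal.mul_mem_left _ _ (ih f' (hdeg i₀ n hc) ?_)
      have h2 : linPoly a * ∑ i ∈ T, f' i * u i = 0 := by
        have h3 : D.act (D.s a) (∑ i ∈ T, c i * u i) = ∑ i ∈ T, D.act (D.s a) (c i) * u i := by
          rw [map_sum]
          exact Finset.sum_congr rfl fun i _ => by rw [map_mul, hu]
        rw [Finset.mul_sum]
        calc _ = ∑ i ∈ T, (c i * u i - D.act (D.s a) (c i) * u i) :=
              Finset.sum_congr rfl fun i _ => by rw [← mul_assoc, ← hf', sub_mul]
          _ = 0 := by rw [Finset.sum_sub_distrib, ← h3, hrel, map_zero, sub_zero]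
      exact (mul_eq_zero.1 h2).resolve_left (linPoly_eq_zero.not.2 (D.root_ne_zero ha'))
    refine mem_of_sub_mem (fun w => (D.act w).toLinearMap) (D.hilb.restrictScalars ℂ)
      (D.sub_mem_of_simple (fun w => (D.act w).toLinearMap) D.act_one D.act_act
        (D.hilb.restrictScalars ℂ) (fun w x hx => act_mem_hilb w hx) h1) ?_
    have hA : ∑ i ∈ T, (∑ w, D.act w (c i)) * u i = 0 := by
      calc _ = ∑ w, D.act w (∑ i ∈ T, c i * u i) := by
            simp only [Finset.sum_mul, map_sum, map_mul, hu _ _]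
            exact Finset.sum_comm
        _ = 0 := by simp [hrel]
    refine mem_hilb (D.sum_act_mem_invS (c i₀)) ?_
    by_contra hk
    change ¬constantCoeff (∑ w, D.act w (c i₀)) = 0 at hk
    refine hne ⟨fun i => -C (constantCoeff (∑ w, D.act w (c i₀)))⁻¹ *
      (if e i ≤ e i₀ then homogeneousComponent (e i₀ - e i) (∑ w, D.act w (c i)) else 0),
      fun i => ?_, ?_⟩
    · refine mul_mem (neg_mem (D.invS.algebraMap_mem _)) ?_
      split_ifs
      · exact D.homogeneousComponent_mem_invS (D.sum_act_mem_invS _) _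
      · exact zero_mem _
    · have h4 := congrArg (homogeneousComponent (e i₀)) hA
      rw [map_sum, map_zero, ← Finset.add_sum_erase _ _ hi₀, homogeneousComponent_mul' (he i₀),
        if_pos le_rfl, Nat.sub_self, homogeneousComponent_zero, ← constantCoeff_eq] at h4
      simp only [homogeneousComponent_mul' (he _)] at h4
      simp only [mul_assoc, ← Finset.mul_sum]
      rw [← sub_eq_zero, neg_mul, sub_neg_eq_add]
      refine Eq.trans ?_ (congrArg (C (constantCoeff (∑ w, D.act w (c i₀)))⁻¹ * ·) h4 |>.trans
        (mul_zero _))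
      rw [mul_add, ← mul_assoc, ← C_mul, inv_mul_cancel₀ hk, C_1, one_mul]

end RootData

namespace DunklKernel

variable {N : ℕ} {W : Type} [Group W] {D : RootData N W} {r : ℕ}

/-- Invariant fields independent modulo decomposable ones have no homogeneous invariant
relations. -/
theorem eq_zero_of_invS_relation (Φ : DunklKernel D r) [Fintype W] {ι : Type*}
    [DecidableEq ι] (e : ι → ℕ) (k : ℕ) :
    ∀ (T : Finset ι), T.card = k → ∀ (u : ι → Pol N) (y : ι → Fin N → Pol N),
      (∀ i, u i ∈ D.invS) → (∀ i, (u i).IsHomogeneous (e i)) → (∀ i, y i ∈ D.invV) →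
      (∀ c : ι → ℂ, ∑ i ∈ T, c i • y i ∈ D.decV → ∀ i ∈ T, c i = 0) →
      ∑ i ∈ T, u i • y i = 0 → ∀ i ∈ T, u i = 0 := by
  induction k with
  | zero => intro T hT; simp [Finset.card_eq_zero.1 hT]
  | succ k ih =>
    intro T hT u y hu he hy hind hrel
    obtain ⟨i₀, hi₀⟩ : T.Nonempty := Finset.card_pos.1 (by omega)
    by_cases hex : ∃ r : ι → Pol N, (∀ i, r i ∈ D.invS) ∧ u i₀ = ∑ i ∈ T.erase i₀, r i * u i
    · obtain ⟨r, hr, hri⟩ := hex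
      have h := ih (T.erase i₀) (by rw [Finset.card_erase_of_mem hi₀, hT]; rfl) u
        (fun i => y i + r i • y i₀) hu he
        (fun i => add_mem (hy i) (RootData.smul_mem_invV (hr i) (hy i₀))) ?_ ?_
      · intro i hi
        by_cases hi' : i = i₀
        · rw [hi', hri]
          exact Finset.sum_eq_zero fun j hj => by rw [h j hj, mul_zero]
        · exact h i (Finset.mem_erase.2 ⟨hi', hi⟩)
      · intro c hc i hi
        have h2 := hind (Function.update c i₀ (∑ i ∈ T.erase i₀, c i * constantCoeff (r i))) ?_ i
          (Finset.mem_of_mem_erase hi)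
        · rwa [Function.update_of_ne (Finset.ne_of_mem_erase hi)] at h2
        · have hs : ∀ v, ∑ j ∈ T.erase i₀, Function.update c i₀ v j • y j =
              ∑ j ∈ T.erase i₀, c j • y j := fun v => Finset.sum_congr rfl fun j hj => by
            rw [Function.update_of_ne (Finset.ne_of_mem_erase hj)]
          rw [← Finset.add_sum_erase _ _ hi₀, Function.update_self, hs, Finset.sum_smul,
            ← Finset.sum_add_distrib]
          rw [← Submodule.sub_mem_iff_left _ hc, ← Finset.sum_sub_distrib]
          refine sum_mem fun j _ => ?_
          have h3 := D.decV.smul_mem (-c j) (RootData.smul_mem_decV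
            (sub_mem (hr j) (D.invS.algebraMap_mem (constantCoeff (r j))))
            (by rw [map_sub, algebraMap_eq, constantCoeff_C, sub_self]) (hy i₀))
          convert h3 using 1
          rw [sub_smul, algebraMap_smul, smul_sub, mul_smul, smul_add, neg_smul, neg_smul]
          abel
      · rw [← Finset.add_sum_erase _ _ hi₀, hri, Finset.sum_smul, ← Finset.sum_add_distrib] at hrel
        rw [← hrel]
        refine Finset.sum_congr rfl fun i _ => ?_
        rw [smul_add, smul_smul, mul_comm (u i), add_comm]
    · exfalso
      choose c hc using fun i => Φ.exists_eq_sum (hy i).1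
      have h1 : (fun j => ∑ i ∈ T, c i j * u i) = 0 := Φ.eq_zero_of_sum_eq_zero (by
        rw [← hrel]
        simp only [Finset.sum_smul]
        rw [Finset.sum_comm]
        refine Finset.sum_congr rfl fun i _ => ?_
        conv_rhs => rw [hc i, Finset.smul_sum]
        exact Finset.sum_congr rfl fun j _ => by rw [smul_smul, mul_comm])
      have h2 : ∀ j, c i₀ j ∈ D.hilb := fun j => by
        refine RootData.mem_hilb_of_relation hi₀ hu he hex ((c i₀ j).totalDegree + 1)
          (fun i => c i j) (fun k hk => homogeneousComponent_eq_zero _ _ (by omega))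
          (congrFun h1 j)
      have h3 : ∑ w, D.vact w (y i₀) ∈ D.decV := by
        rw [hc i₀]
        simp only [map_sum]
        rw [Finset.sum_comm]
        exact sum_mem fun j _ => RootData.sum_vact_smul_mem_decV (h2 j) (Φ.mem j)
      simp only [(hy i₀).2 _, Finset.sum_const, Finset.card_univ] at h3
      rw [← Nat.cast_smul_eq_nsmul ℂ,
        Submodule.smul_mem_iff _ (Nat.cast_ne_zero.2 Fintype.card_ne_zero)] at h3
      have h4 := hind (Pi.single i₀ 1) (by
        rw [Finset.sum_eq_single_of_mem i₀ hi₀ fun j _ hj => by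
          rw [Pi.single_eq_of_ne hj, zero_smul], Pi.single_eq_same, one_smul]
        exact h3) i₀ hi₀
      rw [Pi.single_eq_same] at h4
      exact one_ne_zero h4

/-- Homogeneous invariant fields independent modulo decomposable ones are independent. -/
theorem eq_zero_of_relation (Φ : DunklKernel D r) [Fintype W] {q : ℕ}
    {θ : Fin q → Fin N → Pol N} {e : Fin q → ℕ}
    (he : ∀ k i, (θ k i).IsHomogeneous (e k)) (hθ : ∀ k, θ k ∈ D.invV)
    (hind : ∀ c : Fin q → ℂ, ∑ k, c k • θ k ∈ D.decV → ∀ k, c k = 0) (n : ℕ) :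
    ∀ f : Fin q → Pol N, (∀ k, n ≤ k → ∀ i, homogeneousComponent k (f i) = 0) →
      ∑ k, f k • θ k = 0 → ∀ k, f k = 0 := by
  induction n with
  | zero =>
    intro f hf _ k
    rw [← sum_homogeneousComponent (f k)]
    exact Finset.sum_eq_zero fun j _ => hf j j.zero_le k
  | succ n ih =>
    intro f hf hrel k
    have hinv : ∀ i, f i ∈ D.invS := fun i => by
      have h1 : ∀ a ∈ D.simple, f i - D.act (D.s a) (f i) ∈ (⊥ : Submodule ℂ (Pol N)) :=
        fun a ha => by
          have ha' := D.pos_roots (D.simple_pos ha)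
          choose f' hf' hdeg using fun i => RootData.exists_divided_difference ha' (f i)
          rw [Submodule.mem_bot, hf',
            ih f' (fun k hk i => hdeg i n (fun k hk => hf k hk i) k hk) ?_, mul_zero]
          have h2 : linPoly a • ∑ i, f' i • θ i = 0 := by
            have h3 : D.vact (D.s a) (∑ i, f i • θ i) = ∑ i, D.act (D.s a) (f i) • θ i := by
              rw [map_sum]
              exact Finset.sum_congr rfl fun i _ => by rw [D.vact_smul, (hθ i).2]
            rw [Finset.smul_sum]
            calc _ = ∑ i, (f i • θ i - D.act (D.s a) (f i) • θ i) :=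
                  Finset.sum_congr rfl fun i _ => by rw [smul_smul, ← hf', sub_smul]
              _ = 0 := by rw [Finset.sum_sub_distrib, ← h3, hrel, map_zero, sub_zero]
          exact (smul_eq_zero.1 h2).resolve_left (linPoly_eq_zero.not.2 (D.root_ne_zero ha'))
      intro w
      have h := D.sub_mem_of_simple (fun w => (D.act w).toLinearMap) D.act_one D.act_act ⊥
        (fun w x hx => by rw [(Submodule.mem_bot ℂ).1 hx, map_zero]; exact zero_mem _) h1 w
      exact (sub_eq_zero.1 ((Submodule.mem_bot ℂ).1 h)).symm
    rw [← sum_homogeneousComponent (f k)]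
    refine Finset.sum_eq_zero fun j _ => ?_
    have h4 := eq_zero_of_invS_relation Φ (fun i => j + e k - e i) _ Finset.univ rfl
      (fun i => if e i ≤ j + e k then homogeneousComponent (j + e k - e i) (f i) else 0) θ
      (fun i => ?_) (fun i => ?_) hθ (fun c hc i _ => hind c hc i) ?_ k (Finset.mem_univ k)
    · rwa [if_pos (Nat.le_add_left _ _), Nat.add_sub_cancel] at h4
    · split_ifs
      · exact D.homogeneousComponent_mem_invS (hinv i) _
      · exact zero_mem _
    · split_ifs
      · exact homogeneousComponent_isHomogeneous _ _
      · exact isHomogeneous_zero _ _ _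
    · have h5 := congrArg (vcomp (j + e k)) hrel
      rw [map_sum, map_zero] at h5
      rw [← h5]
      exact Finset.sum_congr rfl fun i _ => (vcomp_smul' (he i) _ _).symm

end DunklKernel

theorem exists_sum_vcomp {n l : ℕ} (φ : Fin l → Pol n) :
    ∃ d, φ = ∑ k ∈ Finset.range d, vcomp k φ := by
  obtain ⟨d, hd⟩ := exists_vcomp_eq_zero φ
  refine ⟨d, funext fun i => ?_⟩
  rw [Finset.sum_apply]
  conv_lhs => rw [← sum_homogeneousComponent (φ i)]
  rcases le_total d ((φ i).totalDegree + 1) with h | h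
  · symm
    refine Finset.sum_subset (Finset.range_mono h) fun k _ hk => congrFun (hd k ?_) i
    simpa using hk
  · refine Finset.sum_subset (Finset.range_mono h) fun k _ hk =>
      homogeneousComponent_eq_zero _ _ ?_
    simpa using hk

namespace RootData

variable {N : ℕ} {W : Type} [Group W] {D : RootData N W}

theorem linPoly_pow_dvd_of_mul {a b : Fin N → ℂ} (ha : a ∈ D.roots) (hb : b ∈ D.roots)
    (h1 : b ≠ a) (h2 : b ≠ -a) {k : ℕ} {f : Pol N} (h : linPoly b ^ k ∣ linPoly a * f) :
    linPoly b ^ k ∣ f := by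
  refine (prime_linPoly (D.root_ne_zero hb)).pow_dvd_of_dvd_mul_left k (fun h' => ?_) h
  rcases D.eq_or_neg hb ha h' with h | h
  · exact h1 h.symm
  · exact h2 (by rw [h, neg_neg])

/-- Odd multiarrangements are stable under divided differences. -/
theorem exists_divided_difference_mder {a : Fin N → ℂ} (ha : a ∈ D.roots) {φ : Fin N → Pol N}
    (hφ : φ ∈ D.mder fun a => 2 * D.m a + 1) :
    ∃ τ ∈ D.mder (fun a => 2 * D.m a + 1), φ - D.vact (D.s a) φ = linPoly a • τ := by
  obtain ⟨τ, hτ⟩ := D.dvd_sub_vact ha ((dvd_pow_self _ (Nat.succ_ne_zero _)).trans (hφ a ha))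
  have hne : linPoly a ≠ 0 := linPoly_eq_zero.not.2 (D.root_ne_zero ha)
  have hself : linPoly a ^ (2 * D.m a + 1) ∣ pair a τ := by
    obtain ⟨h, hh⟩ := hφ a ha
    obtain ⟨h', hh'⟩ := D.dvd_sub_act ha h
    refine ⟨h', mul_left_cancel₀ hne ?_⟩
    have h1 : pair a (D.vact (D.s a) φ) = linPoly a ^ (2 * D.m a + 1) * D.act (D.s a) h := by
      have h2 := D.pair_vact (D.s a) a φ
      rw [D.s_self ha, pair_neg_left, hh, map_mul, map_pow, D.act_s_linPoly ha,
        (odd_two_mul_add_one _).neg_pow, neg_mul, neg_inj] at h2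
      exact h2
    rw [← smul_eq_mul, ← map_smul, ← hτ, map_sub, hh, h1, ← mul_sub, hh']
    ring
  refine ⟨τ, fun b hb => ?_, hτ⟩
  by_cases h1 : b = a
  · rw [h1]; exact hself
  by_cases h2 : b = -a
  · rw [h2]
    change linPoly (-a) ^ (2 * D.m (-a) + 1) ∣ _
    rw [D.m_neg ha, linPoly_neg, (odd_two_mul_add_one _).neg_pow, pair_neg_left]
    exact neg_dvd.2 (dvd_neg.2 hself)
  · refine linPoly_pow_dvd_of_mul ha hb h1 h2 ?_
    rw [← smul_eq_mul, ← map_smul, ← hτ, map_sub]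
    exact dvd_sub (hφ b hb) (D.vact_mem_mder (fun w a ha => by rw [D.m_inv w a ha]) _ hφ b hb)

/-- Odd multiarrangements are generated by invariant fields. -/
theorem mem_span_invV [Finite W] (n : ℕ) : ∀ φ ∈ D.mder (fun a => 2 * D.m a + 1),
    (∀ k, n ≤ k → vcomp k φ = 0) → φ ∈ Submodule.span (Pol N) (D.invV : Set (Fin N → Pol N)) := by
  have := Fintype.ofFinite W
  induction n with
  | zero =>
    intro φ _ h0
    obtain ⟨d, hd⟩ := exists_sum_vcomp φ
    rw [hd]
    exact sum_mem fun k _ => by rw [h0 k k.zero_le]; exact zero_mem _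
  | succ n ih =>
    intro φ hφ h0
    let Q := (Submodule.span (Pol N) (D.invV : Set (Fin N → Pol N))).restrictScalars ℂ
    have hQ : ∀ w, ∀ x ∈ Q, D.vact w x ∈ Q := fun w x hx => by
      change x ∈ Submodule.span _ _ at hx
      induction hx using Submodule.span_induction with
      | mem x hx => rw [hx.2]; exact Submodule.subset_span hx
      | zero => rw [map_zero]; exact zero_mem _
      | add x y _ _ hx hy => rw [map_add]; exact add_mem hx hy
      | smul f x _ hx => rw [vact_smul]; exact Submodule.smul_mem (Submodule.span (Pol N) _) _ hx
    have h1 : ∀ a ∈ D.simple, φ - D.vact (D.s a) φ ∈ Q := fun a ha => by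
      have ha' := D.pos_roots (D.simple_pos ha)
      obtain ⟨τ, hτ, h⟩ := exists_divided_difference_mder ha' hφ
      rw [h]
      refine Submodule.smul_mem (Submodule.span _ _) _ (ih τ hτ fun k hk => ?_)
      have h2 := congrArg (vcomp (k + 1)) h
      rw [vcomp_smul (isHomogeneous_linPoly a), if_pos (by omega), map_sub, vcomp_vact,
        h0 _ (by omega), map_zero, sub_zero] at h2
      exact (smul_eq_zero.1 h2.symm).resolve_left (linPoly_eq_zero.not.2 (D.root_ne_zero ha'))
    have h2 : φ ∈ Q := mem_of_sub_mem D.vact Q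
      (D.sub_mem_of_simple D.vact D.vact_one D.vact_vact Q hQ h1)
      (Submodule.subset_span (sum_vact_mem_invV fun a ha =>
        (pow_dvd_pow _ (Nat.le_succ _)).trans (hφ a ha)))
    exact h2

end RootData

namespace DunklKernel

variable {N : ℕ} {W : Type} [Group W] {D : RootData N W} {r : ℕ}

/-- The logarithmic vector fields of the odd multiarrangement have a basis of homogeneous
invariant fields. -/
theorem exists_basis [Finite W] (Φ : DunklKernel D r) :
    ∃ (e : Fin N → ℕ) (θ : Fin N → Fin N → Pol N), (∀ k i, (θ k i).IsHomogeneous (e k)) ∧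
      (∀ k, θ k ∈ D.invV) ∧ (∀ f : Fin N → Pol N, ∑ k, f k • θ k = 0 → f = 0) ∧
      ∀ φ ∈ D.mder (fun a => 2 * D.m a + 1), ∃ f : Fin N → Pol N, φ = ∑ k, f k • θ k := by
  have := Fintype.ofFinite W
  let P : ℕ → Prop := fun q => ∃ (e : Fin q → ℕ) (θ : Fin q → Fin N → Pol N),
    (∀ k i, (θ k i).IsHomogeneous (e k)) ∧ (∀ k, θ k ∈ D.invV) ∧
    ∀ c : Fin q → ℂ, ∑ k, c k • θ k ∈ D.decV → ∀ k, c k = 0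
  have hind : ∀ {q} {e : Fin q → ℕ} {θ : Fin q → Fin N → Pol N},
      (∀ k i, (θ k i).IsHomogeneous (e k)) → (∀ k, θ k ∈ D.invV) →
      (∀ c : Fin q → ℂ, ∑ k, c k • θ k ∈ D.decV → ∀ k, c k = 0) →
      ∀ f : Fin q → Pol N, ∑ k, f k • θ k = 0 → f = 0 := fun he hθ hc f hf => by
    obtain ⟨d, hd⟩ := exists_vcomp_eq_zero f
    exact funext (eq_zero_of_relation Φ he hθ hc d f (fun k hk => congrFun (hd k hk)) hf)
  have hP : ∃ q, P q ∧ ¬P (q + 1) := by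
    by_contra! h
    have h1 : P (N + 1) := by
      induction N + 1 with
      | zero =>
        exact ⟨Fin.elim0, Fin.elim0, fun k => k.elim0, fun k => k.elim0, fun _ _ k => k.elim0⟩
      | succ q ih => exact h q ih
    obtain ⟨e, θ, he, hθ, hc⟩ := h1
    have h2 : LinearIndependent (Pol N) θ := Fintype.linearIndependent_iff.2 fun f hf =>
      congrFun (hind he hθ hc f hf)
    have := h2.fintype_card_le_finrank
    simp at this
  obtain ⟨q, ⟨e, θ, he, hθ, hc⟩, hq⟩ := hP
  have hspan : ∀ n, ∀ y ∈ D.invV, vcomp n y = y → y ∈ Submodule.span (Pol N) (Set.range θ) := by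
    intro n
    induction n using Nat.strong_induction_on with
    | _ n ih =>
    intro y hy hyn
    by_contra hns
    refine hq ⟨Fin.snoc e n, Fin.snoc θ y, ?_, ?_, fun c hc' => ?_⟩
    · intro k
      refine Fin.lastCases ?_ (fun k => ?_) k
      · intro i
        rw [Fin.snoc_last, Fin.snoc_last, ← hyn]
        exact homogeneousComponent_isHomogeneous _ _
      · simpa using he k
    · intro k
      refine Fin.lastCases ?_ (fun k => ?_) k
      · simpa using hy
      · simpa using hθ k
    · rw [Fin.sum_univ_castSucc] at hc'
      simp only [Fin.snoc_castSucc, Fin.snoc_last] at hc'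
      have hlast : c (Fin.last q) = 0 := by
        by_contra h0
        have hdec : ∀ v ∈ D.decV, vcomp n v ∈ Submodule.span (Pol N) (Set.range θ) :=
          fun v hv => by
          rw [RootData.decV] at hv
          induction hv using Submodule.span_induction with
          | mem v hv =>
            obtain ⟨f, ⟨_, d, hd, hfd⟩, z, hz, rfl⟩ := hv
            rw [vcomp_smul hfd]
            refine Submodule.smul_mem _ _ ?_
            split_ifs with h
            · exact ih (n - d) (by omega) _ (RootData.vcomp_mem_invV hz _) (vcomp_vcomp _ _)
            · exact zero_mem _
          | zero => rw [map_zero]; exact zero_mem _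
          | add x y _ _ hx hy => rw [map_add]; exact add_mem hx hy
          | smul a x _ hx =>
            rw [map_smul, ← algebraMap_smul (Pol N) a]; exact Submodule.smul_mem _ _ hx
        have h3 := hdec _ hc'
        rw [map_add, map_smul, hyn, map_sum, Submodule.add_mem_iff_right,
          ← algebraMap_smul (Pol N) (c _)] at h3
        · have h4 := Submodule.smul_mem _ (algebraMap ℂ (Pol N) (c (Fin.last q))⁻¹) h3
          rw [smul_smul, ← map_mul, inv_mul_cancel₀ h0, map_one, one_smul] at h4
          exact hns h4
        · refine sum_mem fun k _ => ?_
          rw [map_smul, ← algebraMap_smul (Pol N) (c _)]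
          refine Submodule.smul_mem _ _ ?_
          have h5 : vcomp n (θ k) = if e k = n then θ k else 0 := by
            ext1 i
            rw [vcomp_apply, homogeneousComponent_of_mem (he k i)]
            by_cases h : e k = n
            · rw [if_pos h, if_pos h.symm]
            · rw [if_neg h, if_neg (Ne.symm h), Pi.zero_apply]
          rw [h5]
          split_ifs
          · exact Submodule.subset_span ⟨k, rfl⟩
          · exact zero_mem _
      refine Fin.lastCases hlast ?_
      rw [hlast, zero_smul, add_zero] at hc'
      exact hc _ hc'
  have hgen : ∀ φ ∈ D.mder (fun a => 2 * D.m a + 1),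
      φ ∈ Submodule.span (Pol N) (Set.range θ) := fun φ hφ => by
    obtain ⟨d, hd⟩ := exists_vcomp_eq_zero φ
    refine Submodule.span_le.2 ?_ (RootData.mem_span_invV d φ hφ hd)
    intro y hy
    obtain ⟨d, hd⟩ := exists_sum_vcomp y
    rw [hd]
    exact sum_mem fun k _ => hspan k _ (RootData.vcomp_mem_invV hy k) (vcomp_vcomp k y)
  have hqN : q = N := by
    refine le_antisymm ?_ ?_
    · have h2 : LinearIndependent (Pol N) θ := Fintype.linearIndependent_iff.2 fun f hf =>
        congrFun (hind he hθ hc f hf)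
      simpa using h2.fintype_card_le_finrank
    · let δ : Pol N := ∏ a ∈ D.roots, linPoly a ^ (2 * D.m a + 1)
      have hδ : δ ≠ 0 := Finset.prod_ne_zero_iff.2 fun a ha =>
        pow_ne_zero _ (linPoly_eq_zero.not.2 (D.root_ne_zero ha))
      have hv : LinearIndependent (Pol N) fun i : Fin N => δ • (Pi.single i 1 : Fin N → Pol N) :=
        Fintype.linearIndependent_iff.2 fun f hf i => by
          have := congrFun hf i
          simp [Finset.sum_apply, Pi.single_apply, hδ] at this
          exact this
      have := linearIndependent_le_span' _ hv (Set.range θ) (by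
        rintro _ ⟨i, rfl⟩
        refine hgen _ fun a ha => ?_
        rw [map_smul]
        exact (Finset.dvd_prod_of_mem (fun a => linPoly a ^ (2 * D.m a + 1)) ha).mul_right _)
      simpa using this.trans (Nat.cast_le.2 (Fintype.card_range_le θ))
  subst hqN
  refine ⟨e, θ, he, hθ, hind he hθ hc, fun φ hφ => ?_⟩
  obtain ⟨f, hf⟩ := (Submodule.mem_span_range_iff_exists_fun _).1 (hgen φ hφ)
  exact ⟨f, hf.symm⟩

end DunklKernel

section Affine

variable {N : ℕ}

/-- The linear form `b - c z` on the cone, where `z` is the last coordinate. -/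
def aff (b : Fin N → ℂ) (c : ℂ) : Pol (N + 1) := linPoly (Fin.snoc b (-c))

theorem snoc_smul (b : Fin N → ℂ) (c r : ℂ) :
    (Fin.snoc (r • b) (r * c) : Fin (N + 1) → ℂ) = r • Fin.snoc b c := by
  ext i
  refine Fin.lastCases ?_ (fun i => ?_) i <;> simp

theorem snoc_sub (b b' : Fin N → ℂ) (c c' : ℂ) :
    (Fin.snoc (b - b') (c - c') : Fin (N + 1) → ℂ) = Fin.snoc b c - Fin.snoc b' c' := by
  ext i
  refine Fin.lastCases ?_ (fun i => ?_) i <;> simp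

theorem snoc_dotProduct (b b' : Fin N → ℂ) (c c' : ℂ) :
    (Fin.snoc b c : Fin (N + 1) → ℂ) ⬝ᵥ Fin.snoc b' c' = b ⬝ᵥ b' + c * c' := by
  simp [dotProduct, Fin.sum_univ_castSucc]

theorem aff_neg (b : Fin N → ℂ) (c : ℂ) : aff (-b) (-c) = -aff b c := by
  rw [aff, aff, ← linPoly_neg]
  congr 1
  have := snoc_smul b (-c) (-1)
  rw [neg_one_smul, neg_one_smul, neg_one_mul] at this
  exact this

theorem aff_eq (b : Fin N → ℂ) (c : ℂ) : aff b c = aff b 0 - C c * X (Fin.last N) := by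
  simp [aff, linPoly, Fin.sum_univ_castSucc, sub_eq_add_neg]

theorem prime_aff {b : Fin N → ℂ} (hb : b ≠ 0) (c : ℂ) : Prime (aff b c) :=
  prime_linPoly fun h => hb (funext fun i => by simpa using congrFun h i.castSucc)

theorem aff_dvd {b b' : Fin N → ℂ} {c c' : ℂ} (h : aff b c ∣ aff b' c') :
    ∃ r : ℂ, b' = r • b ∧ c' = r * c := by
  obtain ⟨r, hr⟩ := linPoly_dvd_linPoly h
  refine ⟨r, funext fun i => ?_, ?_⟩
  · simpa using congrFun hr i.castSucc
  · simpa using congrFun hr (Fin.last N)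

theorem not_aff_dvd_X {b : Fin N → ℂ} (hb : b ≠ 0) (c : ℂ) : ¬aff b c ∣ X (Fin.last N) := by
  intro h
  rw [← linPoly_single] at h
  obtain ⟨r, hr⟩ := linPoly_dvd_linPoly h
  have h1 := congrFun hr (Fin.last N)
  refine hb (funext fun i => ?_)
  have h2 := congrFun hr i.castSucc
  simp [(Fin.castSucc_lt_last i).ne] at h1 h2
  refine h2.resolve_left ?_
  rintro rfl
  simp at h1

theorem isHomogeneous_aff (b : Fin N → ℂ) (c : ℂ) : (aff b c).IsHomogeneous 1 :=
  isHomogeneous_linPoly _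

/-- The affine reflection in the hyperplane `a = k z`. -/
def affRefl (a : Fin N → ℂ) (k : ℂ) : Pol (N + 1) →ₐ[ℂ] Pol (N + 1) :=
  linSub (1 - Matrix.vecMulVec (Fin.snoc a (-k)) (Fin.snoc ((2 / (a ⬝ᵥ a)) • a) 0))

theorem affRefl_linPoly (a : Fin N → ℂ) (k : ℂ) (b : Fin N → ℂ) (c : ℂ) :
    affRefl a k (linPoly (Fin.snoc b c)) =
      linPoly (Fin.snoc (b - (2 * (a ⬝ᵥ b) / (a ⬝ᵥ a)) • a) (c + 2 * (a ⬝ᵥ b) / (a ⬝ᵥ a) * k)) := by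
  rw [affRefl, linSub_linPoly, Matrix.sub_mulVec, Matrix.one_mulVec, Matrix.vecMulVec_mulVec,
    snoc_dotProduct]
  congr 1
  rw [← sub_neg_eq_add c, snoc_sub, ← mul_neg, snoc_smul]
  congr 1
  ext i
  simp
  ring

theorem affRefl_aff (a : Fin N → ℂ) (k : ℂ) (b : Fin N → ℂ) (c : ℂ) :
    affRefl a k (aff b c) =
      aff (b - (2 * (a ⬝ᵥ b) / (a ⬝ᵥ a)) • a) (c - 2 * (a ⬝ᵥ b) / (a ⬝ᵥ a) * k) := by
  rw [aff, affRefl_linPoly, aff]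
  congr 2
  ring

theorem affRefl_last (a : Fin N → ℂ) (k : ℂ) : affRefl a k (X (Fin.last N)) = X (Fin.last N) := by
  have h : (X (Fin.last N) : Pol (N + 1)) = linPoly (Fin.snoc 0 1) := by
    rw [← linPoly_single]
    congr 1
    ext i
    refine Fin.lastCases ?_ (fun i => ?_) i <;> simp [(Fin.castSucc_lt_last _).ne]
  rw [h, affRefl_linPoly]
  congr 2 <;> simp

theorem affRefl_X (a : Fin N → ℂ) (k : ℂ) (i : Fin N) :
    affRefl a k (X i.castSucc) = X i.castSucc - (2 * a i / (a ⬝ᵥ a)) • aff a k := by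
  have h : (X i.castSucc : Pol (N + 1)) = linPoly (Fin.snoc (Pi.single i 1) 0) := by
    rw [← linPoly_single]
    congr 1
    ext j
    refine Fin.lastCases ?_ (fun j => ?_) j <;> simp [Pi.single_apply, (Fin.castSucc_lt_last _).ne']
  rw [h, affRefl_linPoly, dotProduct_single, mul_one, aff, smul_eq_C_mul, ← linPoly_smul,
    ← linPoly_sub, ← snoc_smul, ← snoc_sub]
  congr 2
  ring

theorem aff_dvd_sub_affRefl (a : Fin N → ℂ) (k : ℂ) (f : Pol (N + 1)) :
    aff a k ∣ f - affRefl a k f := linPoly_dvd_sub_linSub _ _ _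

/-- Restriction to the hyperplane at infinity `z = 0`. -/
def ev0 (N : ℕ) : Pol (N + 1) →ₐ[ℂ] Pol N := aeval (Fin.snoc X 0)

/-- The restriction of the derivative in `z` to the hyperplane at infinity. -/
def ev1 (N : ℕ) : Pol (N + 1) →ₗ[ℂ] Pol N :=
  (ev0 N).toLinearMap ∘ₗ (pderiv (Fin.last N) : Derivation ℂ _ _).toLinearMap

theorem ev0_last : ev0 N (X (Fin.last N)) = 0 := by simp [ev0]

theorem ev0_X (i : Fin N) : ev0 N (X i.castSucc) = X i := by simp [ev0]

theorem ev0_linPoly (b : Fin N → ℂ) (c : ℂ) : ev0 N (linPoly (Fin.snoc b c)) = linPoly b := by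
  simp [linPoly, Fin.sum_univ_castSucc, ev0]

theorem ev0_aff (b : Fin N → ℂ) (c : ℂ) : ev0 N (aff b c) = linPoly b := ev0_linPoly _ _

theorem ev1_apply (f : Pol (N + 1)) : ev1 N f = ev0 N (pderiv (Fin.last N) f) := rfl

theorem ev1_mul (f g : Pol (N + 1)) : ev1 N (f * g) = ev1 N f * ev0 N g + ev0 N f * ev1 N g := by
  simp only [ev1_apply, Derivation.leibniz, smul_eq_mul, map_add, map_mul]; ring

theorem ev1_C (c : ℂ) : ev1 N (C c) = 0 := by rw [ev1_apply, pderiv_C, map_zero]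

theorem ev1_last : ev1 N (X (Fin.last N)) = 1 := by rw [ev1_apply, pderiv_X_self, map_one]

theorem ev1_X (i : Fin N) : ev1 N (X i.castSucc) = 0 := by
  rw [ev1_apply, pderiv_X_of_ne (Fin.castSucc_lt_last i).ne, map_zero]

theorem ev1_aff (b : Fin N → ℂ) (c : ℂ) : ev1 N (aff b c) = C (-c) := by
  simp [aff, linPoly, Fin.sum_univ_castSucc, ev1_mul, ev1_C, ev1_last, ev1_X, ev0]

theorem isHomogeneous_ev0 {d : ℕ} {f : Pol (N + 1)} (h : f.IsHomogeneous d) :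
    (ev0 N f).IsHomogeneous d := by
  have := h.aeval (Fin.snoc X 0 : Fin (N + 1) → Pol N) (n := 1) fun i => by
    refine Fin.lastCases ?_ (fun i => ?_) i
    · simpa using isHomogeneous_zero _ _ _
    · simpa using isHomogeneous_X _ _
  rwa [one_mul] at this

/-- The extension of polynomials to the cone. -/
def extend (N : ℕ) : Pol N →ₐ[ℂ] Pol (N + 1) := rename Fin.castSucc

theorem ev0_extend (f : Pol N) : ev0 N (extend N f) = f := by
  have : (ev0 N).comp (extend N) = AlgHom.id ℂ _ := algHom_ext fun i => by simp [ev0, extend]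
  exact DFunLike.congr_fun this f

theorem extend_linPoly (b : Fin N → ℂ) : extend N (linPoly b) = aff b 0 := by
  simp [extend, aff, linPoly, Fin.sum_univ_castSucc]

theorem last_dvd_sub_extend (f : Pol (N + 1)) : X (Fin.last N) ∣ f - extend N (ev0 N f) := by
  induction f using MvPolynomial.induction_on with
  | C c => simp [ev0, extend]
  | add f g hf hg =>
    rw [map_add, map_add, add_sub_add_comm]; exact dvd_add hf hg
  | mul_X f i hf =>
    rw [map_mul, map_mul]
    refine Fin.lastCases ?_ (fun i => ?_) i
    · rw [ev0_last, map_zero, mul_zero, sub_zero]; exact dvd_mul_left _ _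
    · rw [ev0_X, show extend N (X i) = X i.castSucc by simp [extend], ← sub_mul]
      exact hf.mul_right _

theorem last_dvd_iff {f : Pol (N + 1)} : X (Fin.last N) ∣ f ↔ ev0 N f = 0 := by
  constructor
  · rintro ⟨g, rfl⟩
    rw [map_mul, ev0_last, zero_mul]
  · intro h
    have := last_dvd_sub_extend f
    rwa [h, map_zero, sub_zero] at this

end Affine

/-- Restriction of vector fields to the hyperplane at infinity. -/
def vev0 (N : ℕ) : (Fin N → Pol (N + 1)) →ₗ[ℂ] (Fin N → Pol N) where
  toFun φ i := ev0 N (φ i)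
  map_add' φ ψ := by ext1 i; simp
  map_smul' c φ := by ext1 i; simp

/-- Restriction of the `z`-derivative of vector fields to the hyperplane at infinity. -/
def vev1 (N : ℕ) : (Fin N → Pol (N + 1)) →ₗ[ℂ] (Fin N → Pol N) where
  toFun φ i := ev1 N (φ i)
  map_add' φ ψ := by ext1 i; simp
  map_smul' c φ := by ext1 i; simp

/-- The coroot. -/
def coroot {N : ℕ} (a : Fin N → ℂ) : Fin N → ℂ := (2 / (a ⬝ᵥ a)) • a

section

variable {N : ℕ}

theorem vev0_apply (φ : Fin N → Pol (N + 1)) (i : Fin N) : vev0 N φ i = ev0 N (φ i) := rfl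

theorem vev0_smul (f : Pol (N + 1)) (φ : Fin N → Pol (N + 1)) :
    vev0 N (f • φ) = ev0 N f • vev0 N φ := by
  ext1 i
  simp only [vev0_apply, Pi.smul_apply, smul_eq_mul, map_mul]

theorem vev1_apply (φ : Fin N → Pol (N + 1)) (i : Fin N) : vev1 N φ i = ev1 N (φ i) := rfl

theorem vev1_smul (f : Pol (N + 1)) (φ : Fin N → Pol (N + 1)) :
    vev1 N (f • φ) = ev1 N f • vev0 N φ + ev0 N f • vev1 N φ := by
  ext1 i
  simp only [vev0_apply, vev1_apply, Pi.smul_apply, Pi.add_apply, smul_eq_mul, ev1_mul]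

theorem pair_vev0 (a : Fin N → ℂ) (φ : Fin N → Pol (N + 1)) :
    pair a (vev0 N φ) = ev0 N (pair a φ) := by
  simp [pair_apply, vev0_apply]

theorem vcomp_vev0 (k : ℕ) (φ : Fin N → Pol (N + 1)) : vcomp k (vev0 N φ) = vev0 N (vcomp k φ) :=
  _root_.funext fun i => homogeneousComponent_algHom _ (fun _ _ h => isHomogeneous_ev0 h) (φ i)

theorem vev0_eq_zero {φ : Fin N → Pol (N + 1)} (h : vev0 N φ = 0) :
    ∃ ψ, φ = (X (Fin.last N) : Pol (N + 1)) • ψ := by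
  choose ψ hψ using fun i => last_dvd_iff.2 (congrFun h i)
  exact ⟨ψ, _root_.funext hψ⟩

end

namespace RootData

variable {N : ℕ} {W : Type} [Group W] (D : RootData N W)

theorem affRefl_aff_mulVec {a : Fin N → ℂ} (ha : a ∈ D.roots) (k : ℂ) (b : Fin N → ℂ) (c : ℂ) :
    affRefl a k (aff b c) =
      aff ((D.g (D.s a)).mulVec b) (c - 2 * (a ⬝ᵥ b) / (a ⬝ᵥ a) * k) := by
  rw [affRefl_aff, D.s_mulVec ha]

theorem affRefl_aff_self {a : Fin N → ℂ} (ha : a ∈ D.roots) (k c : ℂ) :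
    affRefl a k (aff a (2 * k - c)) = -aff a c := by
  rw [D.affRefl_aff_mulVec ha, D.s_self ha, ← aff_neg, mul_div_assoc, div_self (D.sq_ne a ha)]
  congr 1
  ring

theorem affRefl_aff_self' {a : Fin N → ℂ} (ha : a ∈ D.roots) (k : ℂ) :
    affRefl a k (aff a k) = -aff a k := by
  rw [← D.affRefl_aff_self ha k k]
  congr 2
  ring

/-- The action of an affine reflection on vector fields. -/
def avact (a : Fin N → ℂ) (k : ℂ) : (Fin N → Pol (N + 1)) →ₗ[ℂ] (Fin N → Pol (N + 1)) :=
  tact (D.g (D.s a)) (affRefl a k)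

theorem pair_avact (a b : Fin N → ℂ) (k : ℂ) (φ : Fin N → Pol (N + 1)) :
    pair ((D.g (D.s a)).mulVec b) (D.avact a k φ) = affRefl a k (pair b φ) :=
  pair_mulVec_tact (D.orth _) _ _ _

theorem s_s {a : Fin N → ℂ} (ha : a ∈ D.roots) (b : Fin N → ℂ) :
    (D.g (D.s a)).mulVec ((D.g (D.s a)).mulVec b) = b := by
  rw [g_mulVec_g, D.s_sq ha, map_one, Matrix.one_mulVec]

theorem pair_avact' {a : Fin N → ℂ} (ha : a ∈ D.roots) (b : Fin N → ℂ) (k : ℂ)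
    (φ : Fin N → Pol (N + 1)) :
    pair b (D.avact a k φ) = affRefl a k (pair ((D.g (D.s a)).mulVec b) φ) := by
  rw [← D.pair_avact, D.s_s ha]

theorem dvd_sub_avact {a : Fin N → ℂ} (ha : a ∈ D.roots) {k : ℂ} {φ : Fin N → Pol (N + 1)}
    (hφ : aff a k ∣ pair a φ) : ∃ ψ, φ - D.avact a k φ = aff a k • ψ := by
  have : ∀ i, aff a k ∣ (φ - D.avact a k φ) i := fun i => by
    have h1 : D.avact a k φ i = affRefl a k (φ i) -
        (2 * a i / (a ⬝ᵥ a)) • affRefl a k (pair a φ) := by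
      rw [← pair_single i (D.avact _ _ _), D.pair_avact' ha, D.s_mulVec ha, pair_sub_left,
        pair_single, pair_smul_left, map_sub, map_smul]
      simp
    rw [Pi.sub_apply, h1, ← sub_add, smul_eq_C_mul]
    refine dvd_add (aff_dvd_sub_affRefl _ _ _) (Dvd.dvd.mul_left ?_ _)
    have := map_dvd (affRefl a k) hφ
    rwa [D.affRefl_aff_self' ha, neg_dvd] at this
  choose ψ hψ using this
  exact ⟨ψ, _root_.funext hψ⟩

theorem ev0_affRefl {a : Fin N → ℂ} (ha : a ∈ D.roots) (k : ℂ) (f : Pol (N + 1)) :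
    ev0 N (affRefl a k f) = D.act (D.s a) (ev0 N f) := by
  have : (ev0 N).comp (affRefl a k) = (D.act (D.s a)).comp (ev0 N) := algHom_ext fun i => by
    simp only [AlgHom.comp_apply]
    refine Fin.lastCases ?_ (fun i => ?_) i
    · rw [affRefl_last, ev0_last, map_zero]
    · rw [affRefl_X, map_sub, map_smul, ev0_X, ev0_aff, ← linPoly_single, act_linPoly,
        D.s_mulVec ha, linPoly_sub, linPoly_smul, smul_eq_C_mul, dotProduct_single, mul_one]
  exact DFunLike.congr_fun this f

theorem ev1_affRefl {a : Fin N → ℂ} (ha : a ∈ D.roots) (k : ℂ) (f : Pol (N + 1)) :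
    ev1 N (affRefl a k f) =
      D.act (D.s a) (ev1 N f + k • dir (coroot a) (ev0 N f)) := by
  induction f using MvPolynomial.induction_on with
  | C c =>
    have h : affRefl a k (C c) = C c := algHom_C _ c
    have h' : ev0 N (C c) = C c := algHom_C _ c
    rw [h, h', ev1_C, dir_apply]
    simp
  | add f g hf hg => simp only [map_add, hf, hg, smul_add]; ring
  | mul_X f i hf =>
    rw [map_mul, ev1_mul, ev1_mul, hf, D.ev0_affRefl ha, D.ev0_affRefl ha, map_mul,
      Derivation.leibniz]
    refine Fin.lastCases ?_ (fun i => ?_) i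
    · rw [affRefl_last, ev0_last, ev1_last]
      simp
    · rw [affRefl_X, map_sub, map_smul, ev0_X, ev1_X, ev1_aff]
      have h : dir (coroot a) (X i) = C (coroot a i) := by
        rw [← linPoly_single, dir_linPoly]; simp
      rw [h]
      simp only [map_add, map_mul, smul_eq_mul, D.act_C, coroot, Pi.smul_apply,
        smul_eq_C_mul, map_neg, map_zero, mul_zero, zero_sub]
      rw [show (2 * a i / (a ⬝ᵥ a)) = 2 / (a ⬝ᵥ a) * a i by ring, C_mul]
      ring

theorem vev0_avact {a : Fin N → ℂ} (ha : a ∈ D.roots) (k : ℂ) (φ : Fin N → Pol (N + 1)) :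
    vev0 N (D.avact a k φ) = D.vact (D.s a) (vev0 N φ) := by
  ext1 i
  simp only [vev0_apply, avact, vact, tact_apply, map_sum, map_smul, D.ev0_affRefl ha]

theorem vev1_avact {a : Fin N → ℂ} (ha : a ∈ D.roots) (k : ℂ) (φ : Fin N → Pol (N + 1)) :
    vev1 N (D.avact a k φ) =
      D.vact (D.s a) (vev1 N φ + k • fun i => dir (coroot a) (vev0 N φ i)) := by
  ext1 i
  simp only [vev0_apply, vev1_apply, avact, vact, tact_apply, map_sum, map_smul,
    D.ev1_affRefl ha, Pi.add_apply, Pi.smul_apply]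

/-- The logarithmic vector fields of the cone of the extended Shi arrangement, tangent to the
levels of `z`. -/
def shi : Submodule (Pol (N + 1)) (Fin N → Pol (N + 1)) where
  carrier := {φ | ∀ b ∈ D.pos, ∀ j : ℤ, 1 - (D.m b : ℤ) ≤ j → j ≤ D.m b → aff b j ∣ pair b φ}
  add_mem' h h' b hb j h1 h2 := by rw [map_add]; exact dvd_add (h b hb j h1 h2) (h' b hb j h1 h2)
  zero_mem' b _ j _ _ := by simp
  smul_mem' c φ h b hb j h1 h2 := by rw [map_smul]; exact (h b hb j h1 h2).mul_left _

theorem aff_dvd_neg {a : Fin N → ℂ} {c : ℂ} {φ : Fin N → Pol (N + 1)} (h : aff a c ∣ pair a φ) :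
    aff (-a) (-c) ∣ pair (-a) φ := by
  rw [aff_neg, pair_neg_left]; exact (neg_dvd.2 (dvd_neg.2 h))

/-- The divided affine reflections preserve the logarithmic vector fields of the cone of the
extended Shi arrangement. -/
theorem exists_shi_operator {a : Fin N → ℂ} {k : ℤ}
    (hk : a ∈ D.pos ∧ k = 0 ∨ -a ∈ D.pos ∧ k = -1)
    (hs : ∀ b ∈ D.pos, b ≠ a → b ≠ -a → ∀ j : ℤ, 1 - (D.m b : ℤ) ≤ j → j ≤ D.m b →
      ∀ φ ∈ D.shi, aff ((D.g (D.s a)).mulVec b) (j - 2 * (a ⬝ᵥ b) / (a ⬝ᵥ a) * k) ∣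
        pair ((D.g (D.s a)).mulVec b) φ)
    {φ : Fin N → Pol (N + 1)} (hφ : φ ∈ D.shi) :
    ∃ τ, (D.m a : ℂ) • (φ - D.avact a k φ) = aff a k • τ ∧
      D.avact a k φ + (X (Fin.last N) : Pol (N + 1)) • τ ∈ D.shi := by
  have ha : a ∈ D.roots := (D.mem_roots a).2 (hk.imp And.left And.left)
  have ha0 := D.root_ne_zero ha
  have hself : ∀ j : ℤ, k + 1 - D.m a ≤ j → j ≤ k + D.m a → aff a j ∣ pair a φ := by
    intro j h1 h2
    rcases hk with ⟨h, rfl⟩ | ⟨h, rfl⟩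
    · exact hφ a h j (by omega) (by omega)
    · have h3 := hφ (-a) h (-j) (by rw [D.m_neg ha]; omega) (by rw [D.m_neg ha]; omega)
      have h4 := aff_dvd_neg h3
      rwa [neg_neg, Int.cast_neg, neg_neg] at h4
  have hτ : ∃ τ, (D.m a : ℂ) • (φ - D.avact a k φ) = aff a k • τ := by
    rcases Nat.eq_zero_or_pos (D.m a) with h | h
    · exact ⟨0, by simp [h]⟩
    · obtain ⟨τ, hτ⟩ := D.dvd_sub_avact ha (hself k (by omega) (by omega))
      exact ⟨(D.m a : ℂ) • τ, by rw [hτ, smul_comm]⟩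
  obtain ⟨τ, hτ⟩ := hτ
  refine ⟨τ, hτ, ?_⟩
  set T := D.avact a k φ + (X (Fin.last N) : Pol (N + 1)) • τ with hT
  have hkm : aff a (k : ℂ) - C (D.m a : ℂ) * X (Fin.last N) = aff a ((k : ℂ) + D.m a) := by
    rw [aff_eq a k, aff_eq a (k + _), C_add]; ring
  have hid : aff a k • T = (C (D.m a : ℂ) * X (Fin.last N)) • φ +
      aff a ((k : ℂ) + D.m a) • D.avact a k φ := by
    rw [hT, smul_add, smul_comm (aff a (k : ℂ)) (X (Fin.last N) : Pol (N + 1)) τ, ← hτ, ← hkm]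
    ext1 i
    simp [smul_eq_C_mul]
    ring
  have hpair : ∀ b, aff a k * pair b T = (C (D.m a : ℂ) * X (Fin.last N)) * pair b φ +
      aff a ((k : ℂ) + D.m a) * affRefl a k (pair ((D.g (D.s a)).mulVec b) φ) := fun b => by
    rw [← D.pair_avact' ha, ← smul_eq_mul, ← map_smul, hid, map_add, map_smul, map_smul]; rfl
  have hTself : ∀ j : ℤ, k + 1 - D.m a ≤ j → j ≤ k + D.m a → aff a j ∣ pair a T := by
    intro j h1 h2
    by_cases hjk : j = k
    · subst hjk
      obtain ⟨p, hp⟩ := hself j h1 h2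
      have h3 : affRefl a j (pair a φ) = -(aff a j * affRefl a j p) := by
        rw [hp, map_mul, D.affRefl_aff_self' ha, neg_mul]
      have h4 : pair a (D.avact a j φ) = aff a j * affRefl a j p := by
        rw [D.pair_avact' ha, D.s_self ha, pair_neg_left, map_neg, h3, neg_neg]
      rw [hT, map_add, map_smul, h4]
      refine dvd_add (dvd_mul_right _ _) (Dvd.dvd.mul_left ?_ _)
      have h5 : C (D.m a : ℂ) * (p - affRefl a j p) = pair a τ := by
        refine mul_left_cancel₀ (prime_aff ha0 (j : ℂ)).ne_zero ?_
        rw [← smul_eq_mul (aff a (j : ℂ)) (pair a τ), ← map_smul, ← hτ,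
          ← algebraMap_smul (Pol (N + 1)), map_smul, map_sub, h4, hp, algebraMap_eq, smul_eq_mul]
        ring
      rw [← h5]
      exact (aff_dvd_sub_affRefl _ _ _).mul_left _
    · have hnd : ¬aff a (j : ℂ) ∣ aff a k := fun h => by
        obtain ⟨r, h3, h4⟩ := aff_dvd h
        have : r = 1 := by
          by_contra hr
          have h5 : (r - 1) • a = 0 := by rw [sub_smul, ← h3, one_smul, sub_self]
          exact (smul_eq_zero.1 h5).elim (fun h => hr (sub_eq_zero.1 h)) ha0
        rw [this, one_mul] at h4
        exact hjk (by exact_mod_cast h4.symm)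
      refine ((prime_aff ha0 (j : ℂ)).dvd_or_dvd ?_).resolve_left hnd
      rw [hpair]
      refine dvd_add ((hself j h1 h2).mul_left _) ?_
      by_cases hj : j = k + D.m a
      · refine Dvd.dvd.mul_right ?_ _
        rw [hj]; push_cast; exact dvd_rfl
      · refine Dvd.dvd.mul_left ?_ _
        rw [D.s_self ha, pair_neg_left, map_neg, dvd_neg]
        have h5 := map_dvd (affRefl a k) (hself (2 * k - j) (by omega) (by omega))
        push_cast at h5
        rwa [D.affRefl_aff_self ha, neg_dvd] at h5
  intro b hb j h1 h2
  by_cases hba : b = a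
  · subst hba
    rcases hk with ⟨_, rfl⟩ | ⟨h, _⟩
    · exact hTself j (by omega) (by omega)
    · exact absurd h (D.pos_disj b hb)
  by_cases hba' : b = -a
  · subst hba'
    rw [D.m_neg ha] at h1 h2
    rcases hk with ⟨h, _⟩ | ⟨_, rfl⟩
    · exact absurd hb (D.pos_disj a h)
    · have h3 := aff_dvd_neg (hTself (-j) (by omega) (by omega))
      rwa [Int.cast_neg, neg_neg] at h3
  have hb' := D.pos_roots hb
  have hnd : ¬aff b (j : ℂ) ∣ aff a k := fun h => by
    obtain ⟨r, h3, -⟩ := aff_dvd h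
    rcases D.reduced b hb' r (h3 ▸ ha) with rfl | rfl
    · exact hba (by rw [h3, one_smul])
    · exact hba' (by rw [h3, neg_one_smul, neg_neg])
  refine ((prime_aff (D.root_ne_zero hb') (j : ℂ)).dvd_or_dvd ?_).resolve_left hnd
  rw [hpair]
  refine dvd_add ((hφ b hb j h1 h2).mul_left _) (Dvd.dvd.mul_left ?_ _)
  have h5 := map_dvd (affRefl a k) (hs b hb hba hba' j h1 h2 φ hφ)
  rw [D.affRefl_aff_mulVec ha, D.s_s ha] at h5
  convert h5 using 2
  have h6 : a ⬝ᵥ (D.g (D.s a)).mulVec b = -(a ⬝ᵥ b) := by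
    rw [← D.dot_g (D.s a) a b, D.s_self ha, neg_dotProduct, neg_neg]
  rw [h6]
  ring

end RootData

namespace RootData

variable {N : ℕ} {W : Type} [Group W] (D : RootData N W)

/-- The divided difference scaled by the multiplicity. -/
def dd (a : Fin N → ℂ) (ψ : Fin N → Pol N) : Fin N → Pol N :=
  open Classical in
  if h : ∃ τ, (D.m a : ℂ) • (ψ - D.vact (D.s a) ψ) = linPoly a • τ then h.choose else 0

variable {D}

theorem dd_eq {a : Fin N → ℂ} (ha : a ∈ D.roots) {ψ τ : Fin N → Pol N}
    (h : (D.m a : ℂ) • (ψ - D.vact (D.s a) ψ) = linPoly a • τ) : D.dd a ψ = τ := by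
  have h' : ∃ τ, (D.m a : ℂ) • (ψ - D.vact (D.s a) ψ) = linPoly a • τ := ⟨τ, h⟩
  have h1 := h'.choose_spec
  rw [dd, dif_pos h']
  refine smul_right_injective _ (linPoly_eq_zero.not.2 (D.root_ne_zero ha)) ?_
  exact h1.symm.trans h

theorem dd_spec {a : Fin N → ℂ} (ha : a ∈ D.roots) {ψ : Fin N → Pol N}
    (hψ : ψ ∈ D.mder fun a => 2 * D.m a) :
    (D.m a : ℂ) • (ψ - D.vact (D.s a) ψ) = linPoly a • D.dd a ψ := by
  have h : ∃ τ, (D.m a : ℂ) • (ψ - D.vact (D.s a) ψ) = linPoly a • τ := by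
    by_cases hm : D.m a = 0
    · exact ⟨0, by simp [hm]⟩
    · obtain ⟨τ, hτ⟩ := D.dvd_sub_vact ha
        ((dvd_pow_self _ (mul_ne_zero two_ne_zero hm)).trans (hψ a ha))
      exact ⟨(D.m a : ℂ) • τ, by rw [hτ, smul_comm]⟩
  rw [dd, dif_pos h]
  exact h.choose_spec

theorem vact_dd (w : W) {a : Fin N → ℂ} (ha : a ∈ D.roots) {ψ : Fin N → Pol N}
    (hψ : ψ ∈ D.mder fun a => 2 * D.m a) :
    D.vact w (D.dd a ψ) = D.dd ((D.g w).mulVec a) (D.vact w ψ) := by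
  refine (dd_eq (D.stab w a ha) ?_).symm
  have h := congrArg (D.vact w) (dd_spec ha hψ)
  rw [map_smul, vact_smul, act_linPoly, map_sub, vact_vact] at h
  rw [D.m_inv w a ha, D.s_conj ha, vact_vact, inv_mul_cancel_right, h]

theorem dd_neg {a : Fin N → ℂ} (ha : a ∈ D.roots) {ψ : Fin N → Pol N}
    (hψ : ψ ∈ D.mder fun a => 2 * D.m a) : D.dd (-a) ψ = -D.dd a ψ := by
  refine dd_eq (D.neg_roots ha) ?_
  rw [D.m_neg ha, D.s_neg ha, linPoly_neg, smul_neg, neg_smul, neg_neg, dd_spec ha hψ]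

theorem dd_vact_s {a : Fin N → ℂ} (ha : a ∈ D.roots) {ψ : Fin N → Pol N}
    (hψ : ψ ∈ D.mder fun a => 2 * D.m a) : D.dd a (D.vact (D.s a) ψ) = -D.dd a ψ := by
  refine dd_eq ha ?_
  rw [vact_vact, D.s_sq ha, vact_one, smul_neg, ← dd_spec ha hψ, ← smul_neg, neg_sub]

theorem sum_simple_reflection {M : Type*} [AddCommGroup M] {f : (Fin N → ℂ) → M}
    (hf : ∀ b ∈ D.roots, f (-b) = -f b) {a : Fin N → ℂ} (ha : a ∈ D.simple) :
    ∑ b ∈ D.pos, f ((D.g (D.s a)).mulVec b) = ∑ b ∈ D.pos, f b - 2 • f a := by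
  classical
  have ha' := D.simple_pos ha
  have har := D.pos_roots ha'
  rw [← Finset.add_sum_erase _ _ ha', ← Finset.add_sum_erase _ f ha', D.s_self har, hf a har]
  have : ∑ b ∈ D.pos.erase a, f ((D.g (D.s a)).mulVec b) = ∑ b ∈ D.pos.erase a, f b := by
    have hmem : ∀ b ∈ D.pos.erase a, (D.g (D.s a)).mulVec b ∈ D.pos.erase a := fun b hb => by
      rw [Finset.mem_erase] at hb ⊢
      refine ⟨fun h => ?_, D.simple_perm a ha b hb.2 hb.1⟩
      have h1 := congrArg (D.g (D.s a)).mulVec h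
      rw [D.s_s har, D.s_self har] at h1
      exact D.pos_disj a ha' (h1 ▸ hb.2)
    exact Finset.sum_nbij' (fun b => (D.g (D.s a)).mulVec b) (fun b => (D.g (D.s a)).mulVec b)
      hmem hmem (fun b _ => D.s_s har b) (fun b _ => D.s_s har b) fun _ _ => rfl
  rw [this, two_nsmul]
  abel

theorem sum_top_reflection {M : Type*} [AddCommGroup M] [Module ℂ M] {f : (Fin N → ℂ) → M}
    (hf : ∀ b ∈ D.roots, f (-b) = -f b) :
    ∑ b ∈ D.pos, f b - ∑ b ∈ D.pos, f ((D.g (D.s D.top)).mulVec b) + (2 : ℂ) • f D.top =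
      (2 : ℂ) • ∑ b ∈ D.pos, (b ⬝ᵥ coroot D.top) • f b := by
  classical
  have ht := D.top_pos
  have htr := D.pos_roots ht
  have hp : ∀ b, (b ⬝ᵥ coroot D.top) • D.top = b - (D.g (D.s D.top)).mulVec b := fun b => by
    rw [D.s_mulVec htr, sub_sub_cancel, coroot, dotProduct_smul, smul_eq_mul,
      dotProduct_comm b]
    congr 1
    ring
  have hp' : ∀ b, b ≠ D.top → b ∈ D.pos →
      (D.g (D.s D.top)).mulVec b = b ∧ b ⬝ᵥ coroot D.top = 0 ∨
      (D.g (D.s D.top)).mulVec b = b - D.top ∧ D.top - b ∈ D.pos ∧ b ⬝ᵥ coroot D.top = 1 := by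
    intro b h1 h2
    rcases D.top_pair b h2 h1 with h | ⟨h, h'⟩
    · refine Or.inl ⟨h, ?_⟩
      have h3 := hp b
      rw [h, sub_self] at h3
      exact (smul_eq_zero.1 h3).resolve_right (D.root_ne_zero htr)
    · refine Or.inr ⟨h, h', ?_⟩
      have h3 := hp b
      rw [h, sub_sub_cancel, ← sub_eq_zero] at h3
      have h4 : (b ⬝ᵥ coroot D.top - 1) • D.top = 0 := by rw [sub_smul, one_smul, h3]
      exact sub_eq_zero.1 ((smul_eq_zero.1 h4).resolve_right (D.root_ne_zero htr))
  have h2 : D.top ⬝ᵥ coroot D.top = 2 := by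
    have h3 := hp D.top
    rw [D.s_self htr, sub_neg_eq_add, ← two_smul ℂ, ← sub_eq_zero, ← sub_smul] at h3
    exact sub_eq_zero.1 ((smul_eq_zero.1 h3).resolve_right (D.root_ne_zero htr))
  have key : ∑ b ∈ D.pos.erase D.top, f ((D.g (D.s D.top)).mulVec b) =
      ∑ b ∈ D.pos.erase D.top, (1 - 2 * (b ⬝ᵥ coroot D.top)) • f b := by
    let i : (Fin N → ℂ) → (Fin N → ℂ) := fun b => if (D.g (D.s D.top)).mulVec b = b then b else
      D.top - b
    have hi1 : ∀ b, (D.g (D.s D.top)).mulVec b = b → i b = b := fun b h => if_pos h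
    have hi2 : ∀ b, (D.g (D.s D.top)).mulVec b = b - D.top → i b = D.top - b := fun b h => by
      refine if_neg fun h' => D.root_ne_zero htr ?_
      rw [h'] at h
      exact (sub_eq_self.1 h.symm)
    have hi3 : ∀ b, (D.g (D.s D.top)).mulVec b = b - D.top →
        (D.g (D.s D.top)).mulVec (D.top - b) = (D.top - b) - D.top := fun b h => by
      rw [Matrix.mulVec_sub, D.s_self htr, h]; abel
    have hmem : ∀ b ∈ D.pos.erase D.top, i b ∈ D.pos.erase D.top := fun b hb => by
      rw [Finset.mem_erase] at hb
      rcases hp' b hb.1 hb.2 with ⟨h, _⟩ | ⟨h, h', _⟩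
      · rw [hi1 b h]; exact Finset.mem_erase.2 hb
      · rw [hi2 b h]
        refine Finset.mem_erase.2 ⟨fun h3 => ?_, h'⟩
        exact D.root_ne_zero (D.pos_roots hb.2) (sub_eq_self.1 h3)
    have hinv : ∀ b ∈ D.pos.erase D.top, i (i b) = b := fun b hb => by
      rw [Finset.mem_erase] at hb
      rcases hp' b hb.1 hb.2 with ⟨h, _⟩ | ⟨h, h', _⟩
      · rw [hi1 b h, hi1 b h]
      · rw [hi2 b h, hi2 _ (hi3 b h)]; abel
    refine Finset.sum_nbij' i i hmem hmem hinv hinv fun b hb => ?_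
    have hb' := Finset.mem_erase.1 (hmem b hb)
    rw [Finset.mem_erase] at hb
    rcases hp' b hb.1 hb.2 with ⟨h, h0⟩ | ⟨h, h', _⟩
    · rw [h, hi1 b h, h0]; simp
    · rw [hi2 b h] at hb' ⊢
      rcases hp' _ hb'.1 hb'.2 with ⟨h3, _⟩ | ⟨_, _, h3⟩
      · rw [hi3 b h] at h3
        exact absurd (sub_eq_self.1 h3) (D.root_ne_zero htr)
      · rw [h3, h, ← neg_sub, hf _ (D.pos_roots h')]
        norm_num
  rw [← Finset.add_sum_erase _ f ht, ← Finset.add_sum_erase _ _ ht,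
    ← Finset.add_sum_erase _ (fun b => (b ⬝ᵥ coroot D.top) • f b) ht, key, D.s_self htr,
    hf _ htr, h2]
  have : ∀ b, (1 - 2 * (b ⬝ᵥ coroot D.top)) • f b = f b - (2 : ℂ) • (b ⬝ᵥ coroot D.top) • f b :=
    fun b => by rw [sub_smul, one_smul, mul_smul]
  simp only [this, Finset.sum_sub_distrib, ← Finset.smul_sum]
  module

theorem coprime_aff {b : Fin N → ℂ} (hb : b ∈ D.roots) {i j : ℤ} (h : i ≠ j) :
    IsRelPrime (aff b i) (aff b j) := by
  have hb0 := D.root_ne_zero hb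
  refine ((prime_aff hb0 (i : ℂ)).irreducible.isRelPrime_iff_not_dvd).2 fun h' => ?_
  obtain ⟨r, h3, h4⟩ := aff_dvd h'
  have : r = 1 := by
    by_contra hr
    have h5 : (r - 1) • b = 0 := by rw [sub_smul, ← h3, one_smul, sub_self]
    exact (smul_eq_zero.1 h5).elim (fun h => hr (sub_eq_zero.1 h)) hb0
  rw [this, one_mul] at h4
  exact h (by exact_mod_cast h4.symm)

theorem pow_dvd_ev0 {b : Fin N → ℂ} (hb : b ∈ D.roots) {s t : ℤ} {f : Pol (N + 1)}
    (h : ∀ j : ℤ, s ≤ j → j ≤ t → aff b j ∣ f) : linPoly b ^ (t + 1 - s).toNat ∣ ev0 N f := by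
  have h1 : ∏ j ∈ Finset.Icc s t, aff b (j : ℂ) ∣ f :=
    Finset.prod_dvd_of_isRelPrime (fun i _ j _ hij => coprime_aff hb hij)
      fun j hj => h j (Finset.mem_Icc.1 hj).1 (Finset.mem_Icc.1 hj).2
  have h2 := map_dvd (ev0 N) h1
  rw [map_prod] at h2
  simpa only [ev0_aff, Finset.prod_const, Int.card_Icc] using h2

theorem vev0_mem_mder {φ : Fin N → Pol (N + 1)} (h : φ ∈ D.shi) :
    vev0 N φ ∈ D.mder fun a => 2 * D.m a := by
  have h1 : ∀ a ∈ D.pos, linPoly a ^ (2 * D.m a) ∣ pair a (vev0 N φ) := fun a ha => by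
    have h2 := pow_dvd_ev0 (D.pos_roots ha) (h a ha)
    rwa [← pair_vev0, show ((D.m a : ℤ) + 1 - (1 - D.m a)).toNat = 2 * D.m a by omega] at h2
  intro a ha
  rcases (D.mem_roots a).1 ha with h2 | h2
  · exact h1 a h2
  · have h3 := h1 _ h2
    rwa [D.m_neg ha, linPoly_neg, (even_two_mul _).neg_pow, pair_neg_left, dvd_neg] at h3

theorem mem_shi_of_last_smul {φ : Fin N → Pol (N + 1)}
    (h : (X (Fin.last N) : Pol (N + 1)) • φ ∈ D.shi) : φ ∈ D.shi := fun b hb j h1 h2 => by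
  have h3 := h b hb j h1 h2
  rw [map_smul] at h3
  have hb0 := D.root_ne_zero (D.pos_roots hb)
  exact ((prime_aff hb0 _).dvd_or_dvd h3).resolve_left (not_aff_dvd_X hb0 _)

variable (D) in
/-- The invariant normalisation of the first jet at infinity. -/
def jet (φ : Fin N → Pol (N + 1)) : Fin N → Pol N :=
  vev1 N φ + (1 / 2 : ℂ) • ∑ b ∈ D.pos, D.dd b (vev0 N φ)

theorem exists_simple_operator {a : Fin N → ℂ} (ha : a ∈ D.simple) {φ : Fin N → Pol (N + 1)}
    (hφ : φ ∈ D.shi) : ∃ T ∈ D.shi, vev0 N T = D.vact (D.s a) (vev0 N φ) ∧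
      D.jet T = D.vact (D.s a) (D.jet φ) := by
  have ha' := D.simple_pos ha
  have har := D.pos_roots ha'
  have hφ0 := vev0_mem_mder hφ
  have hsφ0 := vact_mem (D.s a) hφ0
  obtain ⟨τ, hτ, hT⟩ := D.exists_shi_operator (k := 0) (Or.inl ⟨ha', rfl⟩)
    (fun b hb h1 _ j h3 h4 φ hφ => by
      rw [Int.cast_zero, mul_zero, sub_zero]
      refine hφ _ (D.simple_perm a ha b hb h1) j ?_ ?_ <;> rwa [D.m_inv _ _ (D.pos_roots hb)]) hφ
  have h0 : vev0 N τ = -D.dd a (D.vact (D.s a) (vev0 N φ)) := by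
    have h1 := congrArg (vev0 N) hτ
    rw [map_smul, map_sub, D.vev0_avact har, vev0_smul, ev0_aff] at h1
    rw [dd_vact_s har hφ0, neg_neg, dd_eq har h1]
  refine ⟨_, hT, ?_, ?_⟩
  · rw [map_add, D.vev0_avact har, vev0_smul, ev0_last, zero_smul, add_zero]
  · have h2 := sum_simple_reflection (D := D)
      (f := fun b => D.dd b (D.vact (D.s a) (vev0 N φ))) (fun b hb => dd_neg hb hsφ0) ha
    rw [jet, jet, map_add, map_add, map_add, D.vev0_avact har, D.vev1_avact har, vev0_smul,
      vev1_smul, ev0_last, ev1_last, Int.cast_zero, zero_smul, zero_smul, add_zero, add_zero,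
      zero_smul, add_zero, one_smul, h0, map_smul, map_sum,
      Finset.sum_congr rfl fun b hb => vact_dd (D.s a) (D.pos_roots hb) hφ0, h2]
    module

theorem exists_operator (w : W) : ∀ φ ∈ D.shi, ∃ T ∈ D.shi,
    vev0 N T = D.vact w (vev0 N φ) ∧ D.jet T = D.vact w (D.jet φ) := by
  have hw : w ∈ Subgroup.closure (D.s '' (D.simple : Set (Fin N → ℂ))) := by
    rw [D.gen]; trivial
  have hstep : ∀ a ∈ D.simple, ∀ w, (∀ φ ∈ D.shi, ∃ T ∈ D.shi,
      vev0 N T = D.vact w (vev0 N φ) ∧ D.jet T = D.vact w (D.jet φ)) →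
      ∀ φ ∈ D.shi, ∃ T ∈ D.shi,
      vev0 N T = D.vact (D.s a * w) (vev0 N φ) ∧ D.jet T = D.vact (D.s a * w) (D.jet φ) := by
    intro a ha w hw φ hφ
    obtain ⟨T, hT, h1, h2⟩ := hw φ hφ
    obtain ⟨T', hT', h3, h4⟩ := exists_simple_operator ha hT
    exact ⟨T', hT', by rw [h3, h1, vact_vact], by rw [h4, h2, vact_vact]⟩
  induction hw using Subgroup.closure_induction_left with
  | one => exact fun φ hφ => ⟨φ, hφ, by rw [vact_one], by rw [vact_one]⟩
  | mul_left x hx y _ hy =>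
    obtain ⟨a, ha, rfl⟩ := hx
    exact hstep a ha y hy
  | inv_mul_cancel x hx y _ hy =>
    obtain ⟨a, ha, rfl⟩ := hx
    rw [D.s_inv (D.pos_roots (D.simple_pos ha))]
    exact hstep a ha y hy

variable (D) in
/-- The Dunkl operators on vector fields. -/
def dunkl (y : Fin N → ℂ) (ψ : Fin N → Pol N) : Fin N → Pol N :=
  (fun i => dir y (ψ i)) - ∑ a ∈ D.pos, (a ⬝ᵥ y) • D.dd a ψ

theorem vact_dir (w : W) (y : Fin N → ℂ) (ψ : Fin N → Pol N) :
    D.vact w (fun i => dir y (ψ i)) = fun i => dir ((D.g w).mulVec y) (D.vact w ψ i) := by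
  ext1 i
  simp only [vact, tact_apply, map_sum, Derivation.map_smul, dir_act]

theorem vact_dunkl (w : W) (y : Fin N → ℂ) {ψ : Fin N → Pol N}
    (hψ : ψ ∈ D.mder fun a => 2 * D.m a) :
    D.vact w (D.dunkl y ψ) = D.dunkl ((D.g w).mulVec y) (D.vact w ψ) := by
  rw [dunkl, dunkl, map_sub, vact_dir]
  congr 1
  rw [map_sum]
  have h1 := D.sum_roots (fun a => (a ⬝ᵥ y) • D.dd a ψ) fun a ha => by
    rw [dd_neg (D.pos_roots ha) hψ, neg_dotProduct, neg_smul_neg]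
  have h2 := D.sum_roots (fun a => (a ⬝ᵥ (D.g w).mulVec y) • D.dd a (D.vact w ψ)) fun a ha => by
    rw [dd_neg (D.pos_roots ha) (vact_mem w hψ), neg_dotProduct, neg_smul_neg]
  have h3 : D.vact w (∑ a ∈ D.roots, (a ⬝ᵥ y) • D.dd a ψ) =
      ∑ a ∈ D.roots, (a ⬝ᵥ (D.g w).mulVec y) • D.dd a (D.vact w ψ) := by
    rw [map_sum]
    refine Finset.sum_nbij' (fun a => (D.g w).mulVec a) (fun a => (D.g w⁻¹).mulVec a)
      (fun a ha => D.stab _ _ ha) (fun a ha => D.stab _ _ ha) (fun a _ => D.g_inv_mulVec w a)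
      (fun a _ => D.g_mulVec_inv w a) fun a ha => ?_
    rw [map_smul, vact_dd w ha hψ, dot_g]
  rw [h1, h2, map_nsmul, map_sum, ← Nat.cast_smul_eq_nsmul ℂ, ← Nat.cast_smul_eq_nsmul ℂ] at h3
  exact smul_right_injective _ (by norm_num : ((2 : ℕ) : ℂ) ≠ 0) h3

theorem exists_dunkl_top {φ : Fin N → Pol (N + 1)} (hφ : φ ∈ D.shi) : ∃ η ∈ D.shi,
    vev0 N η = D.dunkl (coroot D.top) (D.vact (D.s D.top) (vev0 N φ)) := by
  have ht := D.top_pos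
  have htr := D.pos_roots ht
  have htn := D.neg_roots htr
  have hφ0 := vev0_mem_mder hφ
  have hsφ0 := vact_mem (D.s D.top) hφ0
  have htt := D.sq_ne _ htr
  obtain ⟨τ, hτ, hT⟩ := D.exists_shi_operator (a := -D.top) (k := -1)
    (Or.inr ⟨by rwa [neg_neg], rfl⟩) (fun b hb h1 h2 j h3 h4 φ hφ => by
      rw [neg_neg] at h2
      have hbr := D.pos_roots hb
      have h5 : (2 * (-D.top ⬝ᵥ b) / (-D.top ⬝ᵥ -D.top)) • D.top =
          (D.g (D.s D.top)).mulVec b - b := by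
        rw [D.s_mulVec htr, neg_dotProduct_neg, neg_dotProduct]
        rw [mul_neg, neg_div, neg_smul]; abel
      rw [D.s_neg htr]
      rcases D.top_pair b hb h2 with h | ⟨h, h'⟩
      · rw [h, sub_self] at h5
        rw [(smul_eq_zero.1 h5).resolve_right (D.root_ne_zero htr), h, zero_mul, sub_zero]
        exact hφ b hb j h3 h4
      · have h6 : 2 * (-D.top ⬝ᵥ b) / (-D.top ⬝ᵥ -D.top) = -1 := by
          rw [h, sub_sub_cancel_left, ← sub_eq_zero, sub_neg_eq_add] at h5
          have h7 : (2 * (-D.top ⬝ᵥ b) / (-D.top ⬝ᵥ -D.top) + 1) • D.top = 0 := by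
            rw [add_smul, one_smul, h5]
          exact eq_neg_of_add_eq_zero_left
            ((smul_eq_zero.1 h7).resolve_right (D.root_ne_zero htr))
        have hm : D.m (D.top - b) = D.m b := by
          rw [← neg_sub, ← h, D.m_neg (D.stab _ _ hbr), D.m_inv _ _ hbr]
        rw [h6, h]
        have h8 := aff_dvd_neg (hφ _ h' (1 - j) (by omega) (by omega))
        rw [neg_sub] at h8
        convert h8 using 2
        push_cast
        ring) hφ
  obtain ⟨T', hT', h1, h2⟩ := exists_operator (D.s D.top) φ hφ
  have h0 : vev0 N τ = D.dd D.top (D.vact (D.s D.top) (vev0 N φ)) := by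
    have h1 := congrArg (vev0 N) hτ
    rw [map_smul, map_sub, D.vev0_avact htn, vev0_smul, ev0_aff] at h1
    rw [dd_vact_s htr hφ0, ← dd_neg htr hφ0, dd_eq htn h1]
  rw [jet, jet, map_add, h1, map_smul, map_sum,
    Finset.sum_congr rfl fun b hb => vact_dd (D.s D.top) (D.pos_roots hb) hφ0] at h2
  have h3 := sum_top_reflection (D := D)
    (f := fun b => D.dd b (D.vact (D.s D.top) (vev0 N φ))) (fun b hb => dd_neg hb hsφ0)
  obtain ⟨η, hη⟩ := vev0_eq_zero (φ := T' - (D.avact (-D.top) ((-1 : ℤ) : ℂ) φ +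
      (X (Fin.last N) : Pol (N + 1)) • τ)) (by
    rw [map_sub, map_add, D.vev0_avact htn, vev0_smul, ev0_last, zero_smul, add_zero, h1,
      D.s_neg htr, sub_self])
  refine ⟨η, mem_shi_of_last_smul (hη ▸ sub_mem hT' hT), ?_⟩
  have h4 := congrArg (vev1 N) hη
  have hc : coroot (-D.top) = -coroot D.top := by
    rw [coroot, coroot, neg_dotProduct_neg, smul_neg]
  have hc' : (D.g (D.s D.top)).mulVec (-coroot D.top) = coroot D.top := by
    rw [coroot, ← smul_neg, Matrix.mulVec_smul, Matrix.mulVec_neg, D.s_self htr, neg_neg]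
  rw [map_sub, map_add, D.vev1_avact htn, vev1_smul, vev1_smul, ev0_last, ev1_last, zero_smul,
    zero_smul, add_zero, add_zero, one_smul, one_smul, h0, D.s_neg htr, map_add, map_smul,
    vact_dir, hc, hc', Int.cast_neg, Int.cast_one] at h4
  rw [dunkl]
  linear_combination (norm := module) (-1 : ℂ) • h4 + h2 - (1 / 2 : ℂ) • h3

end RootData

namespace RootData

variable {N : ℕ} {W : Type} [Group W] (D : RootData N W)

/-- The restrictions to the hyperplane at infinity of the logarithmic vector fields of the cone of
the extended Shi arrangement. -/
def shiBar : Submodule (Pol N) (Fin N → Pol N) where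
  carrier := {ψ | ∃ φ ∈ D.shi, vev0 N φ = ψ}
  add_mem' := by
    rintro _ _ ⟨φ, h, rfl⟩ ⟨φ', h', rfl⟩
    exact ⟨φ + φ', add_mem h h', map_add _ _ _⟩
  zero_mem' := ⟨0, zero_mem _, map_zero _⟩
  smul_mem' := by
    rintro f _ ⟨φ, h, rfl⟩
    exact ⟨extend N f • φ, Submodule.smul_mem _ _ h, by rw [vev0_smul, ev0_extend]⟩

theorem shiBar_ne_bot : D.shiBar ≠ ⊥ := by
  obtain ⟨i, -⟩ := Function.ne_iff.1 (D.root_ne_zero (D.pos_roots D.top_pos))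
  let P : Pol (N + 1) := ∏ b ∈ D.pos, ∏ j ∈ Finset.Icc (1 - (D.m b : ℤ)) (D.m b), aff b (j : ℂ)
  have h1 : P • (Pi.single i 1 : Fin N → Pol (N + 1)) ∈ D.shi := fun b hb j h1 h2 => by
    rw [map_smul]
    refine Dvd.dvd.mul_right ?_ _
    exact (Finset.dvd_prod_of_mem (fun j : ℤ => aff b (j : ℂ)) (Finset.mem_Icc.2 ⟨h1, h2⟩)).trans
      (Finset.dvd_prod_of_mem
        (fun b => ∏ j ∈ Finset.Icc (1 - (D.m b : ℤ)) (D.m b), aff b (j : ℂ)) hb)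
  refine (Submodule.ne_bot_iff _).2 ⟨_, ⟨_, h1, rfl⟩, fun h => ?_⟩
  have h2 := congrFun h i
  rw [vev0_smul, Pi.smul_apply, vev0_apply, Pi.single_eq_same, map_one, smul_eq_mul, mul_one,
    map_prod, Pi.zero_apply] at h2
  refine Finset.prod_ne_zero_iff.2 (fun b hb => ?_) h2
  rw [map_prod]
  refine Finset.prod_ne_zero_iff.2 fun j _ => ?_
  rw [ev0_aff]
  exact linPoly_eq_zero.not.2 (D.root_ne_zero (D.pos_roots hb))

variable {D}

theorem vact_mem_shiBar (w : W) {ψ : Fin N → Pol N} (h : ψ ∈ D.shiBar) :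
    D.vact w ψ ∈ D.shiBar := by
  obtain ⟨φ, hφ, rfl⟩ := h
  obtain ⟨T, hT, h, -⟩ := exists_operator w φ hφ
  exact ⟨T, hT, h⟩

theorem shiBar_le : D.shiBar ≤ D.mder fun a => 2 * D.m a := by
  rintro _ ⟨φ, hφ, rfl⟩
  exact vev0_mem_mder hφ

theorem vcomp_mem_shiBar (k : ℕ) {ψ : Fin N → Pol N} (h : ψ ∈ D.shiBar) :
    vcomp k ψ ∈ D.shiBar := by
  obtain ⟨φ, hφ, rfl⟩ := h
  refine ⟨vcomp k φ, fun b hb j h1 h2 => ?_, (vcomp_vev0 k φ).symm⟩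
  rw [pair_vcomp]
  exact dvd_homogeneousComponent (isHomogeneous_aff _ _) (hφ b hb j h1 h2) k

theorem dunkl_add (y y' : Fin N → ℂ) (ψ : Fin N → Pol N) :
    D.dunkl (y + y') ψ = D.dunkl y ψ + D.dunkl y' ψ := by
  simp only [dunkl, dotProduct_add, add_smul, Finset.sum_add_distrib, dir_add]
  rw [← sub_eq_zero]
  ext1 i
  simp
  ring

theorem dunkl_smul (c : ℂ) (y : Fin N → ℂ) (ψ : Fin N → Pol N) :
    D.dunkl (c • y) ψ = c • D.dunkl y ψ := by
  simp only [dunkl, dotProduct_smul, smul_assoc, ← Finset.smul_sum, dir_smul, smul_sub]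
  rfl

theorem dunkl_mem_shiBar (y : Fin N → ℂ) {ψ : Fin N → Pol N} (h : ψ ∈ D.shiBar) :
    D.dunkl y ψ ∈ D.shiBar := by
  let U : Submodule ℂ (Fin N → ℂ) :=
    { carrier := {y | ∀ ψ ∈ D.shiBar, D.dunkl y ψ ∈ D.shiBar}
      add_mem' := fun h h' ψ hψ => by rw [dunkl_add]; exact add_mem (h ψ hψ) (h' ψ hψ)
      zero_mem' := fun ψ _ => by
        rw [← zero_smul ℂ (0 : Fin N → ℂ), dunkl_smul, zero_smul]; exact zero_mem _
      smul_mem' := fun c y h ψ hψ => by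
        rw [dunkl_smul, ← algebraMap_smul (Pol N)]; exact Submodule.smul_mem _ _ (h ψ hψ) }
  have htr := D.pos_roots D.top_pos
  have htop : coroot D.top ∈ U := by
    intro ψ hψ
    obtain ⟨φ, hφ, h1⟩ := vact_mem_shiBar (D.s D.top) hψ
    obtain ⟨η, hη, h2⟩ := exists_dunkl_top hφ
    exact ⟨η, hη, by rw [h2, h1, vact_vact, D.s_sq htr, vact_one]⟩
  have hU := D.irr U fun w y hy ψ hψ => by
    have h1 := vact_mem_shiBar w (hy _ (vact_mem_shiBar w⁻¹ hψ))
    rwa [vact_dunkl w y (shiBar_le (vact_mem_shiBar w⁻¹ hψ)), vact_vact, mul_inv_cancel,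
      vact_one] at h1
  have hne : U ≠ ⊥ := fun h => by
    rw [h, Submodule.mem_bot, coroot] at htop
    exact (smul_ne_zero (div_ne_zero two_ne_zero (D.sq_ne _ htr)) (D.root_ne_zero htr)) htop
  exact (hU.resolve_left hne ▸ Submodule.mem_top : y ∈ U) ψ h

variable (D) in
theorem exists_dunklKernel_shiBar : ∃ r, ∃ Φ : DunklKernel D r, ∀ j, Φ.φ j ∈ D.shiBar :=
  D.exists_dunklKernel _ D.shiBar_ne_bot shiBar_le (fun _ _ h => vact_mem_shiBar _ h)
    (fun k _ h => vcomp_mem_shiBar k h) fun φ hφ y => ⟨fun a => D.dd a φ,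
      fun _ ha => dd_spec (D.pos_roots ha) (shiBar_le hφ), dunkl_mem_shiBar y hφ⟩

end RootData

namespace RootData

variable {N : ℕ} {W : Type} [Group W] (D : RootData N W)

/-- The linear action on the polynomials on the cone, fixing the last coordinate. -/
def lact (w : W) : Pol (N + 1) →ₐ[ℂ] Pol (N + 1) :=
  aeval (Fin.snoc (fun i => extend N (D.act w (X i))) (X (Fin.last N)))

theorem lact_last (w : W) : D.lact w (X (Fin.last N)) = X (Fin.last N) := by simp [lact]

theorem lact_X (w : W) (i : Fin N) : D.lact w (X i.castSucc) = extend N (D.act w (X i)) := by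
  simp [lact]

theorem lact_extend (w : W) (f : Pol N) : D.lact w (extend N f) = extend N (D.act w f) := by
  have : (D.lact w).comp (extend N) = (extend N).comp (D.act w) := algHom_ext fun i => by
    simp only [AlgHom.comp_apply]
    rw [← lact_X]
    simp [extend]
  exact DFunLike.congr_fun this f

theorem lact_aff (w : W) (b : Fin N → ℂ) (c : ℂ) :
    D.lact w (aff b c) = aff ((D.g w).mulVec b) c := by
  have h : D.lact w (C c) = C c := algHom_C _ c
  rw [aff_eq, map_sub, map_mul, lact_last, h, ← extend_linPoly, lact_extend, act_linPoly,
    extend_linPoly, ← aff_eq]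

theorem lact_comp (w w' : W) : (D.lact w).comp (D.lact w') = D.lact (w * w') :=
  algHom_ext fun i => by
    simp only [AlgHom.comp_apply]
    refine Fin.lastCases ?_ (fun i => ?_) i
    · rw [lact_last, lact_last, lact_last]
    · rw [lact_X, lact_X, lact_extend, act_act]

theorem ev0_lact (w : W) (f : Pol (N + 1)) : ev0 N (D.lact w f) = D.act w (ev0 N f) := by
  have : (ev0 N).comp (D.lact w) = (D.act w).comp (ev0 N) := algHom_ext fun i => by
    simp only [AlgHom.comp_apply]
    refine Fin.lastCases ?_ (fun i => ?_) i
    · rw [lact_last, ev0_last, map_zero]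
    · rw [lact_X, ev0_X, ev0_extend]
  exact DFunLike.congr_fun this f

theorem lact_s {a : Fin N → ℂ} (ha : a ∈ D.roots) : D.lact (D.s a) = affRefl a 0 :=
  algHom_ext fun i => by
    refine Fin.lastCases ?_ (fun i => ?_) i
    · rw [lact_last, affRefl_last]
    · rw [lact_X, affRefl_X, ← linPoly_single, act_linPoly, extend_linPoly, D.s_mulVec ha,
        dotProduct_single, mul_one, ← extend_linPoly, ← extend_linPoly, linPoly_sub, map_sub,
        linPoly_smul, linPoly_single, smul_eq_C_mul, map_mul]
      simp [extend]

/-- The linear action on the vector fields on the cone. -/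
def lvact (w : W) : (Fin N → Pol (N + 1)) →ₗ[ℂ] (Fin N → Pol (N + 1)) := tact (D.g w) (D.lact w)

theorem lvact_smul (w : W) (f : Pol (N + 1)) (φ : Fin N → Pol (N + 1)) :
    D.lvact w (f • φ) = D.lact w f • D.lvact w φ := tact_smul _ _ _ _

theorem lvact_lvact (w w' : W) (φ : Fin N → Pol (N + 1)) :
    D.lvact w (D.lvact w' φ) = D.lvact (w * w') φ := by
  rw [lvact, lvact, lvact, tact_tact, lact_comp, map_mul]

theorem pair_lvact (w : W) (a : Fin N → ℂ) (φ : Fin N → Pol (N + 1)) :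
    pair a (D.lvact w φ) = D.lact w (pair ((D.g w⁻¹).mulVec a) φ) := by
  conv_lhs => rw [← D.g_mulVec_inv w a]
  exact pair_mulVec_tact (D.orth w) _ _ _

theorem lvact_s {a : Fin N → ℂ} (ha : a ∈ D.roots) : D.lvact (D.s a) = D.avact a 0 := by
  rw [lvact, D.lact_s ha]; rfl

theorem vev0_lvact (w : W) (φ : Fin N → Pol (N + 1)) :
    vev0 N (D.lvact w φ) = D.vact w (vev0 N φ) := by
  ext1 i
  simp only [vev0_apply, lvact, vact, tact_apply, map_sum, map_smul, D.ev0_lact]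

/-- The logarithmic vector fields of the cone of the extended Catalan arrangement, tangent to the
levels of `z`. -/
def cat : Submodule (Pol (N + 1)) (Fin N → Pol (N + 1)) where
  carrier := {φ | ∀ b ∈ D.roots, ∀ j : ℤ, -(D.m b : ℤ) ≤ j → j ≤ D.m b → aff b j ∣ pair b φ}
  add_mem' h h' b hb j h1 h2 := by rw [map_add]; exact dvd_add (h b hb j h1 h2) (h' b hb j h1 h2)
  zero_mem' b _ j _ _ := by simp
  smul_mem' c φ h b hb j h1 h2 := by rw [map_smul]; exact (h b hb j h1 h2).mul_left _

theorem mem_cat_of_pos {φ : Fin N → Pol (N + 1)} (h : ∀ b ∈ D.pos, ∀ j : ℤ, -(D.m b : ℤ) ≤ j →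
    j ≤ D.m b → aff b j ∣ pair b φ) : φ ∈ D.cat := fun b hb j h1 h2 => by
  rcases (D.mem_roots b).1 hb with h3 | h3
  · exact h b h3 j h1 h2
  · have h4 := aff_dvd_neg (h _ h3 (-j) (by rw [D.m_neg hb]; omega) (by rw [D.m_neg hb]; omega))
    rwa [neg_neg, Int.cast_neg, neg_neg] at h4

theorem lvact_mem_cat (w : W) {φ : Fin N → Pol (N + 1)} (h : φ ∈ D.cat) : D.lvact w φ ∈ D.cat := by
  intro b hb j h1 h2
  have hm := D.m_inv w⁻¹ b hb
  have h3 := map_dvd (D.lact w) (h _ (D.stab w⁻¹ b hb) j (by omega) (by omega))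
  rwa [lact_aff, g_mulVec_inv, ← pair_lvact] at h3

theorem vcomp_mem_cat (k : ℕ) {φ : Fin N → Pol (N + 1)} (h : φ ∈ D.cat) : vcomp k φ ∈ D.cat :=
  fun b hb j h1 h2 => by
    rw [pair_vcomp]
    exact dvd_homogeneousComponent (isHomogeneous_aff _ _) (h b hb j h1 h2) k

theorem vev0_mem_of_cat {φ : Fin N → Pol (N + 1)} (h : φ ∈ D.cat) :
    vev0 N φ ∈ D.mder fun a => 2 * D.m a + 1 := fun a ha => by
  have h2 := pow_dvd_ev0 ha (h a ha)
  rwa [← pair_vev0, show ((D.m a : ℤ) + 1 - -(D.m a)).toNat = 2 * D.m a + 1 by omega] at h2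

theorem mem_cat_of_last_smul {φ : Fin N → Pol (N + 1)}
    (h : (X (Fin.last N) : Pol (N + 1)) • φ ∈ D.cat) : φ ∈ D.cat := fun b hb j h1 h2 => by
  have h3 := h b hb j h1 h2
  rw [map_smul] at h3
  have hb0 := D.root_ne_zero hb
  exact ((prime_aff hb0 _).dvd_or_dvd h3).resolve_left (not_aff_dvd_X hb0 _)

theorem det_s {a : Fin N → ℂ} (ha : a ∈ D.roots) : (D.g (D.s a)).det = -1 := by
  rw [D.g_s a ha, sub_eq_add_neg, ← Matrix.neg_vecMulVec, Matrix.vecMulVec_eq Unit,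
    Matrix.det_one_add_replicateCol_mul_replicateRow, dotProduct_neg, smul_dotProduct, smul_eq_mul,
    div_mul_cancel₀ _ (D.sq_ne a ha)]
  norm_num

/-- The product of the positive roots. -/
def disc : Pol N := ∏ a ∈ D.pos, linPoly a

theorem disc_ne_zero : D.disc ≠ 0 := Finset.prod_ne_zero_iff.2 fun _ ha =>
  linPoly_eq_zero.not.2 (D.root_ne_zero (D.pos_roots ha))

theorem act_simple_disc {a : Fin N → ℂ} (ha : a ∈ D.simple) :
    D.act (D.s a) D.disc = -D.disc := by
  classical
  have ha' := D.simple_pos ha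
  have har := D.pos_roots ha'
  have hmem : ∀ b ∈ D.pos.erase a, (D.g (D.s a)).mulVec b ∈ D.pos.erase a := fun b hb => by
    rw [Finset.mem_erase] at hb ⊢
    refine ⟨fun h => ?_, D.simple_perm a ha b hb.2 hb.1⟩
    have h1 := congrArg (D.g (D.s a)).mulVec h
    rw [D.s_s har, D.s_self har] at h1
    exact D.pos_disj a ha' (h1 ▸ hb.2)
  have : ∏ b ∈ D.pos.erase a, linPoly ((D.g (D.s a)).mulVec b) = ∏ b ∈ D.pos.erase a, linPoly b :=
    Finset.prod_nbij' (fun b => (D.g (D.s a)).mulVec b) (fun b => (D.g (D.s a)).mulVec b)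
      hmem hmem (fun b _ => D.s_s har b) (fun b _ => D.s_s har b) fun _ _ => rfl
  rw [disc, map_prod, ← Finset.mul_prod_erase _ _ ha', D.act_s_linPoly har]
  simp only [act_linPoly]
  rw [this, neg_mul, Finset.mul_prod_erase _ _ ha']

theorem act_disc (w : W) : D.act w D.disc = (D.g w).det • D.disc := by
  have hw : w ∈ Subgroup.closure (D.s '' (D.simple : Set (Fin N → ℂ))) := by
    rw [D.gen]; trivial
  have hstep : ∀ a ∈ D.simple, ∀ w, D.act w D.disc = (D.g w).det • D.disc →
      D.act (D.s a * w) D.disc = (D.g (D.s a * w)).det • D.disc := by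
    intro a ha w hw
    rw [← act_act, hw, map_smul, D.act_simple_disc ha, map_mul, Matrix.det_mul,
      D.det_s (D.pos_roots (D.simple_pos ha)), neg_one_mul, neg_smul, smul_neg]
  induction hw using Subgroup.closure_induction_left with
  | one => simp [act_one]
  | mul_left x hx y _ hy =>
    obtain ⟨a, ha, rfl⟩ := hx
    exact hstep a ha y hy
  | inv_mul_cancel x hx y _ hy =>
    obtain ⟨a, ha, rfl⟩ := hx
    rw [D.s_inv (D.pos_roots (D.simple_pos ha))]
    exact hstep a ha y hy

theorem det_mul_self (w : W) : (D.g w).det * (D.g w).det = 1 := by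
  have := congrArg Matrix.det (D.orth w)
  rwa [Matrix.det_mul, Matrix.det_transpose, Matrix.det_one] at this

theorem extend_disc : extend N D.disc = ∏ a ∈ D.pos, aff a 0 := by
  rw [disc, map_prod]; exact Finset.prod_congr rfl fun _ _ => extend_linPoly _

theorem extend_disc_dvd {f : Pol (N + 1)} (h : ∀ a ∈ D.pos, aff a 0 ∣ f) :
    extend N D.disc ∣ f := by
  rw [extend_disc]
  refine Finset.prod_dvd_of_isRelPrime (fun a ha b hb hab => ?_) h
  refine ((prime_aff (D.root_ne_zero (D.pos_roots ha)) 0).irreducible.isRelPrime_iff_not_dvd).2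
    fun h => hab ?_
  obtain ⟨r, h1, -⟩ := aff_dvd h
  rcases D.reduced a (D.pos_roots ha) r (h1 ▸ D.pos_roots hb) with rfl | rfl
  · rw [h1, one_smul]
  · rw [h1, neg_one_smul] at hb; exact absurd hb (D.pos_disj a ha)

variable {D}

/-- An antisymmetric logarithmic vector field is the product of the positive roots and a
logarithmic vector field. -/
theorem exists_extend_disc_smul {Ψ : Fin N → Pol (N + 1)} (hΨ : Ψ ∈ D.cat)
    (h : ∀ a ∈ D.roots, D.lvact (D.s a) Ψ = -Ψ) : ∃ φ ∈ D.cat, Ψ = extend N D.disc • φ := by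
  have h0 : ∀ a ∈ D.roots, aff a 0 ∣ pair a Ψ := fun a ha => by
    simpa using hΨ a ha 0 (by omega) (by omega)
  have h1 : ∀ a ∈ D.pos, ∀ i, aff a 0 ∣ Ψ i := fun a ha i => by
    have har := D.pos_roots ha
    obtain ⟨ψ, hψ⟩ := D.dvd_sub_avact har (h0 a har)
    rw [← D.lvact_s har, h a har, sub_neg_eq_add, ← two_smul ℂ] at hψ
    refine ⟨(1 / 2 : ℂ) • ψ i, ?_⟩
    have h2 := congrFun hψ i
    simp only [Pi.smul_apply, smul_eq_mul] at h2
    rw [mul_smul_comm, ← h2, smul_smul]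
    norm_num
  choose φ hφ using fun i => D.extend_disc_dvd fun a ha => h1 a ha i
  have hΨφ : Ψ = extend N D.disc • φ := _root_.funext hφ
  have hne : extend N D.disc ≠ 0 := fun h =>
    D.disc_ne_zero (by rw [← ev0_extend D.disc, h, map_zero])
  refine ⟨φ, ?_, hΨφ⟩
  have hinv : ∀ a ∈ D.roots, D.lvact (D.s a) φ = φ := fun a ha => by
    have h2 := h a ha
    rw [hΨφ, lvact_smul, lact_extend, act_disc, D.det_s ha, neg_one_smul, map_neg, neg_smul,
      neg_inj] at h2
    exact smul_right_injective _ hne h2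
  intro b hb j h2 h3
  have hb0 := D.root_ne_zero hb
  by_cases hj : j = 0
  · subst hj
    rw [Int.cast_zero]
    have h4 := aff_dvd_sub_affRefl b 0 (pair b φ)
    have h5 := congrArg (pair b) (hinv b hb)
    rw [D.lvact_s hb, D.pair_avact' hb, D.s_self hb, pair_neg_left, map_neg] at h5
    rw [← neg_eq_iff_eq_neg.2 h5.symm, sub_neg_eq_add, ← two_mul] at h4
    refine ((prime_aff hb0 0).dvd_or_dvd h4).resolve_left fun h6 => (prime_aff hb0 0).not_isUnit ?_
    refine isUnit_of_dvd_unit h6 ?_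
    have : (2 : Pol (N + 1)) = C 2 := (map_ofNat C 2).symm
    rw [this]
    exact (isUnit_iff_ne_zero.2 (two_ne_zero' ℂ)).map C
  · have h4 := hΨ b hb j h2 h3
    rw [hΨφ, map_smul] at h4
    refine ((prime_aff hb0 _).dvd_or_dvd h4).resolve_left fun h5 => ?_
    rw [extend_disc] at h5
    obtain ⟨a, ha, h6⟩ := (prime_aff hb0 _).exists_mem_finset_dvd h5
    obtain ⟨r, h7, h8⟩ := aff_dvd h6
    have hr : r = 0 := (mul_eq_zero.1 h8.symm).resolve_right (by exact_mod_cast hj)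
    rw [hr, zero_smul] at h7
    exact D.root_ne_zero (D.pos_roots ha) h7

theorem exists_cat_lift [Finite W] {ψ : Fin N → Pol N} (hψ : ψ ∈ D.shiBar)
    (hinv : ∀ w, D.vact w ψ = ψ) : ∃ φ ∈ D.cat, vev0 N φ = ψ := by
  have := Fintype.ofFinite W
  obtain ⟨φ, hφ, rfl⟩ := hψ
  let P : Pol (N + 1) := ∏ a ∈ D.pos, aff a (-D.m a : ℂ)
  have hP : ev0 N P = D.disc := by
    rw [map_prod]; exact Finset.prod_congr rfl fun _ _ => ev0_aff _ _
  have hcat : P • φ ∈ D.cat := D.mem_cat_of_pos fun b hb j h1 h2 => by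
    rw [map_smul]
    by_cases hj : j = -(D.m b)
    · refine Dvd.dvd.mul_right ?_ _
      rw [hj]
      push_cast
      exact Finset.dvd_prod_of_mem (fun a => aff a (-D.m a : ℂ)) hb
    · exact (hφ b hb j (by omega) h2).mul_left _
  obtain ⟨θ, hθ, h⟩ := exists_extend_disc_smul
    (Ψ := ∑ w, (D.g w).det • D.lvact w (P • φ)) (D := D)
    (sum_mem fun w _ => by
      rw [← algebraMap_smul (Pol (N + 1))]
      exact Submodule.smul_mem _ _ (D.lvact_mem_cat w hcat)) (fun a ha => by
      rw [map_sum, ← Finset.sum_neg_distrib]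
      refine Fintype.sum_equiv (Equiv.mulLeft (D.s a)) _ _ fun w => ?_
      rw [Equiv.coe_mulLeft, map_smul, lvact_lvact, map_mul, Matrix.det_mul, D.det_s ha,
        neg_one_mul, neg_smul, neg_neg])
  have h1 := congrArg (vev0 N) h
  have h2 : ∀ w ∈ Finset.univ, vev0 N ((D.g w).det • D.lvact w (P • φ)) = D.disc • vev0 N φ :=
    fun w _ => by
      rw [map_smul, vev0_lvact, vev0_smul, hP, vact_smul, hinv, act_disc, smul_assoc, smul_smul,
        det_mul_self, one_smul]
  rw [map_sum, Finset.sum_congr rfl h2, Finset.sum_const, vev0_smul, ev0_extend, smul_comm] at h1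
  have h3 := smul_right_injective _ D.disc_ne_zero h1
  rw [← Nat.cast_smul_eq_nsmul ℂ] at h3
  refine ⟨((Finset.univ : Finset W).card : ℂ)⁻¹ • θ, ?_, ?_⟩
  · rw [← algebraMap_smul (Pol (N + 1))]; exact Submodule.smul_mem _ _ hθ
  · have hne : ((Finset.univ : Finset W).card : ℂ) ≠ 0 := by
      rw [Nat.cast_ne_zero, Finset.card_ne_zero]; exact ⟨1, Finset.mem_univ _⟩
    rw [map_smul, ← h3, smul_smul, inv_mul_cancel₀ hne, one_smul]

/-- The logarithmic vector fields of the cone of the extended Catalan arrangement that are tangent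
to the levels of `z` form a free module. -/
theorem exists_cat_basis [Finite W] (D : RootData N W) : ∃ Θ : Fin N → Fin N → Pol (N + 1),
    (∀ k, Θ k ∈ D.cat) ∧ (∀ φ ∈ D.cat, ∃ f : Fin N → Pol (N + 1), φ = ∑ k, f k • Θ k) ∧
    ∀ f : Fin N → Pol (N + 1), ∑ k, f k • Θ k = 0 → f = 0 := by
  obtain ⟨r, Φ, hΦ⟩ := D.exists_dunklKernel_shiBar
  obtain ⟨e, θ, he, hθ, hind, hgen⟩ := Φ.exists_basis
  have hlift : ∀ k, ∃ φ ∈ D.cat, (∀ i, (φ i).IsHomogeneous (e k)) ∧ vev0 N φ = θ k := fun k => by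
    obtain ⟨c, hc⟩ := Φ.exists_eq_sum (hθ k).1
    obtain ⟨φ, hφ, h⟩ := exists_cat_lift
      (hc ▸ sum_mem fun j _ => Submodule.smul_mem _ _ (hΦ j)) (hθ k).2
    refine ⟨vcomp (e k) φ, D.vcomp_mem_cat _ hφ,
      fun i => homogeneousComponent_isHomogeneous _ _, ?_⟩
    rw [← vcomp_vev0, h]
    exact _root_.funext fun i => (homogeneousComponent_of_mem (he k i)).trans (if_pos rfl)
  choose Θ hΘ hΘe hΘ0 using hlift
  have hvev : ∀ f : Fin N → Pol (N + 1), vev0 N (∑ k, f k • Θ k) = ∑ k, ev0 N (f k) • θ k :=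
    fun f => by rw [map_sum]; exact Finset.sum_congr rfl fun k _ => by rw [vev0_smul, hΘ0]
  have hz : (X (Fin.last N) : Pol (N + 1)) ≠ 0 := X_ne_zero _
  refine ⟨Θ, hΘ, ?_, ?_⟩
  · let G := Submodule.span (Pol (N + 1)) (Set.range Θ)
    have hG : ∀ g ∈ G, ∀ d, vcomp d g ∈ G := fun g hg d => by
      obtain ⟨f, rfl⟩ := (Submodule.mem_span_range_iff_exists_fun _).1 hg
      rw [map_sum]
      refine sum_mem fun k _ => ?_
      rw [vcomp_smul' (hΘe k)]
      exact Submodule.smul_mem _ _ (Submodule.subset_span ⟨k, rfl⟩)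
    have key : ∀ d, ∀ φ ∈ D.cat, vcomp d φ ∈ G := by
      intro d
      induction d using Nat.strong_induction_on with
      | _ d ih =>
        intro φ hφ
        obtain ⟨f, hf⟩ := hgen _ (D.vev0_mem_of_cat hφ)
        have h0 : vev0 N (φ - ∑ k, extend N (f k) • Θ k) = 0 := by
          rw [map_sub, hvev, hf]
          simp only [ev0_extend, sub_self]
        obtain ⟨φ', hφ'⟩ := vev0_eq_zero h0
        have hs : ∑ k, extend N (f k) • Θ k ∈ G :=
          sum_mem fun k _ => Submodule.smul_mem _ _ (Submodule.subset_span ⟨k, rfl⟩)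
        have hc : φ' ∈ D.cat := D.mem_cat_of_last_smul (hφ' ▸ sub_mem hφ
          (sum_mem fun k _ => Submodule.smul_mem _ _ (hΘ k)))
        rw [sub_eq_iff_eq_add.1 hφ', map_add, vcomp_smul (isHomogeneous_X _ _)]
        refine add_mem (Submodule.smul_mem _ _ ?_) (hG _ hs _)
        split_ifs
        · exact ih (d - 1) (by omega) _ hc
        · exact zero_mem _
    intro φ hφ
    obtain ⟨d, hd⟩ := exists_sum_vcomp φ
    have h : φ ∈ G := hd ▸ sum_mem fun k _ => key k φ hφ
    obtain ⟨f, hf⟩ := (Submodule.mem_span_range_iff_exists_fun _).1 h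
    exact ⟨f, hf.symm⟩
  · have key : ∀ n, ∀ f : Fin N → Pol (N + 1), (∀ k, f k = 0 ∨ (f k).totalDegree < n) →
        ∑ k, f k • Θ k = 0 → f = 0 := by
      intro n
      induction n with
      | zero => exact fun f h _ => _root_.funext fun k => (h k).resolve_right (by omega)
      | succ n ih =>
        intro f hn hf
        have h0 := hind (fun k => ev0 N (f k)) (by rw [← hvev, hf, map_zero])
        choose f' hf' using fun k => last_dvd_iff.2 (congrFun h0 k)
        have h1 : f = (X (Fin.last N) : Pol (N + 1)) • f' := _root_.funext hf'
        rw [h1, ih f' ?_ ?_, smul_zero]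
        · intro k
          rcases eq_or_ne (f' k) 0 with h | h
          · exact Or.inl h
          · right
            have h2 := (hn k).resolve_left (by rw [hf']; exact mul_ne_zero hz h)
            rw [hf', totalDegree_mul_of_isDomain hz h, totalDegree_X] at h2
            omega
        · refine smul_right_injective _ hz ?_
          simp only [smul_zero, Finset.smul_sum, smul_smul]
          rw [← hf]
          exact Finset.sum_congr rfl fun k _ => by rw [hf']
    intro f hf
    refine key ((Finset.univ.sup fun k => (f k).totalDegree) + 1) f (fun k => Or.inr ?_) hf
    exact Nat.lt_succ_of_le (Finset.le_sup (f := fun k => (f k).totalDegree) (Finset.mem_univ k))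

end RootData

/-- A reduced crystallographic root system in `ℝ^N` together with a linear functional separating
its elements. -/
structure OrderedRoots (N : ℕ) where
  /-- The roots. -/
  R : Finset (Fin N → ℝ)
  /-- The separating functional. -/
  f : (Fin N → ℝ) →ₗ[ℝ] ℝ
  reduced : ∀ a ∈ R, ∀ c : ℝ, c • a ∈ R → c = 1 ∨ c = -1
  refl_mem : ∀ a ∈ R, ∀ b ∈ R, b - (2 * (a ⬝ᵥ b) / (a ⬝ᵥ a)) • a ∈ R
  crys : ∀ a ∈ R, ∀ b ∈ R, ∃ k : ℤ, 2 * (a ⬝ᵥ b) / (b ⬝ᵥ b) = k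
  f_ne : ∀ a ∈ R, f a ≠ 0
  f_inj : ∀ a ∈ R, ∀ b ∈ R, f a = f b → a = b

namespace OrderedRoots

variable {N : ℕ} (D : OrderedRoots N)

theorem ne_zero {a : Fin N → ℝ} (h : a ∈ D.R) : a ≠ 0 := by
  rintro rfl
  exact D.f_ne _ h (map_zero _)

theorem dot_pos {a : Fin N → ℝ} (h : a ∈ D.R) : 0 < a ⬝ᵥ a := by
  simpa using Matrix.dotProduct_self_star_pos_iff.2 (D.ne_zero h)

theorem neg_mem {a : Fin N → ℝ} (h : a ∈ D.R) : -a ∈ D.R := by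
  have h1 := D.refl_mem a h a h
  rw [mul_div_assoc, div_self (D.dot_pos h).ne', mul_one, two_smul] at h1
  simpa using h1

theorem crys' {a b : Fin N → ℝ} (ha : a ∈ D.R) (hb : b ∈ D.R) :
    ∃ k : ℤ, 2 * (a ⬝ᵥ b) / (a ⬝ᵥ a) = k := by
  rw [dotProduct_comm a b]
  exact D.crys b hb a ha

theorem dot_sq_lt {a b : Fin N → ℝ} (ha : a ∈ D.R) (hb : b ∈ D.R) (h : b ≠ a) (h' : b ≠ -a) :
    (a ⬝ᵥ b) ^ 2 < (a ⬝ᵥ a) * (b ⬝ᵥ b) := by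
  have ha0 := D.dot_pos ha
  by_contra! hle
  have hw : (a ⬝ᵥ a) • b - (a ⬝ᵥ b) • a = 0 := by
    have h0 : 0 ≤ ((a ⬝ᵥ a) • b - (a ⬝ᵥ b) • a) ⬝ᵥ ((a ⬝ᵥ a) • b - (a ⬝ᵥ b) • a) := by
      simpa using dotProduct_self_star_nonneg ((a ⬝ᵥ a) • b - (a ⬝ᵥ b) • a)
    have h1 : ((a ⬝ᵥ a) • b - (a ⬝ᵥ b) • a) ⬝ᵥ ((a ⬝ᵥ a) • b - (a ⬝ᵥ b) • a) =
        (a ⬝ᵥ a) * ((a ⬝ᵥ a) * (b ⬝ᵥ b) - (a ⬝ᵥ b) ^ 2) := by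
      simp only [sub_dotProduct, dotProduct_sub, smul_dotProduct, dotProduct_smul, smul_eq_mul]
      rw [dotProduct_comm b a]
      ring
    refine dotProduct_self_eq_zero.1 (le_antisymm ?_ h0)
    rw [h1]
    exact mul_nonpos_of_nonneg_of_nonpos ha0.le (by linarith)
  have hb' : b = ((a ⬝ᵥ b) / (a ⬝ᵥ a)) • a := by
    rw [div_eq_inv_mul, mul_smul, ← sub_eq_zero.1 hw, inv_smul_smul₀ ha0.ne']
  rcases D.reduced a ha _ (hb' ▸ hb) with h1 | h1
  · exact h (by rw [hb', h1, one_smul])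
  · exact h' (by rw [hb', h1, neg_one_smul])

theorem exists_cartan {a b : Fin N → ℝ} (ha : a ∈ D.R) (hb : b ∈ D.R) (h : b ≠ a)
    (h0 : 0 < a ⬝ᵥ b) : ∃ k l : ℤ, 2 * (a ⬝ᵥ b) / (a ⬝ᵥ a) = k ∧ 2 * (a ⬝ᵥ b) / (b ⬝ᵥ b) = l ∧
      0 < k ∧ 0 < l ∧ k * l < 4 := by
  obtain ⟨k, hk⟩ := D.crys' ha hb
  obtain ⟨l, hl⟩ := D.crys a ha b hb
  have ha0 := D.dot_pos ha
  have hb0 := D.dot_pos hb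
  have h' : b ≠ -a := by
    rintro rfl
    rw [dotProduct_neg] at h0
    linarith
  refine ⟨k, l, hk, hl, ?_, ?_, ?_⟩
  · exact_mod_cast (hk ▸ by positivity : (0 : ℝ) < k)
  · exact_mod_cast (hl ▸ by positivity : (0 : ℝ) < l)
  · have h1 : (k : ℝ) * l < 4 := by
      rw [← hk, ← hl, div_mul_div_comm, div_lt_iff₀ (mul_pos ha0 hb0)]
      linarith [D.dot_sq_lt ha hb h h']
    exact_mod_cast h1

theorem sub_mem {a b : Fin N → ℝ} (ha : a ∈ D.R) (hb : b ∈ D.R) (h : b ≠ a)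
    (h0 : 0 < a ⬝ᵥ b) : b - a ∈ D.R := by
  obtain ⟨k, l, hk, hl, hk0, hl0, hkl⟩ := D.exists_cartan ha hb h h0
  have h1 : k = 1 ∨ l = 1 := by
    by_contra! hne
    nlinarith [show 2 ≤ k by omega, show 2 ≤ l by omega]
  rcases h1 with rfl | rfl
  · have h2 := D.refl_mem a ha b hb
    rwa [hk, Int.cast_one, one_smul] at h2
  · have h2 := D.refl_mem b hb a ha
    rw [dotProduct_comm b a, hl, Int.cast_one, one_smul] at h2
    simpa using D.neg_mem h2

/-- The positive roots. -/
def pos : Finset (Fin N → ℝ) := D.R.filter fun a => 0 < D.f a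

theorem mem_pos {a : Fin N → ℝ} : a ∈ D.pos ↔ a ∈ D.R ∧ 0 < D.f a := Finset.mem_filter

theorem pos_or_neg {a : Fin N → ℝ} (h : a ∈ D.R) : a ∈ D.pos ∨ -a ∈ D.pos := by
  rcases lt_or_gt_of_ne (D.f_ne a h) with h1 | h1
  · exact Or.inr (D.mem_pos.2 ⟨D.neg_mem h, by rw [map_neg]; linarith⟩)
  · exact Or.inl (D.mem_pos.2 ⟨h, h1⟩)

open scoped Classical in
/-- The simple roots. -/
def simple : Finset (Fin N → ℝ) :=
  D.pos.filter fun a => ∀ b ∈ D.pos, ∀ c ∈ D.pos, a ≠ b + c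

theorem mem_simple {a : Fin N → ℝ} :
    a ∈ D.simple ↔ a ∈ D.pos ∧ ∀ b ∈ D.pos, ∀ c ∈ D.pos, a ≠ b + c := Finset.mem_filter

theorem sub_mem_pos {a b : Fin N → ℝ} (ha : a ∈ D.simple) (hb : b ∈ D.pos) (h : b ≠ a)
    (h0 : 0 < a ⬝ᵥ b) : b - a ∈ D.pos := by
  obtain ⟨ha, ha'⟩ := D.mem_simple.1 ha
  refine (D.pos_or_neg (D.sub_mem (D.mem_pos.1 ha).1 (D.mem_pos.1 hb).1 h h0)).resolve_right
    fun h1 => ha' _ hb _ h1 (by abel)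

theorem simple_perm {a b : Fin N → ℝ} (ha : a ∈ D.simple) (hb : b ∈ D.pos) (h : b ≠ a) :
    b - (2 * (a ⬝ᵥ b) / (a ⬝ᵥ a)) • a ∈ D.pos := by
  obtain ⟨hap, ha'⟩ := D.mem_simple.1 ha
  obtain ⟨haR, haf⟩ := D.mem_pos.1 hap
  obtain ⟨hbR, hbf⟩ := D.mem_pos.1 hb
  have ha0 := D.dot_pos haR
  have hR := D.refl_mem a haR b hbR
  rcases le_or_gt (a ⬝ᵥ b) 0 with h0 | h0
  · refine D.mem_pos.2 ⟨hR, ?_⟩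
    rw [map_sub, map_smul, smul_eq_mul]
    have : 2 * (a ⬝ᵥ b) / (a ⬝ᵥ a) ≤ 0 := div_nonpos_of_nonpos_of_nonneg (by linarith) ha0.le
    nlinarith
  · refine (D.pos_or_neg hR).resolve_right fun hγ => ?_
    obtain ⟨k, l, hk, -, hk0, hl0, hkl⟩ := D.exists_cartan haR hbR h h0
    rw [hk] at hγ
    have h1 := D.sub_mem_pos ha hb h h0
    have hk' : 2 * (a ⬝ᵥ b) = k * (a ⬝ᵥ a) := by rw [← hk]; field_simp
    have h2 : 0 < a ⬝ᵥ (-(b - (k : ℝ) • a)) := by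
      rw [dotProduct_neg, dotProduct_sub, dotProduct_smul, smul_eq_mul]
      linarith
    have h3 : -(b - (k : ℝ) • a) ≠ a := fun h3 => by
      have hb' : b = ((k : ℝ) - 1) • a := by
        linear_combination (norm := module) -h3
      rcases D.reduced a haR _ (hb' ▸ hbR) with h4 | h4
      · exact h (by rw [hb', h4, one_smul])
      · rw [hb', h4, map_smul, smul_eq_mul] at hbf
        linarith
    have h4 := D.sub_mem_pos ha hγ h3 h2
    have h5 : (b - a) + (-(b - (k : ℝ) • a) - a) = ((k : ℝ) - 2) • a := by module
    have h6 : 0 < ((k : ℝ) - 2) * D.f a := by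
      rw [← smul_eq_mul, ← map_smul, ← h5, map_add]
      exact add_pos (D.mem_pos.1 h1).2 (D.mem_pos.1 h4).2
    have h7 : (2 : ℝ) < k := by
      by_contra! h7
      nlinarith
    have h8 : 2 < k := by exact_mod_cast h7
    obtain rfl : k = 3 := by nlinarith
    refine ha' _ h1 _ h4 ?_
    rw [h5]
    norm_num

theorem exists_simple_dot_pos {b v : Fin N → ℝ} (hb : b ∈ D.pos) (h : 0 < v ⬝ᵥ b) :
    ∃ a ∈ D.simple, 0 < v ⬝ᵥ a := by
  by_contra! hne
  obtain ⟨c, hc, hmin⟩ := (D.pos.filter fun b => 0 < v ⬝ᵥ b).exists_min_image D.f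
    ⟨b, Finset.mem_filter.2 ⟨hb, h⟩⟩
  obtain ⟨hc, hvc⟩ := Finset.mem_filter.1 hc
  have h1 : c ∉ D.simple := fun h => (hne c h).not_gt hvc
  simp only [mem_simple, not_and, not_forall, not_not] at h1
  obtain ⟨d, hd, e, he, rfl⟩ := h1 hc
  have hdf := (D.mem_pos.1 hd).2
  have hef := (D.mem_pos.1 he).2
  have hd' : ¬0 < v ⬝ᵥ d := fun h => by
    have := hmin d (Finset.mem_filter.2 ⟨hd, h⟩)
    rw [map_add] at this
    linarith
  have he' : ¬0 < v ⬝ᵥ e := fun h => by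
    have := hmin e (Finset.mem_filter.2 ⟨he, h⟩)
    rw [map_add] at this
    linarith
  rw [dotProduct_add] at hvc
  linarith

/-- Induction on positive roots through simple reflections. -/
theorem pos_induction {P : (Fin N → ℝ) → Prop} (hs : ∀ a ∈ D.simple, P a)
    (hr : ∀ a ∈ D.simple, ∀ b ∈ D.pos, P (b - (2 * (a ⬝ᵥ b) / (a ⬝ᵥ a)) • a) → P b)
    {b : Fin N → ℝ} (hb : b ∈ D.pos) : P b := by
  classical
  by_contra hne
  obtain ⟨c, hc, hmin⟩ := (D.pos.filter fun b => ¬P b).exists_min_image D.f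
    ⟨b, Finset.mem_filter.2 ⟨hb, hne⟩⟩
  obtain ⟨hc, hPc⟩ := Finset.mem_filter.1 hc
  obtain ⟨a, ha, hac⟩ := D.exists_simple_dot_pos hc (D.dot_pos (D.mem_pos.1 hc).1)
  have hca : c ≠ a := by rintro rfl; exact hPc (hs _ ha)
  have haf := D.mem_pos.1 (D.mem_simple.1 ha).1
  refine hPc (hr a ha c hc ?_)
  by_contra hP
  have h1 := hmin _ (Finset.mem_filter.2 ⟨D.simple_perm ha hc hca, hP⟩)
  rw [map_sub, map_smul, smul_eq_mul] at h1
  rw [dotProduct_comm] at hac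
  have h2 : 0 < 2 * (a ⬝ᵥ c) / (a ⬝ᵥ a) := div_pos (by linarith) (D.dot_pos haf.1)
  nlinarith [mul_pos h2 haf.2]

theorem exists_top (hne : D.R.Nonempty) : ∃ t ∈ D.pos, ∀ b ∈ D.pos, b ≠ t →
    b - (2 * (t ⬝ᵥ b) / (t ⬝ᵥ t)) • t = b ∨
      (b - (2 * (t ⬝ᵥ b) / (t ⬝ᵥ t)) • t = b - t ∧ t - b ∈ D.pos) := by
  obtain ⟨t, ht, hmax⟩ := D.R.exists_max_image D.f hne
  have htf : 0 < D.f t := by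
    have h1 := hmax _ (D.neg_mem ht)
    rw [map_neg] at h1
    exact lt_of_le_of_ne (by linarith) (D.f_ne t ht).symm
  refine ⟨t, D.mem_pos.2 ⟨ht, htf⟩, fun b hb hbt => ?_⟩
  obtain ⟨hbR, hbf⟩ := D.mem_pos.1 hb
  rcases lt_trichotomy (t ⬝ᵥ b) 0 with h | h | h
  · have h1 := D.sub_mem (D.neg_mem hbR) ht (fun h1 => by rw [h1, map_neg] at htf; linarith)
      (by rw [neg_dotProduct, dotProduct_comm]; linarith)
    have h2 := hmax _ h1
    rw [sub_neg_eq_add, map_add] at h2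
    linarith
  · left
    rw [h]
    simp
  · right
    have hlt : D.f b < D.f t := lt_of_le_of_ne (hmax b hbR) fun h => hbt (D.f_inj _ hbR _ ht h)
    obtain ⟨k, l, hk, -, hk0, -, -⟩ := D.exists_cartan ht hbR hbt h
    have h1 := hmax _ (D.neg_mem (D.refl_mem t ht b hbR))
    rw [map_neg, map_sub, map_smul, smul_eq_mul, hk] at h1
    have h2 : (k : ℝ) < 2 := by
      by_contra! h2
      nlinarith
    have h2 : k < 2 := by exact_mod_cast h2
    obtain rfl : k = 1 := by omega
    refine ⟨by rw [hk, Int.cast_one, one_smul], D.mem_pos.2 ⟨?_, by rw [map_sub]; linarith⟩⟩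
    have h3 := D.sub_mem hbR ht hbt.symm (by rwa [dotProduct_comm])
    exact h3

end OrderedRoots

/-- A finite set of vectors is separated by some linear functional. -/
theorem exists_separating_functional {N : ℕ} (R : Finset (Fin N → ℝ)) (h0 : 0 ∉ R) :
    ∃ f : (Fin N → ℝ) →ₗ[ℝ] ℝ, (∀ a ∈ R, f a ≠ 0) ∧ ∀ a ∈ R, ∀ b ∈ R, f a = f b → a = b := by
  classical
  obtain ⟨f, hf⟩ := Module.exists_dual_forall_apply_ne_zero (K := ℝ)
    (fun p : {p : (insert 0 R ×ˢ R : Finset ((Fin N → ℝ) × (Fin N → ℝ))) // p.1.2 ≠ p.1.1} =>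
      p.1.1.2 - p.1.1.1) fun p => sub_ne_zero.2 p.2
  have key : ∀ a ∈ insert 0 R, ∀ b ∈ R, f a = f b → a = b := fun a ha b hb h => by
    by_contra hne
    exact hf ⟨⟨(a, b), Finset.mem_product.2 ⟨ha, hb⟩⟩, fun h => hne h.symm⟩
      (by rw [map_sub, h, sub_self])
  refine ⟨f, fun a ha h => h0 ?_, fun a ha => key a (Finset.mem_insert_of_mem ha)⟩
  rwa [key 0 (Finset.mem_insert_self _ _) a ha (by rw [h, map_zero])]

section Complexification

variable {N : ℕ}

/-- The inclusion `ℝ^N ⊂ ℂ^N`. -/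
def cx : (Fin N → ℝ) →ₗ[ℝ] (Fin N → ℂ) where
  toFun a i := (a i : ℂ)
  map_add' a b := by ext; simp
  map_smul' c a := by ext; simp

theorem cx_apply (a : Fin N → ℝ) (i : Fin N) : cx a i = (a i : ℂ) := rfl

theorem cx_injective : Function.Injective (cx : (Fin N → ℝ) → (Fin N → ℂ)) := fun a b h => by
  ext i
  exact Complex.ofReal_injective (congrFun h i)

theorem cx_dot (a b : Fin N → ℝ) : cx a ⬝ᵥ cx b = ((a ⬝ᵥ b : ℝ) : ℂ) := by
  simp [dotProduct, cx_apply]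

theorem cx_smul (c : ℝ) (a : Fin N → ℝ) : cx (c • a) = (c : ℂ) • cx a := by
  ext i; simp [cx_apply]

theorem cx_single (i : Fin N) : cx (Pi.single i 1) = Pi.single i 1 := by
  ext j
  rw [cx_apply, Pi.single_apply, Pi.single_apply]
  split_ifs <;> simp

/-- A complex subspace containing the complexification of a spanning set is everything. -/
theorem eq_top_of_cx_mem {S : Set (Fin N → ℝ)} (hS : Submodule.span ℝ S = ⊤)
    {U : Submodule ℂ (Fin N → ℂ)} (h : ∀ a ∈ S, cx a ∈ U) : U = ⊤ := by
  have h1 : ⊤ ≤ (U.restrictScalars ℝ).comap cx := hS ▸ Submodule.span_le.2 h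
  refine eq_top_iff.2 fun v _ => ?_
  rw [pi_eq_sum_univ' v]
  refine sum_mem fun i _ => U.smul_mem _ ?_
  have h2 : cx (Pi.single i (1 : ℝ)) ∈ U := h1 Submodule.mem_top
  rwa [cx_single] at h2

/-- The matrix of the orthogonal reflection in `a`. -/
def reflMat (a : Fin N → ℂ) : Matrix (Fin N) (Fin N) ℂ :=
  1 - Matrix.vecMulVec a ((2 / (a ⬝ᵥ a)) • a)

theorem reflMat_mulVec (a v : Fin N → ℂ) :
    (reflMat a).mulVec v = v - (2 * (a ⬝ᵥ v) / (a ⬝ᵥ a)) • a := by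
  rw [reflMat, Matrix.sub_mulVec, Matrix.one_mulVec, Matrix.vecMulVec_mulVec]
  congr 1
  ext i
  simp
  ring

theorem reflMat_mul_self (a : Fin N → ℂ) : reflMat a * reflMat a = 1 := by
  refine Matrix.ext_of_mulVec_single fun i => ?_
  rw [← Matrix.mulVec_mulVec, Matrix.one_mulVec, reflMat_mulVec, reflMat_mulVec]
  generalize (Pi.single i 1 : Fin N → ℂ) = v
  rcases eq_or_ne (a ⬝ᵥ a) 0 with h | h
  · simp [h]
  · rw [dotProduct_sub, dotProduct_smul, smul_eq_mul, div_mul_cancel₀ _ h]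
    module

theorem reflMat_transpose (a : Fin N → ℂ) : (reflMat a).transpose = reflMat a := by
  ext i j
  simp only [reflMat, Matrix.transpose_apply, Matrix.sub_apply, Matrix.one_apply, eq_comm,
    Matrix.vecMulVec_apply, Pi.smul_apply, smul_eq_mul]
  ring

theorem reflMat_cx (a b : Fin N → ℝ) : (reflMat (cx a)).mulVec (cx b) =
    cx (b - (2 * (a ⬝ᵥ b) / (a ⬝ᵥ a)) • a) := by
  rw [reflMat_mulVec, map_sub, cx_smul, cx_dot, cx_dot]
  push_cast
  rfl

/-- The reflection in `a` as an invertible matrix. -/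
def reflUnit (a : Fin N → ℂ) : (Matrix (Fin N) (Fin N) ℂ)ˣ :=
  ⟨reflMat a, reflMat a, reflMat_mul_self a, reflMat_mul_self a⟩

end Complexification

namespace OrderedRoots

variable {N : ℕ} (D : OrderedRoots N)

/-- The complexified roots. -/
def croots : Finset (Fin N → ℂ) := D.R.image cx

theorem mem_croots {a : Fin N → ℂ} : a ∈ D.croots ↔ ∃ b ∈ D.R, cx b = a := Finset.mem_image

/-- The Weyl group. -/
def weyl : Subgroup (Matrix (Fin N) (Fin N) ℂ)ˣ :=
  Subgroup.closure (reflUnit '' (D.croots : Set (Fin N → ℂ)))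

theorem weyl_induction {P : Matrix (Fin N) (Fin N) ℂ → Prop} (h1 : P 1)
    (hs : ∀ a ∈ D.R, P (reflMat (cx a))) (hm : ∀ g h, P g → P h → P (g * h))
    (w : D.weyl) : P (w : (Matrix (Fin N) (Fin N) ℂ)ˣ) := by
  obtain ⟨w, hw⟩ := w
  induction hw using Subgroup.closure_induction'' with
  | mem x hx =>
    obtain ⟨_, hx, rfl⟩ := hx
    obtain ⟨a, ha, rfl⟩ := D.mem_croots.1 hx
    exact hs a ha
  | inv_mem x hx =>
    obtain ⟨_, hx, rfl⟩ := hx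
    obtain ⟨a, ha, rfl⟩ := D.mem_croots.1 hx
    exact hs a ha
  | one => exact h1
  | mul x y _ _ hx hy => exact hm _ _ hx hy

theorem weyl_orth (w : D.weyl) : (w : (Matrix (Fin N) (Fin N) ℂ)ˣ).val.transpose *
    (w : (Matrix (Fin N) (Fin N) ℂ)ˣ).val = 1 := by
  refine D.weyl_induction (P := fun g => g.transpose * g = 1) (by simp) (fun a _ => ?_)
    (fun g h hg hh => ?_) w
  · rw [reflMat_transpose, reflMat_mul_self]
  · rw [Matrix.transpose_mul, Matrix.mul_assoc, ← Matrix.mul_assoc g.transpose, hg,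
      Matrix.one_mul, hh]

theorem weyl_stab {m : (Fin N → ℝ) → ℕ} (hm : ∀ a ∈ D.R, ∀ b ∈ D.R,
    m (b - (2 * (a ⬝ᵥ b) / (a ⬝ᵥ a)) • a) = m b) (w : D.weyl) : ∀ b ∈ D.R, ∃ c ∈ D.R,
      (w : (Matrix (Fin N) (Fin N) ℂ)ˣ).val.mulVec (cx b) = cx c ∧ m c = m b := by
  refine D.weyl_induction (P := fun g => ∀ b ∈ D.R, ∃ c ∈ D.R, g.mulVec (cx b) = cx c ∧ m c = m b)
    (fun b hb => ⟨b, hb, Matrix.one_mulVec _, rfl⟩) (fun a ha b hb => ?_)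
    (fun g h hg hh b hb => ?_) w
  · exact ⟨_, D.refl_mem a ha b hb, reflMat_cx a b, hm a ha b hb⟩
  · obtain ⟨c, hc, h1, h2⟩ := hh b hb
    obtain ⟨d, hd, h3, h4⟩ := hg c hc
    exact ⟨d, hd, by rw [← Matrix.mulVec_mulVec, h1, h3], h4.trans h2⟩

theorem finite_weyl (hspan : Submodule.span ℝ (D.R : Set (Fin N → ℝ)) = ⊤) : Finite D.weyl := by
  have hst := fun w => D.weyl_stab (m := fun _ => 0) (fun _ _ _ _ => rfl) w
  choose F hF hF' using hst
  refine Finite.of_injective (β := D.R → D.R) (fun w b => ⟨F w b b.2, hF w b b.2⟩) fun w w' h => ?_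
  refine Subtype.ext (Units.ext (Matrix.ext_of_mulVec_single fun i => ?_))
  have h1 := eq_top_of_cx_mem hspan (U := LinearMap.eqLocus
    (w : (Matrix (Fin N) (Fin N) ℂ)ˣ).val.mulVecLin
    (w' : (Matrix (Fin N) (Fin N) ℂ)ˣ).val.mulVecLin) fun a ha => by
      have h2 := congrArg Subtype.val (congrFun h ⟨a, ha⟩)
      dsimp only at h2
      rw [LinearMap.mem_eqLocus, Matrix.mulVecLin_apply, Matrix.mulVecLin_apply,
        (hF' w a ha).1, (hF' w' a ha).1, h2]
  have h2 : Pi.single i (1 : ℂ) ∈ (⊤ : Submodule ℂ (Fin N → ℂ)) := Submodule.mem_top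
  rw [← h1] at h2
  exact h2

open scoped Classical in
/-- The reflections as elements of the Weyl group. -/
def wrefl (a : Fin N → ℂ) : D.weyl :=
  if h : a ∈ D.croots then ⟨reflUnit a, Subgroup.subset_closure ⟨a, h, rfl⟩⟩ else 1

theorem wrefl_val {a : Fin N → ℂ} (h : a ∈ D.croots) :
    ((D.wrefl a : (Matrix (Fin N) (Fin N) ℂ)ˣ) : Matrix (Fin N) (Fin N) ℂ) = reflMat a := by
  rw [wrefl, dif_pos h]
  rfl

theorem weyl_ext {w w' : D.weyl} (h : ((w : (Matrix (Fin N) (Fin N) ℂ)ˣ) :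
    Matrix (Fin N) (Fin N) ℂ) = (w' : (Matrix (Fin N) (Fin N) ℂ)ˣ)) : w = w' :=
  Subtype.ext (Units.ext h)

theorem cx_mem {a : Fin N → ℝ} (h : a ∈ D.R) : cx a ∈ D.croots := D.mem_croots.2 ⟨a, h, rfl⟩

theorem wrefl_neg {a : Fin N → ℝ} (h : a ∈ D.R) : D.wrefl (cx (-a)) = D.wrefl (cx a) := by
  refine D.weyl_ext ?_
  rw [D.wrefl_val (D.cx_mem h), D.wrefl_val (D.cx_mem (D.neg_mem h)), map_neg, reflMat, reflMat]
  simp [Matrix.vecMulVec_neg, Matrix.neg_vecMulVec]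

theorem wrefl_conj {a b : Fin N → ℝ} (ha : a ∈ D.R) (hb : b ∈ D.R) : D.wrefl (cx b) =
    D.wrefl (cx a) * D.wrefl (cx (b - (2 * (a ⬝ᵥ b) / (a ⬝ᵥ a)) • a)) * D.wrefl (cx a) := by
  refine D.weyl_ext ?_
  have ha0 : cx a ⬝ᵥ cx a ≠ 0 := by
    rw [cx_dot]
    exact_mod_cast (D.dot_pos ha).ne'
  rw [Subgroup.coe_mul, Subgroup.coe_mul, Units.val_mul, Units.val_mul,
    D.wrefl_val (D.cx_mem ha), D.wrefl_val (D.cx_mem hb),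
    D.wrefl_val (D.cx_mem (D.refl_mem a ha b hb)), ← reflMat_cx]
  set A := reflMat (cx a) with hA
  have hAA : A * A = 1 := reflMat_mul_self _
  have hdot : ∀ u v, A.mulVec u ⬝ᵥ v = u ⬝ᵥ A.mulVec v := fun u v => by
    rw [Matrix.dotProduct_mulVec, ← Matrix.mulVec_transpose, hA, reflMat_transpose]
  refine Matrix.ext_of_mulVec_single fun i => ?_
  generalize (Pi.single i 1 : Fin N → ℂ) = v
  rw [← Matrix.mulVec_mulVec, ← Matrix.mulVec_mulVec, reflMat_mulVec, reflMat_mulVec _ (A.mulVec v),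
    Matrix.mulVec_sub, Matrix.mulVec_smul, Matrix.mulVec_mulVec, hAA, Matrix.one_mulVec,
    Matrix.mulVec_mulVec, hAA, Matrix.one_mulVec, hdot, hdot, Matrix.mulVec_mulVec, hAA,
    Matrix.one_mulVec, Matrix.mulVec_mulVec, hAA, Matrix.one_mulVec]

theorem closure_simple : Subgroup.closure (D.wrefl '' (D.simple.image cx : Finset (Fin N → ℂ))) =
    ⊤ := by
  set G := Subgroup.closure (D.wrefl '' (D.simple.image cx : Finset (Fin N → ℂ))) with hG
  have hs : ∀ a ∈ D.simple, D.wrefl (cx a) ∈ G := fun a ha =>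
    Subgroup.subset_closure ⟨_, Finset.mem_coe.2 (Finset.mem_image_of_mem _ ha), rfl⟩
  have hp : ∀ a ∈ D.pos, D.wrefl (cx a) ∈ G := fun a ha =>
    D.pos_induction (P := fun a => D.wrefl (cx a) ∈ G) hs (fun a ha b hb h => by
      rw [D.wrefl_conj (D.mem_pos.1 (D.mem_simple.1 ha).1).1 (D.mem_pos.1 hb).1]
      exact mul_mem (mul_mem (hs a ha) h) (hs a ha)) ha
  refine eq_top_iff.2 ?_
  refine (Subgroup.closure_closure_coe_preimage
    (k := reflUnit '' (D.croots : Set (Fin N → ℂ)))).ge.trans ((Subgroup.closure_le _).2 ?_)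
  rintro w ⟨_, hw', hw⟩
  obtain ⟨a, ha, rfl⟩ := D.mem_croots.1 hw'
  have hwa : w = D.wrefl (cx a) := D.weyl_ext (by rw [D.wrefl_val (D.cx_mem ha), ← hw]; rfl)
  rw [hwa]
  rcases D.pos_or_neg ha with h | h
  · exact hp a h
  · rw [← D.wrefl_neg ha]
    exact hp _ h

theorem weyl_irr (hspan : Submodule.span ℝ (D.R : Set (Fin N → ℝ)) = ⊤)
    (hirr : ∀ U : Submodule ℝ (Fin N → ℝ),
      (∀ a ∈ D.R, ∀ v ∈ U, v - (2 * (a ⬝ᵥ v) / (a ⬝ᵥ a)) • a ∈ U) → U = ⊥ ∨ U = ⊤)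
    (U : Submodule ℂ (Fin N → ℂ)) (hU : ∀ w : D.weyl, ∀ v ∈ U,
      (w : (Matrix (Fin N) (Fin N) ℂ)ˣ).val.mulVec v ∈ U) : U = ⊥ ∨ U = ⊤ := by
  have hU' : ∀ a ∈ D.R, ∀ v ∈ U, (reflMat (cx a)).mulVec v ∈ U := fun a ha v hv => by
    rw [← D.wrefl_val (D.cx_mem ha)]
    exact hU _ v hv
  by_cases hroot : ∃ a ∈ D.R, cx a ∈ U
  · right
    obtain ⟨a₀, ha₀, hU₀⟩ := hroot
    rcases hirr ((U.restrictScalars ℝ).comap cx) (fun a ha v hv => by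
      rw [Submodule.mem_comap, ← reflMat_cx]
      exact hU' a ha _ hv) with h | h
    · refine absurd ?_ (D.ne_zero ha₀)
      rw [← Submodule.mem_bot ℝ, ← h]
      exact hU₀
    · refine eq_top_of_cx_mem (S := Set.univ) Submodule.span_univ fun a _ => ?_
      have h1 : a ∈ (U.restrictScalars ℝ).comap cx := h ▸ Submodule.mem_top
      exact h1
  · left
    push Not at hroot
    refine (Submodule.eq_bot_iff U).2 fun v hv => ?_
    have h0 : ∀ a ∈ D.R, v ⬝ᵥ cx a = 0 := fun a ha => by
      by_contra hne
      have h1 := U.sub_mem hv (hU' a ha v hv)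
      rw [reflMat_mulVec, sub_sub_cancel] at h1
      refine hroot a ha ((U.smul_mem_iff (div_ne_zero (mul_ne_zero two_ne_zero ?_) ?_)).1 h1)
      · rwa [dotProduct_comm]
      · rw [cx_dot]
        exact_mod_cast (D.dot_pos ha).ne'
    have h1 := eq_top_of_cx_mem hspan
      (U := LinearMap.ker (dotProductBilin ℂ ℂ v)) fun a ha => h0 a ha
    ext i
    have h2 : Pi.single i (1 : ℂ) ∈ (⊤ : Submodule ℂ (Fin N → ℂ)) := Submodule.mem_top
    rw [← h1, LinearMap.mem_ker] at h2
    simpa using h2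

theorem exists_rootData (hne : D.R.Nonempty)
    (hspan : Submodule.span ℝ (D.R : Set (Fin N → ℝ)) = ⊤)
    (hirr : ∀ U : Submodule ℝ (Fin N → ℝ),
      (∀ a ∈ D.R, ∀ v ∈ U, v - (2 * (a ⬝ᵥ v) / (a ⬝ᵥ a)) • a ∈ U) → U = ⊥ ∨ U = ⊤)
    {m : (Fin N → ℝ) → ℕ} (hm : ∀ a ∈ D.R, ∀ b ∈ D.R,
      m (b - (2 * (a ⬝ᵥ b) / (a ⬝ᵥ a)) • a) = m b) :
    ∃ E : RootData N D.weyl, E.roots = D.croots ∧ ∀ a, E.m (cx a) = m a := by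
  obtain ⟨t, ht, htop⟩ := D.exists_top hne
  have hre : ∀ a : Fin N → ℝ, (fun i => (cx a i).re) = a := fun a => rfl
  have hsp : ∀ {a}, a ∈ D.pos → a ∈ D.R := fun h => (D.mem_pos.1 h).1
  have hval : ∀ {a}, a ∈ D.R → ((D.wrefl (cx a) : (Matrix (Fin N) (Fin N) ℂ)ˣ) :
    Matrix (Fin N) (Fin N) ℂ) = reflMat (cx a) := fun h => D.wrefl_val (D.cx_mem h)
  have himg : ∀ {S : Finset (Fin N → ℝ)} {a}, cx a ∈ S.image cx ↔ a ∈ S := fun {S a} => by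
    rw [Finset.mem_image]
    exact ⟨fun ⟨b, hb, h⟩ => cx_injective h ▸ hb, fun h => ⟨a, h, rfl⟩⟩
  refine ⟨{
    roots := D.croots
    pos := D.pos.image cx
    simple := D.simple.image cx
    top := cx t
    m := fun v => m fun i => (v i).re
    g := (Units.coeHom _).comp D.weyl.subtype
    s := D.wrefl
    orth := D.weyl_orth
    faithful := fun w w' h => D.weyl_ext h
    sq_ne := ?_
    g_s := fun a ha => D.wrefl_val ha
    stab := ?_
    m_inv := ?_
    reduced := ?_
    irr := D.weyl_irr hspan hirr
    mem_roots := ?_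
    pos_disj := ?_
    simple_pos := ?_
    simple_perm := ?_
    gen := D.closure_simple
    top_pos := himg.2 ht
    top_pair := ?_ }, rfl, fun a => rfl⟩
  · refine Finset.forall_mem_image.2 fun a ha => ?_
    rw [cx_dot]
    exact_mod_cast (D.dot_pos ha).ne'
  · intro w
    refine Finset.forall_mem_image.2 fun a ha => ?_
    obtain ⟨c, hc, h, -⟩ := D.weyl_stab hm w a ha
    exact D.mem_croots.2 ⟨c, hc, h.symm⟩
  · intro w
    refine Finset.forall_mem_image.2 fun a ha => ?_
    obtain ⟨c, hc, h, h'⟩ := D.weyl_stab hm w a ha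
    change m (fun i => ((w : (Matrix (Fin N) (Fin N) ℂ)ˣ).val.mulVec (cx a) i).re) = m a
    rw [h]
    exact h'
  · refine Finset.forall_mem_image.2 fun a ha c hc => ?_
    obtain ⟨b, hb, hb'⟩ := D.mem_croots.1 hc
    obtain ⟨i, hi⟩ := Function.ne_iff.1 (D.ne_zero ha)
    have hci : c = ((b i / a i : ℝ) : ℂ) := by
      have h1 := congrFun hb' i
      rw [cx_apply, Pi.smul_apply, cx_apply, smul_eq_mul] at h1
      rw [Complex.ofReal_div, h1, mul_div_cancel_right₀]
      exact_mod_cast hi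
    rw [hci, ← cx_smul] at hb'
    rcases D.reduced a ha _ (cx_injective hb' ▸ hb) with h | h
    · left; rw [hci, h, Complex.ofReal_one]
    · right; rw [hci, h, Complex.ofReal_neg, Complex.ofReal_one]
  · intro a
    constructor
    · intro h
      obtain ⟨a, ha, rfl⟩ := D.mem_croots.1 h
      rw [← map_neg, himg, himg]
      exact D.pos_or_neg ha
    · rintro (h | h)
      · obtain ⟨a, ha, rfl⟩ := Finset.mem_image.1 h
        exact D.cx_mem (hsp ha)
      · obtain ⟨b, hb, h⟩ := Finset.mem_image.1 h
        rw [← neg_neg a, ← h, ← map_neg]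
        exact D.cx_mem (D.neg_mem (hsp hb))
  · refine Finset.forall_mem_image.2 fun a ha h => ?_
    rw [← map_neg, himg, D.mem_pos, map_neg] at h
    linarith [h.2, (D.mem_pos.1 ha).2]
  · exact Finset.image_subset_image fun a ha => (D.mem_simple.1 ha).1
  · refine Finset.forall_mem_image.2 fun a ha => Finset.forall_mem_image.2 fun b hb h => ?_
    change (D.wrefl (cx a) : (Matrix (Fin N) (Fin N) ℂ)ˣ).val.mulVec (cx b) ∈ _
    rw [hval (hsp (D.mem_simple.1 ha).1), reflMat_cx, himg]
    exact D.simple_perm ha hb fun h' => h (h' ▸ rfl)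
  · refine Finset.forall_mem_image.2 fun b hb h => ?_
    change (D.wrefl (cx t) : (Matrix (Fin N) (Fin N) ℂ)ˣ).val.mulVec (cx b) = _ ∨
      (D.wrefl (cx t) : (Matrix (Fin N) (Fin N) ℂ)ˣ).val.mulVec (cx b) = _ ∧ _
    rw [hval (hsp ht), reflMat_cx, ← map_sub, ← map_sub, himg, cx_injective.eq_iff,
      cx_injective.eq_iff]
    exact htop b hb fun h' => h (h' ▸ rfl)

end OrderedRoots

section Cone

variable {N : ℕ}

theorem linPoly_coneVec (a : Fin N → ℝ) (j : ℤ) : linPoly (coneVec a j) = aff (cx a) j := rfl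

theorem sum_coneVec (a : Fin N → ℝ) (j : ℤ) (g : Fin (N + 1) → Pol (N + 1)) :
    ∑ i, C (coneVec a j i) * g i =
      pair (cx a) (fun i : Fin N => g i.castSucc) - C (j : ℂ) * g (Fin.last N) := by
  rw [Fin.sum_univ_castSucc, pair_apply]
  simp only [coneVec, Fin.snoc_castSucc, Fin.snoc_last, map_neg, neg_mul, smul_eq_C_mul, cx_apply,
    sub_eq_add_neg]

/-- The fields of a basis of the vertical fields, completed by the Euler field. -/
def withEuler (Θ : Fin N → Fin N → Pol (N + 1)) : Fin (N + 1) → Fin (N + 1) → Pol (N + 1) :=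
  Fin.snoc (fun k => Fin.snoc (Θ k) 0) X

theorem sum_withEuler_castSucc (Θ : Fin N → Fin N → Pol (N + 1)) (c : Fin (N + 1) → Pol (N + 1))
    (i : Fin N) : ∑ k, c k * withEuler Θ k i.castSucc =
      (∑ k : Fin N, c k.castSucc • Θ k) i + c (Fin.last N) * X i.castSucc := by
  simp [Fin.sum_univ_castSucc, withEuler]

theorem sum_withEuler_last (Θ : Fin N → Fin N → Pol (N + 1)) (c : Fin (N + 1) → Pol (N + 1)) :
    ∑ k, c k * withEuler Θ k (Fin.last N) = c (Fin.last N) * X (Fin.last N) := by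
  simp [Fin.sum_univ_castSucc, withEuler]

end Cone
/-- the cone `cCat` of the extended Catalan arrangement is free: the module
of logarithmic vector fields on `ℂ^{N+1}` (with coordinates `x_1,…,x_N,z`) is a free
`ℂ[x_1,…,x_N,z]`-module of rank `N+1`. A vector field is encoded by its coefficient
vector `g : Fin (N+1) → ℂ[x,z]` (the last index corresponding to `∂_z`), and for a linear
form `ℓ` with coefficient vector `u`, `L(ℓ) = Σ u_i g_i`.  The hyperplane `(α,x) = jz`
has coefficient vector `coneVec α j`. -/
theorem stmt_13 (N : ℕ) (hN : 0 < N)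
    -- `R` is a reduced crystallographic root system spanning `ℝ^N`, acting irreducibly
    (R : Finset (Fin N → ℝ)) (hR0 : (0 : Fin N → ℝ) ∉ R)
    (hspan : Submodule.span ℝ (R : Set (Fin N → ℝ)) = ⊤)
    (hreduced : ∀ a ∈ R, ∀ c : ℝ, c • a ∈ R → c = 1 ∨ c = -1)
    (hrefl : ∀ a ∈ R, ∀ b ∈ R,
      (b - (2 * (∑ i, a i * b i) / (∑ i, a i * a i)) • a) ∈ R)
    (hcrys : ∀ a ∈ R, ∀ b ∈ R, ∃ k : ℤ,
      2 * (∑ i, a i * b i) / (∑ i, b i * b i) = (k : ℝ))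
    (hirr : ∀ U : Submodule ℝ (Fin N → ℝ),
      (∀ a ∈ R, ∀ v ∈ U, (v - (2 * (∑ i, a i * v i) / (∑ i, a i * a i)) • a) ∈ U) →
      U = ⊥ ∨ U = ⊤)
    -- `R_+` is a choice of positive roots
    (Rp : Finset (Fin N → ℝ))
    (hRp : ∀ a, a ∈ R ↔ (a ∈ Rp ∨ -a ∈ Rp)) (hRpdisj : ∀ a, ¬(a ∈ Rp ∧ -a ∈ Rp))
    -- `m` is a `W`-invariant multiplicity function
    (m : (Fin N → ℝ) → ℕ)
    (hminv : ∀ a ∈ R, ∀ b ∈ R,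
      m (b - (2 * (∑ i, a i * b i) / (∑ i, a i * a i)) • a) = m b) :
    ∃ θ : Fin (N + 1) → (Fin (N + 1) → MvPolynomial (Fin (N + 1)) ℂ),
      -- each `θ_k` is logarithmic for every hyperplane `(α,x) = jz` of `cCat`
      (∀ k, ∀ a ∈ Rp, ∀ j : ℤ, -(m a : ℤ) ≤ j → j ≤ (m a : ℤ) →
        linPoly (coneVec a j) ∣ ∑ i, MvPolynomial.C (coneVec a j i) * θ k i) ∧
      -- and for the hyperplane `z = 0`
      (∀ k, MvPolynomial.X (Fin.last N) ∣ θ k (Fin.last N)) ∧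
      -- the `θ_k` generate `D(cCat)` over `ℂ[x_1,…,x_N,z]`
      (∀ g : Fin (N + 1) → MvPolynomial (Fin (N + 1)) ℂ,
        (∀ a ∈ Rp, ∀ j : ℤ, -(m a : ℤ) ≤ j → j ≤ (m a : ℤ) →
          linPoly (coneVec a j) ∣ ∑ i, MvPolynomial.C (coneVec a j i) * g i) →
        MvPolynomial.X (Fin.last N) ∣ g (Fin.last N) →
        ∃ c : Fin (N + 1) → MvPolynomial (Fin (N + 1)) ℂ, ∀ i, g i = ∑ k, c k * θ k i) ∧
      -- and they are independent, so `D(cCat)` is free of rank `N+1`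
      (∀ c : Fin (N + 1) → MvPolynomial (Fin (N + 1)) ℂ,
        (∀ i, (∑ k, c k * θ k i) = 0) → ∀ k, c k = 0) := by
  obtain ⟨f, hf, hf'⟩ := exists_separating_functional R hR0
  let D : OrderedRoots N := ⟨R, f, hreduced, hrefl, hcrys, hf, hf'⟩
  have hne : R.Nonempty := by
    by_contra h
    rw [Finset.not_nonempty_iff_eq_empty.1 h, Finset.coe_empty, Submodule.span_empty] at hspan
    have h1 : Pi.single ⟨0, hN⟩ (1 : ℝ) ∈ (⊤ : Submodule ℝ (Fin N → ℝ)) := Submodule.mem_top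
    rw [← hspan, Submodule.mem_bot] at h1
    simpa using congrFun h1 ⟨0, hN⟩
  have := D.finite_weyl hspan
  obtain ⟨E, hE, hm⟩ := D.exists_rootData hne hspan hirr hminv
  obtain ⟨Θ, hΘ, hgen, hind⟩ := E.exists_cat_basis
  have hmem : ∀ a ∈ R, cx a ∈ E.roots := fun a ha => hE ▸ D.cx_mem ha
  have hRpR : ∀ a ∈ Rp, a ∈ R := fun a ha => (hRp a).2 (Or.inl ha)
  have hcat : ∀ φ : Fin N → Pol (N + 1), (∀ a ∈ Rp, ∀ j : ℤ, -(m a : ℤ) ≤ j → j ≤ m a →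
      aff (cx a) j ∣ pair (cx a) φ) → φ ∈ E.cat := fun φ h b hb j hj hj' => by
    rw [hE] at hb
    obtain ⟨a, ha, rfl⟩ := D.mem_croots.1 hb
    rw [hm] at hj hj'
    rcases (hRp a).1 ha with h1 | h1
    · exact h a h1 j hj hj'
    · have h2 : m (-a) = m a := by
        rw [← hm, ← hm, map_neg]
        exact E.m_neg (hmem a ha)
      have h3 := RootData.aff_dvd_neg (h _ h1 (-j) (by rw [h2]; omega) (by rw [h2]; omega))
      simpa using h3
  have hX : (X (Fin.last N) : Pol (N + 1)) ≠ 0 := X_ne_zero _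
  refine ⟨withEuler Θ, fun k a ha j hj hj' => ?_, fun k => ?_, fun g hg hz => ?_, fun c hc => ?_⟩
  · rw [linPoly_coneVec]
    refine Fin.lastCases ?_ (fun k => ?_) k
    · simp only [withEuler, Fin.snoc_last]
      exact dvd_rfl
    · rw [sum_coneVec]
      simp only [withEuler, Fin.snoc_castSucc, Fin.snoc_last, mul_zero, sub_zero]
      exact hΘ k _ (hmem a (hRpR a ha)) j (by rwa [hm]) (by rwa [hm])
  · refine Fin.lastCases ?_ (fun k => ?_) k <;> simp [withEuler]
  · obtain ⟨q, hq⟩ := hz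
    have h1 : (fun i : Fin N => g i.castSucc - q * X i.castSucc) ∈ E.cat := by
      refine hcat _ fun a ha j hj hj' => ?_
      have h2 := (hg a ha j hj hj').sub (Dvd.intro_left q (rfl : q * linPoly (coneVec a j) = _))
      rw [linPoly_coneVec] at h2
      refine h2.trans (dvd_of_eq ?_)
      rw [← linPoly_coneVec, linPoly, sum_coneVec, sum_coneVec, hq]
      simp only [pair_apply, smul_sub, Finset.sum_sub_distrib, mul_sub, Finset.mul_sum,
        mul_smul_comm]
      ring
    obtain ⟨c, hc⟩ := hgen _ h1
    refine ⟨Fin.snoc c q, Fin.lastCases ?_ fun i => ?_⟩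
    · rw [sum_withEuler_last, Fin.snoc_last, hq, mul_comm]
    · rw [sum_withEuler_castSucc, Fin.snoc_last]
      simp only [Fin.snoc_castSucc]
      rw [← hc]
      ring
  · have h1 : c (Fin.last N) = 0 := by
      have h2 := hc (Fin.last N)
      rw [sum_withEuler_last] at h2
      exact (mul_eq_zero.1 h2).resolve_right hX
    have h2 := hind (fun k => c k.castSucc) (by
      ext1 i
      have h3 := hc i.castSucc
      rwa [sum_withEuler_castSucc, h1, zero_mul, add_zero] at h3)
    exact Fin.lastCases h1 fun k => congrFun h2 k

end
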